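/- Let Ω := ℝ × (−1,1) ⊂ ℝ² and let S := sup { ∫_Ω (e^{4π u(x)²} − 1) dx : u ∈ C_c^∞(Ω), ∫_Ω |∇u(x)|² dx ≤ 1 } (which is finite). Then the supremum is attained by a function of H¹_0(Ω): there exist a measurable function ũ : Ω → ℝ and a sequence (φ_j) in C_c^∞(Ω) with ∫_Ω |∇φ_j(x)|² dx ≤ 1 for every j and φ_j → ũ almost everywhere in Ω, such that ∫_Ω (e^{4π ũ(x)²} − 1) dx = S. -/

import Mathlib

open MeasureTheory Real Filter

/-- The infinite planar strip `Ω = ℝ × (-1,1) ⊂ ℝ²`. -/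
def strip : Set (EuclideanSpace ℝ (Fin 2)) := {x | x 1 ∈ Set.Ioo (-1 : ℝ) 1}

/-- `u ∈ C_c^∞(Ω)`: smooth, compactly supported, with support contained in `Ω`. -/
def IsTest (Ω : Set (EuclideanSpace ℝ (Fin 2)))
    (u : EuclideanSpace ℝ (Fin 2) → ℝ) : Prop :=
  ContDiff ℝ (⊤ : ℕ∞) u ∧ HasCompactSupport u ∧ tsupport u ⊆ Ω


section Aux
open MeasureTheory Real Filter Set Topology ContDiff

/-- Admissible slope for the one-dimensional problem. -/
structure Slope (g : ℝ → ℝ) (C R : ℝ) : Prop where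
  meas : Measurable g
  nonneg : ∀ s, 0 ≤ g s
  le : ∀ s, g s ≤ C
  zero : ∀ s, R < s → g s = 0
  C0 : 0 ≤ C
  R0 : 0 ≤ R

namespace Slope
variable {g : ℝ → ℝ} {C R : ℝ}

lemma locInt (h : Slope g C R) (a b : ℝ) : IntervalIntegrable g volume a b := by
  rw [intervalIntegrable_iff]
  apply Measure.integrableOn_of_bounded (M := C) (by simp) h.meas.aestronglyMeasurable
  exact ae_of_all _ fun x => by rw [Real.norm_eq_abs, abs_of_nonneg (h.nonneg x)]; exact h.le x

lemma int_Ioi (h : Slope g C R) (a : ℝ) : IntegrableOn g (Ioi a) := by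
  have : IntegrableOn g (Icc a (max a R)) := by
    apply Measure.integrableOn_of_bounded (M := C) (by simp) h.meas.aestronglyMeasurable
    exact ae_of_all _ fun x => by rw [Real.norm_eq_abs, abs_of_nonneg (h.nonneg x)]; exact h.le x
  have h2 : IntegrableOn g (Ioi (max a R)) := by
    apply IntegrableOn.congr_fun (f := fun _ => (0:ℝ)) integrableOn_zero
    · intro x hx; exact (h.zero x (lt_of_le_of_lt (le_max_right _ _) hx)).symm
    · exact measurableSet_Ioi
  apply (this.union h2).mono_set
  intro x hx
  by_cases hh : x ≤ max a R
  · left; exact ⟨le_of_lt hx, hh⟩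
  · right; exact not_le.mp hh

lemma sq_int_Ioi (h : Slope g C R) (a : ℝ) : IntegrableOn (fun s => g s ^ 2) (Ioi a) := by
  have := (h.int_Ioi a).const_mul C
  apply this.mono' (h.meas.pow_const 2).aestronglyMeasurable
  exact ae_of_all _ fun x => by
    rw [Real.norm_eq_abs, abs_of_nonneg (sq_nonneg _), sq]
    exact mul_le_mul_of_nonneg_right (h.le x) (h.nonneg x)

lemma prim_cont (h : Slope g C R) : Continuous (fun t => ∫ s in (0:ℝ)..t, g s) :=
  intervalIntegral.continuous_primitive (fun a b => h.locInt a b) 0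

lemma prim_nonneg (h : Slope g C R) {t : ℝ} (ht : 0 ≤ t) : 0 ≤ ∫ s in (0:ℝ)..t, g s :=
  intervalIntegral.integral_nonneg ht (fun x _ => h.nonneg x)

lemma prim_mono (h : Slope g C R) {a b : ℝ} (hab : a ≤ b) :
    (∫ s in (0:ℝ)..a, g s) ≤ ∫ s in (0:ℝ)..b, g s := by
  have : (∫ s in (0:ℝ)..a, g s) + (∫ s in a..b, g s) = ∫ s in (0:ℝ)..b, g s :=
    intervalIntegral.integral_add_adjacent_intervals (h.locInt _ _) (h.locInt _ _)
  have := intervalIntegral.integral_nonneg (μ := volume) hab (fun x _ => h.nonneg x)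
  linarith

lemma prim_le (h : Slope g C R) {t : ℝ} (ht : 0 ≤ t) : (∫ s in (0:ℝ)..t, g s) ≤ C * R := by
  have key : ∀ t, 0 ≤ t → t ≤ R → (∫ s in (0:ℝ)..t, g s) ≤ C * R := by
    intro t ht htR
    have := intervalIntegral.integral_mono_on (μ := volume) ht (h.locInt 0 t)
      (by simp : IntervalIntegrable (fun _ => C) volume 0 t) (fun x _ => h.le x)
    simp at this
    nlinarith [h.C0]
  by_cases htR : t ≤ R
  · exact key t ht htR
  · push Not at htR
    have e : (∫ s in (0:ℝ)..R, g s) + (∫ s in R..t, g s) = ∫ s in (0:ℝ)..t, g s :=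
      intervalIntegral.integral_add_adjacent_intervals (h.locInt _ _) (h.locInt _ _)
    have e2 : (∫ s in R..t, g s) = 0 := by
      rw [intervalIntegral.integral_of_le htR.le]
      rw [setIntegral_congr_fun (g := fun _ => (0:ℝ)) measurableSet_Ioc
        (fun x hx => h.zero x hx.1)]
      simp
    have := key R h.R0 le_rfl
    linarith
end Slope

lemma exp_neg_int (a : ℝ) : IntegrableOn (fun t : ℝ => exp (-t)) (Ioi a) :=
  integrableOn_exp_neg_Ioi a

lemma integral_exp_neg_Ioi' (a : ℝ) : ∫ t in Ioi a, exp (-t) = exp (-a) := integral_exp_neg_Ioi a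

lemma tonelli1 {p g : ℝ → ℝ} (hp : IntegrableOn p (Ioi 0)) (hg : IntegrableOn g (Ioi 0)) :
    ∫ t in Ioi (0:ℝ), p t * (∫ s in (0:ℝ)..t, g s) =
      ∫ s in Ioi (0:ℝ), g s * (∫ t in Ioi s, p t) := by
  set μ := volume.restrict (Ioi (0:ℝ)) with hμ
  have hS : MeasurableSet {q : ℝ × ℝ | q.2 < q.1} := measurableSet_lt measurable_snd measurable_fst
  have hitg : Integrable (fun q : ℝ × ℝ => {q : ℝ × ℝ | q.2 < q.1}.indicator
      (fun q => p q.1 * g q.2) q) (μ.prod μ) := (Integrable.mul_prod hp hg).indicator hS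
  have hsw := integral_integral_swap (f := fun t s => {q : ℝ × ℝ | q.2 < q.1}.indicator
      (fun q => p q.1 * g q.2) (t, s)) hitg
  have e1 : ∀ t ∈ Ioi (0:ℝ), (∫ s, {q : ℝ × ℝ | q.2 < q.1}.indicator
      (fun q => p q.1 * g q.2) (t, s) ∂μ) = p t * (∫ s in (0:ℝ)..t, g s) := by
    intro t ht
    rw [intervalIntegral.integral_of_le (le_of_lt ht), integral_Ioc_eq_integral_Ioo,
      ← integral_const_mul, ← integral_indicator measurableSet_Ioo, hμ,
      ← integral_indicator measurableSet_Ioi]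
    congr 1; ext s
    by_cases h1 : 0 < s <;> by_cases h2 : s < t <;> simp [indicator, h1, h2]
  have e2 : ∀ s ∈ Ioi (0:ℝ), (∫ t, {q : ℝ × ℝ | q.2 < q.1}.indicator
      (fun q => p q.1 * g q.2) (t, s) ∂μ) = g s * (∫ t in Ioi s, p t) := by
    intro s hs
    rw [← integral_const_mul, ← integral_indicator (s := Ioi s) measurableSet_Ioi, hμ,
      ← integral_indicator (s := Ioi (0:ℝ)) measurableSet_Ioi]
    congr 1; ext t
    have hs' : 0 < s := hs
    by_cases h1 : s < t
    · have : 0 < t := hs'.trans h1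
      simp [indicator, h1, this, mul_comm]
    · simp [indicator, h1]
  rw [setIntegral_congr_fun measurableSet_Ioi (fun t ht => (e1 t ht).symm),
    setIntegral_congr_fun measurableSet_Ioi (fun t ht => (e2 t ht).symm)]
  exact hsw

/-- One-dimensional sharp Onofri inequality. -/
theorem onofri1 {g : ℝ → ℝ} {C R : ℝ} (h : Slope g C R) :
    IntegrableOn (fun t => exp ((∫ s in (0:ℝ)..t, g s) - t)) (Ioi 0) ∧
    ∫ t in Ioi (0:ℝ), exp ((∫ s in (0:ℝ)..t, g s) - t) ≤
      exp (1 + (1/4) * ∫ s in Ioi (0:ℝ), g s ^ 2) := by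
  set z : ℝ → ℝ := fun t => ∫ s in (0:ℝ)..t, g s with hz
  have zc : Continuous z := h.prim_cont
  have qc : Continuous (fun t => exp (z t - t)) := by fun_prop
  set B := exp (C * R) with hB
  have qle : ∀ t, 0 ≤ t → exp (z t - t) ≤ B * exp (-t) := by
    intro t ht
    rw [hB, ← exp_add]; apply exp_le_exp.2
    have := h.prim_le ht
    simp only [hz]; linarith
  have qint : IntegrableOn (fun t => exp (z t - t)) (Ioi 0) := by
    apply ((exp_neg_int 0).const_mul B).mono' qc.aestronglyMeasurable
    filter_upwards [ae_restrict_mem measurableSet_Ioi] with t ht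
    rw [Real.norm_eq_abs, abs_of_pos (exp_pos _)]
    exact qle t (le_of_lt ht)
  refine ⟨qint, ?_⟩
  set I := ∫ t in Ioi (0:ℝ), exp (z t - t) with hI
  have Ipos : 0 < I := by
    have : (1:ℝ) ≤ I := by
      have e : ∫ t in Ioi (0:ℝ), exp (-t) = 1 := by rw [integral_exp_neg_Ioi' 0]; simp
      rw [← e]
      apply setIntegral_mono_on (exp_neg_int 0) qint measurableSet_Ioi
      intro t ht
      apply exp_le_exp.2
      have := h.prim_nonneg (le_of_lt ht)
      simp only [hz]; linarith
    linarith
  set p : ℝ → ℝ := fun t => exp (z t - t) / I with hp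
  have pc : Continuous p := by fun_prop
  have ppos : ∀ t, 0 < p t := fun t => div_pos (exp_pos _) Ipos
  have pint : IntegrableOn p (Ioi 0) := qint.div_const I
  have ptot : ∫ t in Ioi (0:ℝ), p t = 1 := by
    simp only [hp]; rw [integral_div, ← hI]; field_simp
  set P : ℝ → ℝ := fun t => 1 - ∫ s in (0:ℝ)..t, p s with hP
  have Pd : ∀ t, HasDerivAt P (- p t) t := by
    intro t
    have := intervalIntegral.integral_hasDerivAt_right (pc.intervalIntegrable 0 t)
      (pc.stronglyMeasurableAtFilter _ _) pc.continuousAt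
    simpa using this.const_sub 1
  have Pc : Continuous P := continuous_iff_continuousAt.2 fun t => (Pd t).continuousAt
  have Ptail : ∀ t, 0 ≤ t → P t = ∫ s in Ioi t, p s := by
    intro t ht
    have := intervalIntegral.integral_interval_add_Ioi pint (pint.mono_set (Ioi_subset_Ioi ht))
    simp only [hP]; linarith
  have Ppos : ∀ t, 0 ≤ t → 0 < P t := by
    intro t ht
    rw [Ptail t ht]
    rw [setIntegral_pos_iff_support_of_nonneg_ae]
    · have : Function.support p = univ := by ext x; simp [(ppos x).ne']
      simp [this]
    · exact ae_of_all _ fun x => (ppos x).le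
    · exact pint.mono_set (Ioi_subset_Ioi ht)
  have Plt : ∀ t, 0 < t → P t < 1 := by
    intro t ht
    have := intervalIntegral.intervalIntegral_pos_of_pos (pc.intervalIntegrable 0 t) ppos ht
    simp only [hP]; linarith
  have P0 : P 0 = 1 := by simp [hP]
  have Ple : ∀ t, 0 ≤ t → P t ≤ B / I * exp (-t) := by
    intro t ht
    rw [Ptail t ht, ← integral_exp_neg_Ioi' t, ← integral_const_mul]
    apply setIntegral_mono_on (pint.mono_set (Ioi_subset_Ioi ht))
      ((exp_neg_int t).const_mul _) measurableSet_Ioi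
    intro x hx
    have := qle x (ht.trans (le_of_lt hx))
    simp only [hp]
    rw [div_mul_eq_mul_div]
    gcongr
  have Pint : IntegrableOn P (Ioi 0) := by
    apply ((exp_neg_int 0).const_mul (B/I)).mono' Pc.aestronglyMeasurable
    filter_upwards [ae_restrict_mem measurableSet_Ioi] with t ht
    rw [Real.norm_eq_abs, abs_of_pos (Ppos t (le_of_lt ht))]
    exact Ple t (le_of_lt ht)
  have Ple1 : ∀ t, 0 ≤ t → P t ≤ 1 := fun t ht => by
    rcases ht.eq_or_lt with h | h
    · rw [← h, P0]
    · exact (Plt t h).le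
  have P2int : IntegrableOn (fun t => P t ^ 2) (Ioi 0) := by
    apply Pint.mono' (by fun_prop : Continuous fun t => P t ^ 2).aestronglyMeasurable
    filter_upwards [ae_restrict_mem measurableSet_Ioi] with t ht
    have h1 := Ppos t (le_of_lt ht)
    have h2 := Ple1 t (le_of_lt ht)
    rw [Real.norm_eq_abs, abs_of_nonneg (sq_nonneg _)]
    nlinarith
  have Plim : Tendsto P atTop (𝓝 0) := by
    apply squeeze_zero' (g := fun t => B / I * exp (-t))
    · filter_upwards [eventually_ge_atTop 0] with t ht using (Ppos t ht).le
    · filter_upwards [eventually_ge_atTop 0] with t ht using Ple t ht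
    · have := (tendsto_exp_neg_atTop_nhds_zero).const_mul (B/I)
      simpa using this
  -- first moment
  have tpint : IntegrableOn (fun t => t * p t) (Ioi 0) := by
    have : IntegrableOn (fun t : ℝ => t * exp (-t)) (Ioi 0) := by
      have := Real.GammaIntegral_convergent (s := 2) (by norm_num)
      apply this.congr_fun _ measurableSet_Ioi
      intro x hx
      norm_num [mul_comm]
    apply (this.const_mul (B/I)).mono' (by fun_prop : Continuous fun t => t * p t).aestronglyMeasurable
    filter_upwards [ae_restrict_mem measurableSet_Ioi] with t ht
    have ht' : 0 < t := ht
    rw [Real.norm_eq_abs, abs_of_pos (mul_pos ht (ppos t))]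
    have := qle t ht'.le
    calc t * p t ≤ t * (B * exp (-t) / I) := by simp only [hp]; gcongr
      _ = _ := by ring
  have mom : ∫ t in Ioi (0:ℝ), t * p t = ∫ t in Ioi (0:ℝ), P t := by
    have hd : ∀ t ∈ Ici (0:ℝ), HasDerivAt (fun t => t * P t) (P t - t * p t) t := by
      intro t _
      have := (hasDerivAt_id t).mul (Pd t)
      exact this.congr_deriv (by simp only [id]; ring)
    have lim : Tendsto (fun t => t * P t) atTop (𝓝 0) := by
      apply squeeze_zero' (g := fun t => B / I * (t * exp (-t)))
      · filter_upwards [eventually_ge_atTop 0] with t ht using mul_nonneg ht (Ppos t ht).le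
      · filter_upwards [eventually_ge_atTop 0] with t ht
        calc t * P t ≤ t * (B / I * exp (-t)) := by gcongr; exact Ple t ht
          _ = _ := by ring
      · have := (Real.tendsto_pow_mul_exp_neg_atTop_nhds_zero 1).const_mul (B/I)
        simpa using this
    have := integral_Ioi_of_hasDerivAt_of_tendsto' hd (Pint.sub tpint) lim
    rw [integral_sub Pint tpint] at this
    simp at this
    linarith
  -- logarithmic part
  set G : ℝ → ℝ := fun x => x * log x - (1 - x) * log (1 - x) - 2 * x with hG
  have Gc : Continuous G := by
    have h1 : Continuous fun x : ℝ => x * log x := Real.continuous_mul_log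
    have h2 : Continuous fun x : ℝ => (1 - x) * log (1 - x) :=
      Real.continuous_mul_log.comp (continuous_const.sub continuous_id)
    exact (h1.sub h2).sub (continuous_const.mul continuous_id)
  have Gd : ∀ x, 0 < x → x < 1 → HasDerivAt G (log (x * (1 - x))) x := by
    intro x h0 h1
    have a1 := Real.hasDerivAt_mul_log h0.ne'
    have a2 := (Real.hasDerivAt_mul_log (sub_pos.2 h1).ne').comp x ((hasDerivAt_id x).const_sub 1)
    have := (a1.sub a2).sub ((hasDerivAt_id x).const_mul 2)
    refine this.congr_deriv ?_
    rw [log_mul h0.ne' (sub_pos.2 h1).ne']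
    simp
    ring
  have Kd : ∀ t ∈ Ioi (0:ℝ), HasDerivAt (fun t => G (P t)) (- p t * log (P t * (1 - P t))) t := by
    intro t ht
    have := (Gd (P t) (Ppos t (le_of_lt ht)) (Plt t ht)).comp t (Pd t)
    exact this.congr_deriv (by ring)
  have Knn : ∀ t ∈ Ioi (0:ℝ), 0 ≤ - p t * log (P t * (1 - P t)) := by
    intro t ht
    have h1 := Ppos t (le_of_lt ht)
    have h2 := Plt t ht
    have : log (P t * (1 - P t)) ≤ 0 := Real.log_nonpos (by nlinarith) (by nlinarith)
    nlinarith [ppos t]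
  have Klim : Tendsto (fun t => G (P t)) atTop (𝓝 0) := by
    have := (Gc.tendsto 0).comp Plim
    simpa [hG, Function.comp_def] using this
  have Kcont : ContinuousWithinAt (fun t => G (P t)) (Ici 0) 0 :=
    (Gc.comp Pc).continuousWithinAt
  have Kint : IntegrableOn (fun t => - p t * log (P t * (1 - P t))) (Ioi 0) :=
    integrableOn_Ioi_deriv_of_nonneg Kcont Kd Knn Klim
  have Keq : ∫ t in Ioi (0:ℝ), - p t * log (P t * (1 - P t)) = 2 := by
    rw [integral_Ioi_of_hasDerivAt_of_nonneg Kcont Kd Knn Klim, P0]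
    simp [hG]
  -- z part
  have zpint : IntegrableOn (fun t => p t * z t) (Ioi 0) := by
    apply (pint.const_mul (C * R)).mono' (by fun_prop : Continuous fun t => p t * z t).aestronglyMeasurable
    filter_upwards [ae_restrict_mem measurableSet_Ioi] with t ht
    have h1 := h.prim_nonneg (le_of_lt ht)
    have h2 := h.prim_le (le_of_lt ht)
    rw [Real.norm_eq_abs, abs_of_nonneg (mul_nonneg (ppos t).le h1), mul_comm]
    exact mul_le_mul_of_nonneg_right h2 (ppos t).le
  have zp : ∫ t in Ioi (0:ℝ), p t * z t = ∫ s in Ioi (0:ℝ), g s * P s := by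
    rw [tonelli1 pint (h.int_Ioi 0)]
    apply setIntegral_congr_fun measurableSet_Ioi
    intro s hs
    simp only [Ptail s (le_of_lt hs)]
  have gPint : IntegrableOn (fun s => g s * P s) (Ioi 0) := by
    apply (h.int_Ioi 0).mono' (by have := h.meas; have := Pc.measurable; fun_prop :
      Measurable fun s => g s * P s).aestronglyMeasurable
    filter_upwards [ae_restrict_mem measurableSet_Ioi] with t ht
    have h1 := Ppos t (le_of_lt ht)
    have h2 := Ple1 t (le_of_lt ht)
    rw [Real.norm_eq_abs, abs_of_nonneg (mul_nonneg (h.nonneg t) h1.le)]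
    nlinarith [h.nonneg t]
  have gP : ∫ s in Ioi (0:ℝ), g s * P s ≤
      (∫ s in Ioi (0:ℝ), P s ^ 2) + (1/4) * ∫ s in Ioi (0:ℝ), g s ^ 2 := by
    rw [← integral_const_mul, ← integral_add P2int ((h.sq_int_Ioi 0).const_mul _)]
    apply integral_mono gPint (P2int.add ((h.sq_int_Ioi 0).const_mul _))
    intro s
    simp only [Pi.add_apply]
    nlinarith [sq_nonneg (P s - g s / 2)]
  -- pointwise
  have pw : ∀ t ∈ Ioi (0:ℝ), p t * log I ≤
      p t * z t - t * p t + (P t - P t ^ 2) + (- p t * log (P t * (1 - P t))) - p t := by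
    intro t ht
    have h1 := Ppos t (le_of_lt ht)
    have h2 := Plt t ht
    have hp0 := ppos t
    have hlogp : log (p t) = z t - t - log I := by
      simp only [hp]; rw [log_div (exp_pos _).ne' Ipos.ne', log_exp]
    set c := P t * (1 - P t) with hc
    have c0 : 0 < c := mul_pos h1 (by linarith)
    have : log (c / p t) ≤ c / p t - 1 := Real.log_le_sub_one_of_pos (div_pos c0 hp0)
    rw [log_div c0.ne' hp0.ne'] at this
    have h3 : p t * (log c - log (p t)) ≤ c - p t := by
      calc p t * (log c - log (p t)) ≤ p t * (c / p t - 1) := by gcongr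
        _ = c - p t := by field_simp
    have h4 : P t - P t ^ 2 = c := by rw [hc]; ring
    rw [h4]
    have h5 : log I = z t - t - log (p t) := by linarith
    rw [h5]
    nlinarith
  have fin : log I ≤ 1 + (1/4) * ∫ s in Ioi (0:ℝ), g s ^ 2 := by
    have hL : ∫ t in Ioi (0:ℝ), p t * log I = log I := by
      rw [integral_mul_const, ptot, one_mul]
    have i1 : IntegrableOn (fun t => p t * z t - t * p t) (Ioi 0) := zpint.sub tpint
    have i2 : IntegrableOn (fun t => P t - P t ^ 2) (Ioi 0) := Pint.sub P2int
    have i3 : IntegrableOn (fun t => p t * z t - t * p t + (P t - P t ^ 2)) (Ioi 0) := i1.add i2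
    have i4 : IntegrableOn (fun t => p t * z t - t * p t + (P t - P t ^ 2)
      + (- p t * log (P t * (1 - P t)))) (Ioi 0) := i3.add Kint
    have := setIntegral_mono_on (pint.mul_const (log I)) (i4.sub pint)
      measurableSet_Ioi pw
    rw [hL] at this
    simp only [Pi.sub_apply] at this
    rw [integral_sub i4 pint, integral_add i3 Kint, integral_add i1 i2] at this
    rw [integral_sub zpint tpint, integral_sub Pint P2int, mom, zp, Keq, ptot] at this
    linarith
  calc I = exp (log I) := (exp_log Ipos).symm
    _ ≤ _ := exp_le_exp.2 fin

lemma integral_Ioi_shift (f : ℝ → ℝ) (a : ℝ) :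
    ∫ x in Ioi (0:ℝ), f (a + x) = ∫ x in Ioi a, f x := by
  rw [← integral_indicator measurableSet_Ioi, ← integral_indicator measurableSet_Ioi,
    ← integral_add_left_eq_self ((Ioi a).indicator f) a]
  congr 1; ext x
  simp [indicator]

lemma integral_Ioi_affine (f : ℝ → ℝ) (a : ℝ) {b : ℝ} (hb : 0 < b) :
    ∫ x in Ioi (0:ℝ), f (a + b * x) = b⁻¹ * ∫ x in Ioi a, f x := by
  have := integral_comp_mul_left_Ioi (fun x => f (a + x)) 0 hb
  rw [this, mul_zero, integral_Ioi_shift, smul_eq_mul]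

namespace Slope
variable {g : ℝ → ℝ} {C R : ℝ}

lemma sq_locInt (h : Slope g C R) (a b : ℝ) : IntervalIntegrable (fun s => g s ^ 2) volume a b := by
  rw [intervalIntegrable_iff]
  exact (h.sq_int_Ioi (min a b)).mono_set (fun x hx => hx.1)

lemma cs (h : Slope g C R) {a b : ℝ} (hab : a ≤ b) :
    (∫ s in a..b, g s) ^ 2 ≤ (b - a) * ∫ s in a..b, g s ^ 2 := by
  rcases hab.eq_or_lt with rfl | hlt
  · simp
  set m := (∫ s in a..b, g s) / (b - a) with hm
  have hb : 0 < b - a := sub_pos.2 hlt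
  have hI : (∫ s in a..b, g s) = m * (b - a) := by rw [hm]; field_simp
  have h0 : 0 ≤ ∫ s in a..b, (g s - m) ^ 2 :=
    intervalIntegral.integral_nonneg hab (fun x _ => sq_nonneg _)
  have e : (∫ s in a..b, (g s - m) ^ 2) =
      (∫ s in a..b, g s ^ 2) - 2 * m * (∫ s in a..b, g s) + m ^ 2 * (b - a) := by
    have : ∀ s, (g s - m) ^ 2 = (g s ^ 2 - 2 * m * g s) + m ^ 2 := fun s => by ring
    simp_rw [this]
    rw [intervalIntegral.integral_add ((h.sq_locInt a b).sub ((h.locInt a b).const_mul _)) (by simp),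
      intervalIntegral.integral_sub (h.sq_locInt a b) ((h.locInt a b).const_mul _),
      intervalIntegral.integral_const_mul]
    simp; ring
  rw [e, hI] at h0
  rw [hI]
  nlinarith

lemma sq_le_tail (h : Slope g C R) {a b : ℝ} (hab : a ≤ b) :
    (∫ s in a..b, g s ^ 2) ≤ ∫ s in Ioi a, g s ^ 2 := by
  rw [intervalIntegral.integral_of_le hab]
  apply setIntegral_mono_set (h.sq_int_Ioi a)
  · exact ae_of_all _ fun x => sq_nonneg _
  · exact (Ioc_subset_Ioi_self).eventuallyLE

lemma exp_sq_int (h : Slope g C R) {a : ℝ} (ha : 0 ≤ a) :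
    IntegrableOn (fun s => exp ((∫ x in (0:ℝ)..s, g x) ^ 2 - s)) (Ioi a) := by
  have := h.prim_cont
  apply ((exp_neg_int a).const_mul (exp ((C * R) ^ 2))).mono'
    (by fun_prop : Continuous _).aestronglyMeasurable
  filter_upwards [ae_restrict_mem measurableSet_Ioi] with t ht
  have ht' : 0 ≤ t := ha.trans (le_of_lt ht)
  rw [Real.norm_eq_abs, abs_of_pos (exp_pos _), ← exp_add]
  apply exp_le_exp.2
  have h1 := h.prim_nonneg ht'
  have h2 := h.prim_le ht'
  nlinarith

lemma tail (h : Slope g C R) {a δ : ℝ} (ha : 0 ≤ a) (hδ0 : 0 ≤ δ) (hδ : δ < 1)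
    (hg : ∫ s in Ioi a, g s ^ 2 ≤ δ) (hw : (∫ s in (0:ℝ)..a, g s) ^ 2 ≤ a * (1 - δ)) :
    ∫ s in Ioi a, exp ((∫ x in (0:ℝ)..s, g x) ^ 2 - s) ≤ exp 1 / (1 - δ) := by
  set w : ℝ → ℝ := fun s => ∫ x in (0:ℝ)..s, g x with hwdef
  have hd : 0 < 1 - δ := sub_pos.2 hδ
  have wa0 : 0 ≤ w a := h.prim_nonneg ha
  set b := (1 - δ)⁻¹ with hb
  have hb0 : 0 < b := inv_pos.2 hd
  set k : ℝ → ℝ := fun t => 2 * w a * b * g (a + b * t) with hk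
  have hS : Slope k (2 * w a * b * C) ((1 - δ) * R) := by
    refine ⟨?_, ?_, ?_, ?_, ?_, ?_⟩
    · have := h.meas; fun_prop
    · intro s; have := h.nonneg (a + b * s); simp only [hk]; positivity
    · intro s; have := h.le (a + b * s); simp only [hk]; gcongr
    · intro s hs
      have : R < b * s := by
        rw [hb, inv_mul_eq_div, lt_div_iff₀ hd]; linarith
      simp only [hk]; rw [h.zero _ (by linarith)]; simp
    · have := h.C0; positivity
    · have := h.R0; positivity
  have kprim : ∀ t, (∫ s in (0:ℝ)..t, k s) = 2 * w a * (w (a + b * t) - w a) := by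
    intro t
    simp only [hk]
    rw [intervalIntegral.integral_const_mul, intervalIntegral.integral_comp_add_mul _ hb0.ne']
    have : (∫ x in (0:ℝ)..a, g x) + (∫ x in a..(a + b * t), g x) = ∫ x in (0:ℝ)..(a + b * t), g x :=
      intervalIntegral.integral_add_adjacent_intervals (h.locInt _ _) (h.locInt _ _)
    simp only [hwdef, mul_zero, add_zero, smul_eq_mul]
    rw [← this]; field_simp; ring
  have ksq : ∫ s in Ioi (0:ℝ), k s ^ 2 ≤ 4 * (w a) ^ 2 * (δ * b) := by
    have : ∀ s, k s ^ 2 = (2 * w a * b) ^ 2 * (g (a + b * s)) ^ 2 := fun s => by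
      simp only [hk]; ring
    simp_rw [this]
    rw [integral_const_mul, integral_Ioi_affine (fun x => g x ^ 2) a hb0]
    calc (2 * w a * b) ^ 2 * (b⁻¹ * ∫ x in Ioi a, g x ^ 2)
        ≤ (2 * w a * b) ^ 2 * (b⁻¹ * δ) := by gcongr
      _ = _ := by field_simp; ring
  obtain ⟨oint, on⟩ := onofri1 hS
  have key : ∫ s in Ioi a, exp (2 * w a * (w s - w a) - (1 - δ) * (s - a)) ≤
      b * exp (1 + (w a) ^ 2 * (δ * b)) := by
    have e := integral_Ioi_affine
      (fun s => exp (2 * w a * (w s - w a) - (1 - δ) * (s - a))) a hb0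
    have e2 : ∫ x in Ioi (0:ℝ), exp (2 * w a * (w (a + b * x) - w a) - (1 - δ) * (a + b * x - a))
        = ∫ t in Ioi (0:ℝ), exp ((∫ s in (0:ℝ)..t, k s) - t) := by
      apply setIntegral_congr_fun measurableSet_Ioi
      intro x hx
      simp only
      rw [kprim x]
      congr 2
      rw [hb]; field_simp; ring
    rw [e2] at e
    have : ∫ s in Ioi a, exp (2 * w a * (w s - w a) - (1 - δ) * (s - a)) =
      b * ∫ t in Ioi (0:ℝ), exp ((∫ s in (0:ℝ)..t, k s) - t) := by
      rw [e]; field_simp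
    rw [this]
    apply mul_le_mul_of_nonneg_left _ hb0.le
    refine on.trans (exp_le_exp.2 ?_)
    linarith
  have wc : Continuous w := h.prim_cont
  have kint : IntegrableOn (fun s => exp (2 * w a * (w s - w a) - (1 - δ) * (s - a))) (Ioi a) := by
    have hh : IntegrableOn (fun s => exp (-((1 - δ) * s))) (Ioi a) := by
      have := integrableOn_exp_mul_Ioi (a := -(1-δ)) (by linarith) a
      refine this.congr_fun (fun x _ => by ring_nf) measurableSet_Ioi
    apply (hh.const_mul (exp (2 * w a * (C * R) + (1 - δ) * a))).mono'
      (by fun_prop : Continuous _).aestronglyMeasurable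
    filter_upwards [ae_restrict_mem measurableSet_Ioi] with t ht
    have ht' : 0 ≤ t := ha.trans (le_of_lt ht)
    rw [Real.norm_eq_abs, abs_of_pos (exp_pos _), ← exp_add]
    apply exp_le_exp.2
    have h2 : w t ≤ C * R := h.prim_le ht'
    nlinarith
  calc ∫ s in Ioi a, exp (w s ^ 2 - s)
      ≤ ∫ s in Ioi a, exp (w a ^ 2 - a) * exp (2 * w a * (w s - w a) - (1 - δ) * (s - a)) := by
        apply setIntegral_mono_on (h.exp_sq_int ha) (kint.const_mul _) measurableSet_Ioi
        intro s hs
        rw [← exp_add]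
        apply exp_le_exp.2
        have hs' : a ≤ s := le_of_lt hs
        have e : (∫ x in (0:ℝ)..a, g x) + (∫ x in a..s, g x) = ∫ x in (0:ℝ)..s, g x :=
          intervalIntegral.integral_add_adjacent_intervals (h.locInt _ _) (h.locInt _ _)
        have e1 : (∫ x in a..s, g x) = w s - w a := by simp only [hwdef]; linarith
        have := h.cs hs'
        have h3 := (h.sq_le_tail hs').trans hg
        rw [e1] at this
        have h4 : (s - a) * ∫ x in a..s, g x ^ 2 ≤ (s - a) * δ :=
          mul_le_mul_of_nonneg_left h3 (by linarith)
        nlinarith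
    _ ≤ exp (w a ^ 2 - a) * (b * exp (1 + (w a) ^ 2 * (δ * b))) := by
        rw [integral_const_mul]; gcongr
    _ = exp (w a ^ 2 - a + (1 + (w a) ^ 2 * (δ * b))) * b := by rw [exp_add (w a ^ 2 - a)]; ring
    _ ≤ exp 1 * b := by
        gcongr
        have : w a ^ 2 * b ≤ a := by
          rw [hb, ← div_eq_mul_inv, div_le_iff₀ hd]; exact hw
        have : w a ^ 2 + w a ^ 2 * (δ * b) = w a ^ 2 * b := by
          rw [hb]; field_simp; ring
        linarith
    _ = _ := by rw [hb]; rfl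
end Slope

lemma log_le_two_sqrt {x : ℝ} (hx : 0 < x) : log x ≤ 2 * √x := by
  have h1 : log x = 2 * log (√x) := by
    rw [Real.log_sqrt hx.le]; ring
  have := Real.log_le_sub_one_of_pos (Real.sqrt_pos.2 hx)
  linarith

lemma cc1_quant {g : ℝ → ℝ} {C R : ℝ} (h : Slope g C R) (hg : ∫ s in Ioi (0:ℝ), g s ^ 2 ≤ 1)
    {m η : ℝ} (hm : 5 ≤ m) (hη0 : 0 < η) (hη : η ≤ 1) (hw : (∫ s in (0:ℝ)..(m^2), g s) ≤ η) :
    ∫ s in Ioi (0:ℝ), (exp ((∫ x in (0:ℝ)..s, g x) ^ 2) - 1) * exp (-s) ≤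
      (exp (η ^ 2) - 1) + 1 / m ^ 2 + exp 1 / (1 - 4 / m) := by
  set w : ℝ → ℝ := fun s => ∫ x in (0:ℝ)..s, g x with hwdef
  have wc : Continuous w := h.prim_cont
  set A := m ^ 2 with hA
  have A0 : 0 < A := by positivity
  have hitg : ∀ a, 0 ≤ a → IntegrableOn (fun s => (exp (w s ^ 2) - 1) * exp (-s)) (Ioi a) := by
    intro a ha
    refine ((h.exp_sq_int ha).sub (exp_neg_int a)).congr_fun ?_ measurableSet_Ioi
    intro s _
    show exp (w s ^ 2 - s) - exp (-s) = _
    rw [sub_eq_add_neg (w s ^ 2) s, exp_add]; ring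
  have split : ∀ a b, 0 ≤ a → a ≤ b → ∫ s in Ioi a, (exp (w s ^ 2) - 1) * exp (-s) =
      (∫ s in Ioc a b, (exp (w s ^ 2) - 1) * exp (-s)) +
        ∫ s in Ioi b, (exp (w s ^ 2) - 1) * exp (-s) := by
    intro a b ha hab
    rw [← Ioc_union_Ioi_eq_Ioi hab]
    exact setIntegral_union (Ioc_disjoint_Ioi le_rfl) measurableSet_Ioi
      ((hitg a ha).mono_set Ioc_subset_Ioi_self) (hitg b (ha.trans hab))
  have part1 : ∫ s in Ioc 0 A, (exp (w s ^ 2) - 1) * exp (-s) ≤ exp (η ^ 2) - 1 := by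
    calc _ ≤ ∫ s in Ioc 0 A, (exp (η ^ 2) - 1) * exp (-s) := by
          apply setIntegral_mono_on ((hitg 0 le_rfl).mono_set Ioc_subset_Ioi_self)
            (((exp_neg_int 0).mono_set Ioc_subset_Ioi_self).const_mul _) measurableSet_Ioc
          intro s hs
          have h1 : w s ≤ η := (h.prim_mono hs.2).trans hw
          have h0 : 0 ≤ w s := h.prim_nonneg hs.1.le
          gcongr
      _ = (exp (η ^ 2) - 1) * ∫ s in Ioc 0 A, exp (-s) := by rw [integral_const_mul]
      _ ≤ (exp (η ^ 2) - 1) * 1 := by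
          have : (1:ℝ) ≤ exp (η^2) := Real.one_le_exp (sq_nonneg _)
          apply mul_le_mul_of_nonneg_left _ (by linarith)
          have e : ∫ t in Ioi (0:ℝ), exp (-t) = 1 := by rw [integral_exp_neg_Ioi' 0]; simp
          rw [← e]
          apply setIntegral_mono_set (exp_neg_int 0) (ae_of_all _ fun x => (exp_pos _).le)
          exact (Ioc_subset_Ioi_self).eventuallyLE
      _ = _ := mul_one _
  have rint : IntegrableOn (fun s : ℝ => s ^ (-2:ℝ)) (Ioi A) :=
    integrableOn_Ioi_rpow_of_lt (by norm_num) A0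
  have rval : ∫ s in Ioi A, s ^ (-2:ℝ) = 1 / A := by
    rw [integral_Ioi_rpow_of_lt (by norm_num) A0]
    norm_num
    rw [Real.rpow_neg_one]
  have pw : ∀ s, A < s → w s ^ 2 < s - 2 * log s →
      (exp (w s ^ 2) - 1) * exp (-s) ≤ s ^ (-2:ℝ) := by
    intro s hs hlt
    have s0 : 0 < s := A0.trans hs
    rw [Real.rpow_def_of_pos s0]
    have : (exp (w s ^ 2) - 1) * exp (-s) ≤ exp (w s ^ 2 - s) := by
      rw [sub_eq_add_neg (w s ^ 2), exp_add]; nlinarith [exp_pos (-s)]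
    refine this.trans (exp_le_exp.2 ?_)
    linarith
  have mpos : 0 < m := by linarith
  have h4m : 4 / m ≤ 4/5 := by gcongr
  have tail0 : 0 ≤ exp 1 / (1 - 4/m) := div_nonneg (exp_pos _).le (by linarith)
  rw [split 0 A le_rfl A0.le]
  suffices hsuf : ∫ s in Ioi A, (exp (w s ^ 2) - 1) * exp (-s) ≤ 1 / A + exp 1 / (1 - 4 / m) by
    linarith
  by_cases hT : ∀ s, A < s → w s ^ 2 < s - 2 * log s
  · have : ∫ s in Ioi A, (exp (w s ^ 2) - 1) * exp (-s) ≤ 1 / A := by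
      rw [← rval]
      exact setIntegral_mono_on (hitg A A0.le) rint measurableSet_Ioi
        (fun s hs => pw s hs (hT s hs))
    linarith
  · push Not at hT
    set T : Set ℝ := {s | A ≤ s ∧ s - 2 * log s ≤ w s ^ 2} with hTdef
    have Tne : T.Nonempty := by
      obtain ⟨s, h1, h2⟩ := hT; exact ⟨s, h1.le, h2⟩
    have Tbd : BddBelow T := ⟨A, fun s hs => hs.1⟩
    have Tcl : IsClosed T := by
      have hc : ContinuousOn (fun s => w s ^ 2 - (s - 2 * log s)) (Ici A) := by
        apply ContinuousOn.sub (by fun_prop)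
        apply ContinuousOn.sub (by fun_prop)
        apply ContinuousOn.mul (by fun_prop)
        exact Real.continuousOn_log.mono (fun x hx => (A0.trans_le hx).ne')
      have := hc.preimage_isClosed_of_isClosed isClosed_Ici (isClosed_Ici (a := (0:ℝ)))
      convert this using 1
      ext s; simp [hTdef]
    have haT : sInf T ∈ T := Tcl.csInf_mem Tne Tbd
    set a := sInf T with ha
    have hAa : A ≤ a := haT.1
    have a0 : 0 < a := A0.trans_le hAa
    have before : ∀ s, A < s → s < a → w s ^ 2 < s - 2 * log s := by
      intro s h1 h2
      by_contra hcon
      push Not at hcon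
      exact absurd (csInf_le Tbd (⟨h1.le, hcon⟩ : s ∈ T)) (not_le.2 h2)
    set δ := 1 - w a ^ 2 / a with hδ
    have totsplit : (∫ s in (0:ℝ)..a, g s ^ 2) + ∫ s in Ioi a, g s ^ 2 =
        ∫ s in Ioi (0:ℝ), g s ^ 2 :=
      intervalIntegral.integral_interval_add_Ioi (h.sq_int_Ioi 0) (h.sq_int_Ioi a)
    have hcs : w a ^ 2 ≤ a * ∫ s in (0:ℝ)..a, g s ^ 2 := by
      have := h.cs a0.le
      simpa using this
    have hcs' : w a ^ 2 / a ≤ ∫ s in (0:ℝ)..a, g s ^ 2 := by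
      rw [div_le_iff₀ a0]; linarith
    have tnn : 0 ≤ ∫ s in Ioi a, g s ^ 2 := setIntegral_nonneg measurableSet_Ioi
      (fun x _ => sq_nonneg _)
    have hδ0 : 0 ≤ δ := by rw [hδ]; linarith
    have hδ1 : δ ≤ 4 / m := by
      have h1 : a - 2 * log a ≤ w a ^ 2 := haT.2
      have h2 := log_le_two_sqrt a0
      have h3 : m ≤ √a := by
        rw [show m = √(m^2) from (Real.sqrt_sq mpos.le).symm]; exact Real.sqrt_le_sqrt hAa
      have h4 : √a * √a = a := Real.mul_self_sqrt a0.le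
      have h5 : 0 < √a := Real.sqrt_pos.2 a0
      have : δ * a ≤ 4 / m * a := by
        have e : δ * a = a - w a ^ 2 := by rw [hδ]; field_simp
        rw [e]
        calc a - w a ^ 2 ≤ 4 * √a := by linarith
          _ ≤ 4 / m * a := by
            rw [div_mul_eq_mul_div, le_div_iff₀ mpos]
            nlinarith
      exact le_of_mul_le_mul_right this a0
    have hδlt : δ < 1 := by linarith
    have ht := h.tail a0.le hδ0 hδlt (by rw [hδ]; linarith)
      (by have : a * (1 - δ) = w a ^ 2 := by rw [hδ]; field_simp; ring
          rw [this])
    rw [split A a A0.le hAa]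
    have p2 : ∫ s in Ioc A a, (exp (w s ^ 2) - 1) * exp (-s) ≤ 1 / A := by
      rw [← rval]
      calc _ = ∫ s in Ioo A a, (exp (w s ^ 2) - 1) * exp (-s) := integral_Ioc_eq_integral_Ioo
        _ ≤ ∫ s in Ioo A a, s ^ (-2:ℝ) := by
          apply setIntegral_mono_on ((hitg A A0.le).mono_set Ioo_subset_Ioi_self)
            (rint.mono_set Ioo_subset_Ioi_self) measurableSet_Ioo
          intro s hs
          exact pw s hs.1 (before s hs.1 hs.2)
        _ ≤ _ := by
          apply setIntegral_mono_set rint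
          · filter_upwards [ae_restrict_mem measurableSet_Ioi] with t ht
            exact Real.rpow_nonneg (A0.trans ht).le _
          · exact (Ioo_subset_Ioi_self).eventuallyLE
    have p3 : ∫ s in Ioi a, (exp (w s ^ 2) - 1) * exp (-s) ≤ exp 1 / (1 - 4/m) := by
      calc _ ≤ ∫ s in Ioi a, exp (w s ^ 2 - s) := by
            apply setIntegral_mono_on (hitg a a0.le) (h.exp_sq_int a0.le) measurableSet_Ioi
            intro s _
            rw [sub_eq_add_neg (w s ^ 2), exp_add]; nlinarith [exp_pos (-s)]
        _ ≤ _ := ht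
        _ ≤ _ := by
          apply div_le_div_of_nonneg_left (exp_pos _).le (by linarith)
          linarith
    linarith

/-- One-dimensional concentration level (Carleson-Chang). -/
theorem cc1 (ε : ℝ) (hε : 0 < ε) : ∃ A : ℝ, 0 < A ∧ ∃ η : ℝ, 0 < η ∧ ∀ (g : ℝ → ℝ) (C R : ℝ),
    Slope g C R → ∫ s in Ioi (0:ℝ), g s ^ 2 ≤ 1 → (∫ s in (0:ℝ)..A, g s) ≤ η →
    ∫ s in Ioi (0:ℝ), (exp ((∫ x in (0:ℝ)..s, g x) ^ 2) - 1) * exp (-s) ≤ exp 1 + ε := by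
  have h1 : Tendsto (fun m : ℝ => 1 / m ^ 2 + exp 1 / (1 - 4 / m)) atTop
      (𝓝 (0 + exp 1 / (1 - 0))) := by
    apply Tendsto.add
    · have : Tendsto (fun m : ℝ => m ^ 2) atTop atTop := tendsto_pow_atTop (by norm_num)
      simpa [Function.comp_def] using tendsto_inv_atTop_zero.comp this
    · apply Tendsto.div tendsto_const_nhds _ (by norm_num)
      apply tendsto_const_nhds.sub
      exact tendsto_const_nhds.div_atTop tendsto_id
  have h2 : ∀ᶠ m : ℝ in atTop, 1 / m ^ 2 + exp 1 / (1 - 4 / m) < exp 1 + ε / 2 := by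
    apply h1.eventually_lt_const
    simp; linarith
  obtain ⟨m, hm, hm5⟩ := (h2.and (eventually_ge_atTop 5)).exists
  have h3 : Tendsto (fun η : ℝ => exp (η ^ 2) - 1) (𝓝[>] 0) (𝓝 0) := by
    have : Continuous (fun η : ℝ => exp (η ^ 2) - 1) := by fun_prop
    have := (this.tendsto 0).mono_left (nhdsWithin_le_nhds (s := Ioi 0))
    simpa using this
  have h4 : ∀ᶠ η : ℝ in 𝓝[>] 0, exp (η ^ 2) - 1 < ε / 2 :=
    h3.eventually_lt_const (by linarith)
  have h5 : ∀ᶠ η : ℝ in 𝓝[>] 0, η ∈ Ioc (0:ℝ) 1 := Ioc_mem_nhdsGT (by norm_num)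
  obtain ⟨η, hη, hη1⟩ := (h4.and h5).exists
  refine ⟨m ^ 2, by positivity, η, hη1.1, ?_⟩
  intro g C R h hg hw
  have := cc1_quant h hg hm5 hη1.1 hη1.2 hw
  linarith

lemma bm1_compact {K : Set ℝ} (hK : IsCompact K) (hne : K.Nonempty) {r : ℝ} (hr : 0 < r)
    {T : Set ℝ} (hT : ∀ x ∈ K, ∀ y, |y| < r → x + y ∈ T) :
    volume K + ENNReal.ofReal (2 * r) ≤ volume T := by
  set M := sSup K
  set m := sInf K
  have hM : M ∈ K := hK.sSup_mem hne
  have hm : m ∈ K := hK.sInf_mem hne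
  have h1 : ∀ x ∈ K, x ≤ M := fun x hx => le_csSup hK.bddAbove hx
  have h2 : ∀ x ∈ K, m ≤ x := fun x hx => csInf_le hK.bddBelow hx
  have sub : (K ∪ Ioo M (M + r)) ∪ Ioo (m - r) m ⊆ T := by
    rintro x ((hx | hx) | hx)
    · simpa using hT x hx 0 (by simpa using hr)
    · have := hT M hM (x - M) (by rw [abs_lt]; constructor <;> linarith [hx.1, hx.2])
      simpa using this
    · have := hT m hm (x - m) (by rw [abs_lt]; constructor <;> linarith [hx.1, hx.2])
      simpa using this
  refine le_trans (le_of_eq ?_) (measure_mono sub)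
  rw [measure_union _ measurableSet_Ioo, measure_union _ measurableSet_Ioo, Real.volume_Ioo,
    Real.volume_Ioo, add_assoc, ← ENNReal.ofReal_add (by linarith) (by linarith)]
  · congr 2; ring
  · rw [Set.disjoint_left]; intro x hx hx'; exact absurd (h1 x hx) (not_le.2 hx'.1)
  · rw [Set.disjoint_left]; rintro x (hx | hx) hx'
    · exact absurd (h2 x hx) (not_le.2 hx'.2)
    · linarith [h1 m hm, hx.1, hx'.2]

lemma bm1 {X : Set ℝ} (hX : MeasurableSet X) (hne : X.Nonempty) {r : ℝ} (hr : 0 < r)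
    {T : Set ℝ} (hT : ∀ x ∈ X, ∀ y, |y| < r → x + y ∈ T) :
    volume X + ENNReal.ofReal (2 * r) ≤ volume T := by
  obtain ⟨x0, hx0⟩ := hne
  have key : ∀ K : Set ℝ, IsCompact K → K.Nonempty → K ⊆ X →
      volume K + ENNReal.ofReal (2 * r) ≤ volume T := fun K hK hn hs =>
    bm1_compact hK hn hr (fun x hx => hT x (hs hx))
  have h0 : ENNReal.ofReal (2 * r) ≤ volume T := by
    have := key {x0} isCompact_singleton (singleton_nonempty _) (by simpa using hx0)
    simpa using this
  refine add_le_of_le_tsub_right_of_le h0 ?_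
  rw [hX.measure_eq_iSup_isCompact]
  refine iSup_le fun K => iSup_le fun hs => iSup_le fun hK => ?_
  rcases K.eq_empty_or_nonempty with rfl | hn
  · simp
  exact ENNReal.le_sub_of_add_le_right ENNReal.ofReal_ne_top (key K hK hn hs)

lemma lint_layer {α : Type*} [MeasurableSpace α] (μ : Measure α) [SFinite μ] {k : α → ℝ} (hk : Measurable k) (t t' : ℝ) :
    ∫⁻ τ in Ioo t t', μ {x | τ < k x} = ∫⁻ x, ENNReal.ofReal (min t' (k x) - t) ∂μ := by
  have hm : MeasurableSet {p : ℝ × α | p.1 < k p.2} := measurableSet_lt measurable_fst (hk.comp measurable_snd)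
  have e1 : ∀ τ : ℝ, μ {x | τ < k x} = ∫⁻ x, {p : ℝ × α | p.1 < k p.2}.indicator 1 (τ, x) ∂μ := by
    intro τ
    rw [← lintegral_indicator_one (measurableSet_lt measurable_const hk)]
    rfl
  simp_rw [e1]
  rw [lintegral_lintegral_swap]
  · congr 1; ext x
    have : (fun τ : ℝ => {p : ℝ × α | p.1 < k p.2}.indicator (1 : ℝ × α → ENNReal) (τ, x)) = (Iio (k x)).indicator 1 := rfl
    rw [this, lintegral_indicator_one measurableSet_Iio, Measure.restrict_apply measurableSet_Iio,
      inter_comm, Ioo_inter_Iio, Real.volume_Ioo]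
  · exact (measurable_one.indicator hm).aemeasurable

lemma half_circle {ε : ℝ} (hε : 0 < ε) :
    ∫⁻ l in Ioo (0:ℝ) 1, ENNReal.ofReal (2 * (ε * √(1 - l ^ 2))) = ENNReal.ofReal (π * ε / 2) := by
  have hc : Continuous fun l : ℝ => √(1 - l ^ 2) := by fun_prop
  have h1 : (∫ x in (0:ℝ)..1, √(1 - x ^ 2)) = π / 4 := by
    have h := integral_sqrt_one_sub_sq
    rw [← intervalIntegral.integral_add_adjacent_intervals (hc.intervalIntegrable (-1) 0)
      (hc.intervalIntegrable 0 1)] at h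
    have h2 := intervalIntegral.integral_comp_neg (a := 0) (b := 1) (fun x : ℝ => √(1 - x ^ 2))
    simp only [neg_sq, neg_zero] at h2
    rw [← h2] at h; linarith
  rw [← ofReal_integral_eq_lintegral_ofReal]
  · congr 1
    rw [← integral_Ioc_eq_integral_Ioo, ← intervalIntegral.integral_of_le zero_le_one,
      intervalIntegral.integral_const_mul, intervalIntegral.integral_const_mul, h1]
    ring
  · exact ((by fun_prop : Continuous fun l : ℝ => 2 * (ε * √(1 - l ^ 2))).integrableOn_Icc).mono_set Ioo_subset_Icc_self
  · exact ae_of_all _ fun x => by positivity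

/-- Brunn-Minkowski inequality with a disc. -/
theorem bm2 {A T : Set (ℝ × ℝ)} (hA : MeasurableSet A) (hTm : MeasurableSet T) {R ε : ℝ}
    (hR : ∀ p ∈ A, |p.2| ≤ R) (hε : 0 < ε) (hTf : volume T ≠ ⊤)
    (hT : ∀ p ∈ A, ∀ q : ℝ × ℝ, q.1 ^ 2 + q.2 ^ 2 < ε ^ 2 → p + q ∈ T) :
    volume.real A + 2 * ε * √(π * volume.real A) ≤ volume.real T := by
  set f : ℝ → ENNReal := fun x => volume (Prod.mk x ⁻¹' A) with hf
  set fT : ℝ → ENNReal := fun x => volume (Prod.mk x ⁻¹' T) with hfT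
  have fm : Measurable f := measurable_measure_prodMk_left hA
  have fTm : Measurable fT := measurable_measure_prodMk_left hTm
  have volA : volume A = ∫⁻ x, f x := Measure.prod_apply hA
  have volT : volume T = ∫⁻ x, fT x := Measure.prod_apply hTm
  have hAT : A ⊆ T := fun p hp => by simpa using hT p hp 0 (by simpa using sq_pos_of_pos hε)
  have hAf : volume A ≠ ⊤ := ne_top_of_le_ne_top hTf (measure_mono hAT)
  rcases eq_or_ne (volume A) 0 with h0 | h0
  · simp [Measure.real, h0]
  set F := ⨆ x, f x with hF
  have hfF : ∀ x, f x ≤ F := fun x => le_iSup f x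
  have Ftop : F ≠ ⊤ := by
    apply ne_top_of_le_ne_top (b := volume (Icc (-R) R)) (by simp)
    refine iSup_le fun x => measure_mono fun y hy => ?_
    exact abs_le.1 (hR _ hy)
  have F0 : F ≠ 0 := by
    intro h
    apply h0; rw [volA]
    have : ∀ x, f x = 0 := fun x => le_antisymm ((hfF x).trans h.le) zero_le
    simp [this]
  set Fr := F.toReal with hFr
  have Fr0 : 0 < Fr := ENNReal.toReal_pos F0 Ftop
  have ftop : ∀ x, f x ≠ ⊤ := fun x => ne_top_of_le_ne_top Ftop (hfF x)
  set k : ℝ → ℝ := fun x => (f x).toReal / Fr with hk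
  set kT : ℝ → ℝ := fun x => (min (fT x) (ENNReal.ofReal (Fr + 2 * ε))).toReal / (Fr + 2 * ε) with hkT
  have km : Measurable k := fm.ennreal_toReal.div_const _
  have kTm : Measurable kT := (fTm.min measurable_const).ennreal_toReal.div_const _
  have LA := lint_layer volume km 0 1
  have LT := lint_layer volume kTm 0 1
  have EA : ∫⁻ x, ENNReal.ofReal (min 1 (k x) - 0) = volume A / F := by
    rw [volA, ENNReal.div_eq_inv_mul, ← lintegral_const_mul _ fm]
    congr 1; ext x
    have : k x ≤ 1 := by
      rw [hk]; simp only; rw [div_le_one Fr0]; exact ENNReal.toReal_mono Ftop (hfF x)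
    rw [min_eq_right this, sub_zero, hk]
    simp only
    rw [ENNReal.ofReal_div_of_pos Fr0, ENNReal.ofReal_toReal (ftop x), hFr, ENNReal.ofReal_toReal Ftop,
      ENNReal.div_eq_inv_mul]
  have hF2 : 0 < Fr + 2 * ε := by positivity
  have ET : ∫⁻ x, ENNReal.ofReal (min 1 (kT x) - 0) ≤ volume T / ENNReal.ofReal (Fr + 2 * ε) := by
    rw [volT, ENNReal.div_eq_inv_mul, ← lintegral_const_mul _ fTm]
    refine lintegral_mono fun x => ?_
    have h1 : ENNReal.ofReal (min 1 (kT x) - 0) ≤ ENNReal.ofReal (kT x) := by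
      apply ENNReal.ofReal_le_ofReal; simp
    refine h1.trans ?_
    rw [hkT]; simp only
    rw [ENNReal.ofReal_div_of_pos hF2, ENNReal.ofReal_toReal (by simp), ENNReal.div_eq_inv_mul]
    gcongr; exact min_le_left _ _
  have main : ∀ l ∈ Ioo (0:ℝ) 1, volume {x | l < k x} + ENNReal.ofReal (2 * (ε * √(1 - l ^ 2)))
      ≤ volume {x | l < kT x} := by
    intro l hl
    have hl2 : 0 < 1 - l ^ 2 := by nlinarith [hl.1, hl.2]
    apply bm1 (measurableSet_lt measurable_const km)
    · by_contra hne
      rw [not_nonempty_iff_eq_empty] at hne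
      have hall : ∀ x, f x ≤ ENNReal.ofReal (l * Fr) := by
        intro x
        have : ¬ l < k x := fun h => by
          have : x ∈ ({x | l < k x} : Set ℝ) := h
          rw [hne] at this; exact this
        rw [not_lt, hk] at this; simp only at this
        rw [div_le_iff₀ Fr0] at this
        rw [← ENNReal.ofReal_toReal (ftop x)]
        exact ENNReal.ofReal_le_ofReal this
      have : F ≤ ENNReal.ofReal (l * Fr) := iSup_le hall
      have := ENNReal.toReal_mono ENNReal.ofReal_ne_top this
      rw [ENNReal.toReal_ofReal (by have := hl.1; positivity)] at this
      nlinarith [hl.2]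
    · have := Real.sqrt_pos.2 hl2; positivity
    · intro x hx x' hx'
      have hx2 : x' ^ 2 < ε ^ 2 * (1 - l ^ 2) := by
        have := sq_lt_sq.2 (show |x'| < |ε * √(1 - l ^ 2)| from lt_of_lt_of_le hx' (le_abs_self _))
        rwa [mul_pow, Real.sq_sqrt hl2.le] at this
      set ρ := √(ε ^ 2 - x' ^ 2) with hρ
      have hpos : (l * ε) ^ 2 < ε ^ 2 - x' ^ 2 := by nlinarith
      have hρl : l * ε < ρ := by
        rw [hρ]; exact Real.lt_sqrt_of_sq_lt hpos
      have hρ0 : 0 < ρ := lt_trans (mul_pos hl.1 hε) hρl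
      have hx1 : l * Fr < (f x).toReal := by
        have : l < k x := hx
        rw [hk] at this; simp only at this
        rwa [lt_div_iff₀ Fr0] at this
      have hsec : f x + ENNReal.ofReal (2 * ρ) ≤ fT (x + x') := by
        apply bm1 (measurable_prodMk_left hA) _ hρ0
        · intro y hy y' hy'
          have := hT (x, y) hy (x', y') (by
            have := sq_lt_sq.2 (show |y'| < |ρ| from lt_of_lt_of_le hy' (le_abs_self _))
            rw [hρ, Real.sq_sqrt (by nlinarith)] at this
            simp only; linarith)
          simpa using this
        · by_contra hne
          rw [not_nonempty_iff_eq_empty] at hne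
          have : f x = 0 := by rw [hf]; simp [hne]
          rw [this] at hx1; simp at hx1
          nlinarith [hl.1]
      show l < kT (x + x')
      rw [hkT]; simp only
      rw [lt_div_iff₀ hF2]
      have h3 : ENNReal.ofReal (min ((f x).toReal + 2 * ρ) (Fr + 2 * ε)) ≤
          min (fT (x + x')) (ENNReal.ofReal (Fr + 2 * ε)) := by
        apply le_min
        · refine le_trans ?_ hsec
          rw [← ENNReal.ofReal_toReal (ftop x), ← ENNReal.ofReal_add (by positivity) (by positivity),
            ENNReal.toReal_ofReal (by positivity)]
          exact ENNReal.ofReal_le_ofReal (min_le_left _ _)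
        · exact ENNReal.ofReal_le_ofReal (min_le_right _ _)
      have h4 := ENNReal.toReal_mono (by simp) h3
      rw [ENNReal.toReal_ofReal (by positivity)] at h4
      refine lt_of_lt_of_le (lt_min ?_ ?_) h4
      · linarith
      · nlinarith [hl.2]
  have tot : volume A / F + ENNReal.ofReal (π * ε / 2) ≤ volume T / ENNReal.ofReal (Fr + 2 * ε) := by
    rw [← EA, ← LA, ← half_circle hε]
    refine le_trans ?_ (LT.le.trans ET)
    rw [← lintegral_add_right]
    · exact setLIntegral_mono' measurableSet_Ioo main
    · fun_prop
  have tr : volume.real A / Fr + π * ε / 2 ≤ volume.real T / (Fr + 2 * ε) := by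
    have := ENNReal.toReal_mono (by
      apply ENNReal.div_ne_top hTf; simpa using hF2) tot
    rw [ENNReal.toReal_add (ENNReal.div_ne_top hAf F0) ENNReal.ofReal_ne_top, ENNReal.toReal_div,
      ENNReal.toReal_div, ENNReal.toReal_ofReal (by positivity), ENNReal.toReal_ofReal hF2.le] at this
    exact this
  rw [le_div_iff₀ hF2] at tr
  refine le_trans ?_ tr
  set a := volume.real A
  have a0 : 0 ≤ a := measureReal_nonneg
  have h5 : 2 * √(π * a) ≤ 2 * a / Fr + Fr * π / 2 := by
    have h6 : π * a = (2 * a / Fr) * (Fr * π / 2) := by field_simp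
    have p1 : 0 ≤ 2 * a / Fr := by positivity
    have p2 : 0 ≤ Fr * π / 2 := by positivity
    rw [h6, Real.sqrt_mul p1]
    nlinarith [sq_nonneg (√(2 * a / Fr) - √(Fr * π / 2)), Real.sq_sqrt p1, Real.sq_sqrt p2]
  have : (a / Fr + π * ε / 2) * (Fr + 2 * ε) = a + ε * (2 * a / Fr + Fr * π / 2) + π * ε ^ 2 := by
    field_simp; ring
  rw [this]
  have := mul_le_mul_of_nonneg_left h5 hε.le
  nlinarith [Real.pi_pos, sq_nonneg ε]

theorem bmC {A T : Set ℂ} (hA : MeasurableSet A) (hTm : MeasurableSet T) {R ε : ℝ}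
    (hR : ∀ p ∈ A, |p.im| ≤ R) (hε : 0 < ε) (hTf : volume T ≠ ⊤)
    (hT : ∀ p ∈ A, ∀ q : ℂ, ‖q‖ < ε → p + q ∈ T) :
    volume.real A + 2 * ε * √(π * volume.real A) ≤ volume.real T := by
  have mp := Complex.volume_preserving_equiv_real_prod.symm
  have eA := mp.measure_preimage hA.nullMeasurableSet
  have eT := mp.measure_preimage hTm.nullMeasurableSet
  have := bm2 (A := Complex.measurableEquivRealProd.symm ⁻¹' A)
    (T := Complex.measurableEquivRealProd.symm ⁻¹' T) (R := R) (ε := ε)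
    (Complex.measurableEquivRealProd.symm.measurable hA)
    (Complex.measurableEquivRealProd.symm.measurable hTm) (fun p hp => hR _ hp) hε (by rw [eT]; exact hTf)
    (fun p hp q hq => by
      have := hT _ hp (Complex.measurableEquivRealProd.symm q) (by
        rw [← abs_of_pos hε, ← abs_of_nonneg (norm_nonneg (Complex.measurableEquivRealProd.symm q)),
          ← sq_lt_sq, Complex.sq_norm, Complex.normSq_apply]
        simpa [sq] using hq)
      have e : Complex.measurableEquivRealProd.symm (p + q) =
        Complex.measurableEquivRealProd.symm p + Complex.measurableEquivRealProd.symm q := by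
        apply Complex.ext <;> simp
      show _ ∈ T
      rw [e]; exact this)
  simpa [Measure.real, eA, eT] using this

lemma taylor2 {v : ℂ → ℝ} (hv : ContDiff ℝ ∞ v) (hc : HasCompactSupport v) :
    ∃ C : ℝ, 0 ≤ C ∧ ∀ x y : ℂ, |v (x + y)| ≤ |v x| + ‖fderiv ℝ v x‖ * ‖y‖ + C * ‖y‖ ^ 2 := by
  obtain ⟨C, hC⟩ := ((hv.fderiv_right (m := 1) (by norm_cast)).lipschitzWith_of_hasCompactSupport
    (hc.fderiv ℝ) (by norm_num))
  refine ⟨C, C.2, fun x y => ?_⟩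
  have h1 := (convex_closedBall x ‖y‖).norm_image_sub_le_of_norm_fderiv_le' (f := v) (𝕜 := ℝ)
    (φ := fderiv ℝ v x) (C := C * ‖y‖) (x := x) (y := x + y)
    (fun z _ => (hv.differentiable (by simp)) z) (fun z hz => by
      rw [← dist_eq_norm]
      refine (hC.dist_le_mul z x).trans ?_
      gcongr; exact Metric.mem_closedBall.1 hz) (by simp) (by simp)
  simp only [add_sub_cancel_left] at h1
  have h2 : v (x + y) = v x + fderiv ℝ v x y + (v (x + y) - v x - fderiv ℝ v x y) := by ring
  rw [h2]
  refine (abs_add_le _ _).trans (add_le_add ((abs_add_le _ _).trans (add_le_add le_rfl ?_)) ?_)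
  · exact (fderiv ℝ v x).le_opNorm y
  · rw [Real.norm_eq_abs] at h1; nlinarith

lemma band_eps {v : ℂ → ℝ} (hv : ContDiff ℝ ∞ v) {R C L : ℝ} (hR : ∀ x, R ≤ ‖x‖ → v x = 0)
    (hC0 : 0 ≤ C) (hC : ∀ x y : ℂ, |v (x + y)| ≤ |v x| + ‖fderiv ℝ v x‖ * ‖y‖ + C * ‖y‖ ^ 2)
    (hL : ∀ x, ‖fderiv ℝ v x‖ + C ≤ L) {t t' ε : ℝ} (ht : 0 ≤ t) (htt : t < t') (hε : 0 < ε) (hε1 : ε ≤ 1) :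
    2 * √(π * volume.real {x | t' ≤ |v x|}) * (t' - t) ≤
      (∫ x in Metric.ball 0 (R + 1) ∩ {x | t ≤ |v x| ∧ |v x| < t'}, ‖fderiv ℝ v x‖) +
      C * ε * volume.real (Metric.ball (0:ℂ) (R + 1)) +
      L * (volume.restrict (Metric.ball (0:ℂ) (R + 1))).real {x | t - L * ε < |v x| ∧ |v x| < t} := by
  set W : Set ℂ := Metric.ball 0 (R + 1) with hW
  have hvc : Continuous v := hv.continuous
  have hdc : Continuous fun x => ‖fderiv ℝ v x‖ := (hv.continuous_fderiv (by simp)).norm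
  set ν := volume.real {x | t' ≤ |v x|} with hν
  set μ := volume.restrict W with hμ
  have Wf : volume W ≠ ⊤ := Metric.isBounded_ball.measure_lt_top.ne
  have : IsFiniteMeasure μ := ⟨by rw [hμ, Measure.restrict_apply_univ]; exact Wf.lt_top⟩
  set h : ℂ → ℝ := fun x => |v x| + ε * ‖fderiv ℝ v x‖ + C * ε ^ 2 with hh
  have hhc : Continuous h := by fun_prop
  have L0 : 0 ≤ L := le_trans (by positivity) (hL 0)
  have subW : ∀ τ, 0 ≤ τ → ∀ x, τ < |v x| → ‖x‖ < R := by
    intro τ h0 x hx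
    by_contra hcon
    rw [hR x (not_lt.1 hcon)] at hx; simp at hx; linarith
  have lev : ∀ τ ∈ Ioo t t', μ {x | τ < |v x|} + ENNReal.ofReal (2 * ε * √(π * ν)) ≤ μ {x | τ < h x} := by
    intro τ hτ
    have τ0 : 0 ≤ τ := ht.trans hτ.1.le
    have mA : MeasurableSet {x : ℂ | τ < |v x|} := measurableSet_lt measurable_const hvc.abs.measurable
    have mT : MeasurableSet {x : ℂ | τ < h x} := measurableSet_lt measurable_const hhc.measurable
    have AW : {x : ℂ | τ < |v x|} ⊆ W := fun x hx => by
      rw [hW, mem_ball_zero_iff]; linarith [subW τ τ0 x hx]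
    rw [hμ, Measure.restrict_apply mA, Measure.restrict_apply mT, inter_eq_left.2 AW]
    have Tf : volume ({x : ℂ | τ < h x} ∩ W) ≠ ⊤ := ne_top_of_le_ne_top Wf (measure_mono inter_subset_right)
    have Af : volume {x : ℂ | τ < |v x|} ≠ ⊤ := ne_top_of_le_ne_top Wf (measure_mono AW)
    have := bmC (A := {x : ℂ | τ < |v x|}) (T := {x : ℂ | τ < h x} ∩ W) (R := R) mA
      (mT.inter Metric.isOpen_ball.measurableSet)
      (fun p hp => (Complex.abs_im_le_norm p).trans (subW τ τ0 p hp).le) hε Tf (fun p hp q hq => by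
        constructor
        · have h1 := hC (p + q) (-q)
          have h2 : τ < |v p| := hp
          rw [add_neg_cancel_right, norm_neg] at h1
          show τ < |v (p + q)| + ε * ‖fderiv ℝ v (p + q)‖ + C * ε ^ 2
          have h3 : ‖fderiv ℝ v (p + q)‖ * ‖q‖ ≤ ε * ‖fderiv ℝ v (p + q)‖ := by
            rw [mul_comm]; gcongr
          have h4 : C * ‖q‖ ^ 2 ≤ C * ε ^ 2 := by gcongr
          linarith
        · rw [hW, mem_ball_zero_iff]
          have := norm_add_le p q
          linarith [subW τ τ0 p hp])
    have νle : ν ≤ volume.real {x : ℂ | τ < |v x|} :=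
      measureReal_mono (fun x hx => lt_of_lt_of_le hτ.2 hx) Af
    rw [← ENNReal.ofReal_toReal Tf, ← ENNReal.ofReal_toReal Af, ← ENNReal.ofReal_add (by positivity) (by positivity)]
    apply ENNReal.ofReal_le_ofReal
    refine le_trans ?_ this
    simp only [Measure.real] at *
    gcongr
  have I1 := lint_layer μ hvc.abs.measurable t t'
  have I2 := lint_layer μ hhc.measurable t t'
  set S1 : Set ℂ := {x | t ≤ |v x| ∧ |v x| < t'} with hS1
  set S2 : Set ℂ := {x | t - L * ε < |v x| ∧ |v x| < t} with hS2
  have mS1 : MeasurableSet S1 := (measurableSet_le measurable_const hvc.abs.measurable).inter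
    (measurableSet_lt hvc.abs.measurable measurable_const)
  have mS2 : MeasurableSet S2 := (measurableSet_lt measurable_const hvc.abs.measurable).inter
    (measurableSet_lt hvc.abs.measurable measurable_const)
  set b : ℂ → ℝ := fun x => ε * S1.indicator (fun x => ‖fderiv ℝ v x‖) x + C * ε ^ 2 +
    L * ε * S2.indicator (fun _ => 1) x with hb
  have i1 : 0 ≤ fun x => S1.indicator (fun x => ‖fderiv ℝ v x‖) x := fun x =>
    indicator_nonneg (fun _ _ => norm_nonneg _) x
  have i2 : 0 ≤ fun x => S2.indicator (fun _ => (1:ℝ)) x := fun x =>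
    indicator_nonneg (fun _ _ => zero_le_one) x
  have b0 : ∀ x, 0 ≤ b x := fun x => by
    have := i1 x; have := i2 x; simp only [Pi.zero_apply] at *; rw [hb]; positivity
  have pw : ∀ x, ENNReal.ofReal (min t' (h x) - t) ≤ ENNReal.ofReal (min t' |v x| - t) + ENNReal.ofReal (b x) := by
    intro x
    have hhL : h x ≤ |v x| + L * ε := by
      have h1 := hL x
      have h2 : C * ε ^ 2 ≤ C * ε := mul_le_mul_of_nonneg_left (by nlinarith) hC0
      rw [hh]; simp only; nlinarith
    have hle : |v x| ≤ h x := by rw [hh]; simp only; nlinarith [mul_nonneg hε.le (norm_nonneg (fderiv ℝ v x)), mul_nonneg hC0 (sq_nonneg ε)]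
    rcases le_or_gt t' |v x| with h1 | h1
    · rw [min_eq_left h1, min_eq_left (h1.trans hle)]; exact le_self_add
    rcases le_or_gt t |v x| with h2 | h2
    · rw [← ENNReal.ofReal_add (by simp [htt.le, h2]) (b0 x)]
      apply ENNReal.ofReal_le_ofReal
      rw [min_eq_right h1.le]
      have hx1 : x ∈ S1 := ⟨h2, h1⟩
      have := i2 x; simp only [Pi.zero_apply] at this
      have : h x ≤ |v x| + b x := by
        rw [hb, hh]; simp only [indicator_of_mem hx1]
        nlinarith [mul_nonneg (mul_nonneg L0 hε.le) this]
      linarith [min_le_right t' (h x)]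
    · refine le_trans ?_ le_add_self
      apply ENNReal.ofReal_le_ofReal_iff'.2
      by_cases h3 : t < h x
      · left
        have hx2 : x ∈ S2 := ⟨by linarith, h2⟩
        have := i1 x; simp only [Pi.zero_apply] at this
        have : L * ε ≤ b x := by
          rw [hb]; simp only [indicator_of_mem hx2]
          nlinarith [mul_nonneg hε.le this, mul_nonneg hC0 (sq_nonneg ε)]
        linarith [min_le_right t' (h x)]
      · right; linarith [min_le_right t' (h x)]
  have fin1 : ∫⁻ x, ENNReal.ofReal (min t' |v x| - t) ∂μ ≠ ⊤ := by
    apply ne_top_of_le_ne_top (b := ∫⁻ x, ENNReal.ofReal t' ∂μ)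
    · rw [lintegral_const]; exact ENNReal.mul_ne_top ENNReal.ofReal_ne_top (measure_ne_top _ _)
    · refine lintegral_mono fun x => ENNReal.ofReal_le_ofReal ?_
      linarith [min_le_left t' |v x|]
  have j1 : Integrable (fun x => S1.indicator (fun x => ‖fderiv ℝ v x‖) x) μ := by
    apply Integrable.indicator _ mS1
    exact Integrable.of_bound hdc.aestronglyMeasurable L
      (ae_of_all _ fun x => by rw [norm_norm]; linarith [hL x])
  have j2 : Integrable (fun x => S2.indicator (fun _ => (1:ℝ)) x) μ :=
    (integrable_const _).indicator mS2
  have bint : Integrable b μ := ((j1.const_mul ε).add (integrable_const _)).add (j2.const_mul _)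
  have key : ENNReal.ofReal (2 * ε * √(π * ν) * (t' - t)) ≤ ENNReal.ofReal (∫ x, b x ∂μ) := by
    rw [ofReal_integral_eq_lintegral_ofReal bint (ae_of_all _ b0)]
    rw [← ENNReal.add_le_add_iff_left fin1]
    calc _ = ∫⁻ τ in Ioo t t', (μ {x | τ < |v x|} + ENNReal.ofReal (2 * ε * √(π * ν))) := by
          rw [lintegral_add_right _ measurable_const, I1, setLIntegral_const, Real.volume_Ioo,
            ENNReal.ofReal_mul (by positivity)]
      _ ≤ ∫⁻ τ in Ioo t t', μ {x | τ < h x} := setLIntegral_mono' measurableSet_Ioo lev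
      _ = _ := I2
      _ ≤ _ := by
          rw [← lintegral_add_left (by fun_prop)]
          exact lintegral_mono pw
  have key2 := (ENNReal.ofReal_le_ofReal_iff (integral_nonneg b0)).1 key
  have eb : ∫ x, b x ∂μ = ε * ((∫ x in W ∩ S1, ‖fderiv ℝ v x‖) + C * ε * volume.real W + L * μ.real S2) := by
    have k1 : Integrable (fun x => ε * S1.indicator (fun x => ‖fderiv ℝ v x‖) x) μ := j1.const_mul ε
    have k2 : Integrable (fun x => ε * S1.indicator (fun x => ‖fderiv ℝ v x‖) x + C * ε ^ 2) μ :=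
      k1.add (integrable_const _)
    rw [hb, integral_add k2 (j2.const_mul _), integral_add k1 (integrable_const _),
      integral_const_mul ε, integral_const_mul (L * ε), integral_indicator mS1, integral_indicator mS2,
      hμ, Measure.restrict_restrict mS1, inter_comm S1 W, integral_const, integral_const]
    simp [Measure.real]; ring
  rw [eb] at key2
  have : ε * (2 * √(π * ν) * (t' - t)) ≤ ε * ((∫ x in W ∩ S1, ‖fderiv ℝ v x‖) + C * ε * volume.real W + L * μ.real S2) := by
    linarith
  exact le_of_mul_le_mul_left this hε

/-- coarea + isoperimetric inequality on a band. -/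
lemma band {v : ℂ → ℝ} (hv : ContDiff ℝ ∞ v) (hc : HasCompactSupport v) {t t' : ℝ} (ht : 0 ≤ t) (htt : t < t') :
    2 * √(π * volume.real {x | t' ≤ |v x|}) * (t' - t) ≤
      ∫ x in {x | t ≤ |v x| ∧ |v x| < t'}, ‖fderiv ℝ v x‖ := by
  obtain ⟨C, hC0, hC⟩ := taylor2 hv hc
  have hdc : Continuous fun x => ‖fderiv ℝ v x‖ := (hv.continuous_fderiv (by simp)).norm
  obtain ⟨L, hL⟩ : ∃ L, ∀ x, ‖fderiv ℝ v x‖ + C ≤ L := by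
    obtain ⟨M, hM⟩ := (hc.fderiv ℝ).exists_bound_of_continuous (hv.continuous_fderiv (by simp))
    exact ⟨M + C, fun x => by linarith [hM x]⟩
  obtain ⟨R, hR⟩ := hc.isCompact.isBounded.subset_ball (0:ℂ)
  have hR' : ∀ x, R ≤ ‖x‖ → v x = 0 := fun x hx => by
    apply image_eq_zero_of_notMem_tsupport
    intro h; have := hR h; rw [mem_ball_zero_iff] at this; linarith
  set W := Metric.ball (0:ℂ) (R+1)
  have Wf : volume W ≠ ⊤ := Metric.isBounded_ball.measure_lt_top.ne
  set μ := volume.restrict W with hμ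
  have : IsFiniteMeasure μ := ⟨by rw [hμ, Measure.restrict_apply_univ]; exact Wf.lt_top⟩
  have L0 : 0 ≤ L := le_trans (by positivity) (hL 0)
  set S1 : Set ℂ := {x | t ≤ |v x| ∧ |v x| < t'} with hS1
  have mono : ∫ x in W ∩ S1, ‖fderiv ℝ v x‖ ≤ ∫ x in S1, ‖fderiv ℝ v x‖ := by
    apply setIntegral_mono_set
    · exact ((hdc.integrable_of_hasCompactSupport (hc.fderiv ℝ).norm)).integrableOn
    · exact ae_of_all _ fun x => norm_nonneg _
    · exact inter_subset_right.eventuallyLE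
  set s : ℕ → Set ℂ := fun n => {x | t - L * (1 / ((n:ℝ) + 1)) < |v x| ∧ |v x| < t} with hs
  have lim2 : Tendsto (fun n => μ.real (s n)) atTop (𝓝 0) := by
    have hanti : Antitone s := by
      intro n m hnm x hx
      refine ⟨lt_of_le_of_lt ?_ hx.1, hx.2⟩
      have : 1 / ((m:ℝ) + 1) ≤ 1 / ((n:ℝ) + 1) := by gcongr
      nlinarith
    have hempty : ⋂ n, s n = ∅ := by
      rw [eq_empty_iff_forall_notMem]
      intro x hx
      rw [mem_iInter] at hx
      have l1 : Tendsto (fun n : ℕ => t - L * (1 / ((n:ℝ) + 1))) atTop (𝓝 (t - L * 0)) :=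
        tendsto_const_nhds.sub (tendsto_const_nhds.mul tendsto_one_div_add_atTop_nhds_zero_nat)
      have := le_of_tendsto l1 (Eventually.of_forall fun n => (hx n).1.le)
      have := (hx 0).2
      simp at *; linarith
    have := tendsto_measure_iInter_atTop (μ := μ) (s := s) (fun n => by
      apply MeasurableSet.nullMeasurableSet
      exact (measurableSet_lt measurable_const hv.continuous.abs.measurable).inter
        (measurableSet_lt hv.continuous.abs.measurable measurable_const)) hanti ⟨0, measure_ne_top _ _⟩
    rw [hempty, measure_empty] at this
    exact (ENNReal.tendsto_toReal ENNReal.zero_ne_top).comp this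
  have lim : Tendsto (fun n : ℕ => (∫ x in W ∩ S1, ‖fderiv ℝ v x‖) + C * (1 / ((n:ℝ) + 1)) * volume.real W +
      L * μ.real (s n)) atTop (𝓝 ((∫ x in W ∩ S1, ‖fderiv ℝ v x‖) + C * 0 * volume.real W + L * 0)) :=
    (tendsto_const_nhds.add ((tendsto_const_nhds.mul tendsto_one_div_add_atTop_nhds_zero_nat).mul
      tendsto_const_nhds)).add (tendsto_const_nhds.mul lim2)
  have := ge_of_tendsto lim (Eventually.of_forall fun n => band_eps hv hR' hC0 hC hL ht htt
    (ε := 1 / ((n:ℝ)+1)) (by positivity) (by rw [div_le_one (by positivity)]; linarith [n.cast_nonneg (α := ℝ)]))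
  simp only [mul_zero, zero_mul, add_zero] at this
  exact this.trans mono

lemma cs_int {α : Type*} [MeasurableSpace α] {μ : Measure α} {f g : α → ℝ}
    (hf : Integrable (fun x => f x ^ 2) μ) (hg : Integrable (fun x => g x ^ 2) μ)
    (hfg : Integrable (fun x => f x * g x) μ) :
    (∫ x, f x * g x ∂μ) ^ 2 ≤ (∫ x, f x ^ 2 ∂μ) * ∫ x, g x ^ 2 ∂μ := by
  have key : ∀ t : ℝ, 0 ≤ (∫ x, f x ^ 2 ∂μ) * (t * t) + (-2 * ∫ x, f x * g x ∂μ) * t + ∫ x, g x ^ 2 ∂μ := by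
    intro t
    have h0 : 0 ≤ ∫ x, (t * f x - g x) ^ 2 ∂μ := integral_nonneg fun x => sq_nonneg _
    have e : ∀ x, (t * f x - g x) ^ 2 = (t ^ 2 * f x ^ 2 - 2 * t * (f x * g x)) + g x ^ 2 := fun x => by ring
    simp_rw [e] at h0
    have i1 : Integrable (fun x => t ^ 2 * f x ^ 2) μ := hf.const_mul _
    have i2 : Integrable (fun x => 2 * t * (f x * g x)) μ := hfg.const_mul _
    have i3 : Integrable (fun x => t ^ 2 * f x ^ 2 - 2 * t * (f x * g x)) μ := i1.sub i2
    rw [integral_add i3 hg, integral_sub i1 i2, integral_const_mul, integral_const_mul] at h0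
    linarith
  have := discrim_le_zero key
  rw [discrim] at this
  nlinarith

/-- distribution function on the unit disc -/
noncomputable def nu (v : ℂ → ℝ) (t : ℝ) : ℝ := volume.real (Metric.ball (0:ℂ) 1 ∩ {x | t ≤ |v x|})

/-- energy of a band in the unit disc -/
noncomputable def Eb (v : ℂ → ℝ) (t t' : ℝ) : ℝ :=
  ∫ x in Metric.ball (0:ℂ) 1 ∩ {x | t ≤ |v x| ∧ |v x| < t'}, ‖fderiv ℝ v x‖ ^ 2

structure DTest (v : ℂ → ℝ) : Prop where
  smooth : ContDiff ℝ ∞ v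
  cpt : HasCompactSupport v
  supp : tsupport v ⊆ Metric.ball (0:ℂ) 1

namespace DTest
variable {v : ℂ → ℝ}

lemma dcont (h : DTest v) : Continuous fun x => ‖fderiv ℝ v x‖ := (h.smooth.continuous_fderiv (by simp)).norm

lemma dint (h : DTest v) : Integrable fun x => ‖fderiv ℝ v x‖ :=
  h.dcont.integrable_of_hasCompactSupport (h.cpt.fderiv ℝ).norm

lemma dint2 (h : DTest v) : Integrable fun x => ‖fderiv ℝ v x‖ ^ 2 := by
  apply (h.dcont.pow 2).integrable_of_hasCompactSupport
  have h1 : HasCompactSupport fun x => ‖fderiv ℝ v x‖ := (h.cpt.fderiv ℝ).norm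
  have h2 := h1.comp_left (g := fun x : ℝ => x ^ 2) (by norm_num)
  exact h2

lemma mle (h : DTest v) (t : ℝ) : MeasurableSet {x : ℂ | t ≤ |v x|} :=
  measurableSet_le measurable_const h.smooth.continuous.abs.measurable

lemma mlt (h : DTest v) (t : ℝ) : MeasurableSet {x : ℂ | |v x| < t} :=
  measurableSet_lt h.smooth.continuous.abs.measurable measurable_const

lemma mband (h : DTest v) (t t' : ℝ) : MeasurableSet (Metric.ball (0:ℂ) 1 ∩ {x | t ≤ |v x| ∧ |v x| < t'}) :=
  Metric.isOpen_ball.measurableSet.inter ((h.mle t).inter (h.mlt t'))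

lemma zero_out (h : DTest v) {x : ℂ} (hx : x ∉ Metric.ball (0:ℂ) 1) : v x = 0 :=
  image_eq_zero_of_notMem_tsupport fun hh => hx (h.supp hh)

lemma dzero_out (h : DTest v) {x : ℂ} (hx : x ∉ Metric.ball (0:ℂ) 1) : fderiv ℝ v x = 0 :=
  image_eq_zero_of_notMem_tsupport fun hh => hx (h.supp (tsupport_fderiv_subset ℝ hh))

lemma nu_anti (h : DTest v) {t t' : ℝ} (htt : t ≤ t') : nu v t' ≤ nu v t := by
  apply measureReal_mono
  · exact inter_subset_inter_right _ fun x hx => htt.trans hx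
  · exact (Metric.isBounded_ball.measure_lt_top.trans_le' (measure_mono inter_subset_left)).ne

lemma nu_sub (h : DTest v) {t t' : ℝ} (htt : t ≤ t') :
    volume.real (Metric.ball (0:ℂ) 1 ∩ {x | t ≤ |v x| ∧ |v x| < t'}) = nu v t - nu v t' := by
  have e : Metric.ball (0:ℂ) 1 ∩ {x | t ≤ |v x|} =
      (Metric.ball (0:ℂ) 1 ∩ {x | t ≤ |v x| ∧ |v x| < t'}) ∪ (Metric.ball (0:ℂ) 1 ∩ {x | t' ≤ |v x|}) := by
    ext x; simp only [mem_inter_iff, mem_union, mem_ofPred_eq]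
    constructor
    · rintro ⟨h1, h2⟩
      rcases lt_or_ge |v x| t' with h3 | h3
      · exact Or.inl ⟨h1, h2, h3⟩
      · exact Or.inr ⟨h1, h3⟩
    · rintro (⟨h1, h2, h3⟩ | ⟨h1, h2⟩)
      · exact ⟨h1, h2⟩
      · exact ⟨h1, htt.trans h2⟩
  have fin : ∀ s : Set ℂ, volume (Metric.ball (0:ℂ) 1 ∩ s) ≠ ⊤ := fun s =>
    (Metric.isBounded_ball.measure_lt_top.trans_le' (measure_mono inter_subset_left)).ne
  have : nu v t = volume.real (Metric.ball (0:ℂ) 1 ∩ {x | t ≤ |v x| ∧ |v x| < t'}) + nu v t' := by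
    rw [nu, e, measureReal_union _ (Metric.isOpen_ball.measurableSet.inter (h.mle t')) (fin _) (fin _)]
    · rfl
    · rw [Set.disjoint_left]; intro x hx hx'
      exact absurd hx.2.2 (not_lt.2 hx'.2)
  linarith

lemma nu_zero (h : DTest v) : nu v 0 = π := by
  have : {x : ℂ | 0 ≤ |v x|} = univ := by ext x; simp
  rw [nu, this, inter_univ, Measure.real, Complex.volume_ball]
  simp

lemma Eb_nonneg (t t' : ℝ) : 0 ≤ Eb v t t' := integral_nonneg fun x => sq_nonneg _

lemma band2 (h : DTest v) {t t' : ℝ} (ht : 0 ≤ t) (htt : t < t') :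
    4 * π * (t' - t) ^ 2 * nu v t' ≤ (nu v t - nu v t') * Eb v t t' := by
  have b := band h.smooth h.cpt ht htt
  have t0 : 0 < t' := ht.trans_lt htt
  have e1 : {x : ℂ | t' ≤ |v x|} = Metric.ball (0:ℂ) 1 ∩ {x | t' ≤ |v x|} := by
    symm; rw [inter_eq_right]
    intro x hx; by_contra hc
    have : t' ≤ |v x| := hx
    rw [h.zero_out hc] at this; simp at this; linarith
  have e2 : ∫ x in {x | t ≤ |v x| ∧ |v x| < t'}, ‖fderiv ℝ v x‖ =
      ∫ x in Metric.ball (0:ℂ) 1 ∩ {x | t ≤ |v x| ∧ |v x| < t'}, ‖fderiv ℝ v x‖ := by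
    rw [inter_comm]
    apply setIntegral_eq_of_subset_of_forall_sdiff_eq_zero (show MeasurableSet {x : ℂ | t ≤ |v x| ∧ |v x| < t'} from (h.mle t).inter (h.mlt t')) inter_subset_left
    intro x hx
    rw [h.dzero_out, norm_zero]
    intro hb; exact hx.2 ⟨hx.1, hb⟩
  rw [e1, e2] at b
  change 2 * √(π * nu v t') * (t' - t) ≤ _ at b
  set s := Metric.ball (0:ℂ) 1 ∩ {x | t ≤ |v x| ∧ |v x| < t'} with hs
  have sf : volume s ≠ ⊤ := (Metric.isBounded_ball.measure_lt_top.trans_le' (measure_mono inter_subset_left)).ne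
  have cs := cs_int (μ := volume.restrict s) (f := fun _ => 1) (g := fun x => ‖fderiv ℝ v x‖)
    (by simp only [one_pow]; exact integrableOn_const sf) h.dint2.integrableOn (by simp only [one_mul]; exact h.dint.integrableOn)
  simp only [one_mul, one_pow, integral_const, smul_eq_mul, mul_one, measureReal_restrict_apply_univ] at cs
  rw [hs, h.nu_sub htt.le, ← hs] at cs
  have nn : 0 ≤ nu v t' := measureReal_nonneg
  have b2 := pow_le_pow_left₀ (by have := sub_pos.2 htt; positivity) b 2
  rw [mul_pow, mul_pow, Real.sq_sqrt (by positivity)] at b2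
  rw [Eb]
  linarith

lemma Eb_add (h : DTest v) {a b c : ℝ} (hab : a ≤ b) (hbc : b ≤ c) : Eb v a c = Eb v a b + Eb v b c := by
  rw [Eb, Eb, Eb, ← setIntegral_union _ (h.mband b c) h.dint2.integrableOn h.dint2.integrableOn, ← inter_union_distrib_left]
  · congr 3; ext x; simp only [mem_ofPred_eq, mem_union]
    constructor
    · rintro ⟨h1, h2⟩
      rcases lt_or_ge |v x| b with h3 | h3
      · exact Or.inl ⟨h1, h3⟩
      · exact Or.inr ⟨h3, h2⟩
    · rintro (⟨h1, h2⟩ | ⟨h1, h2⟩)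
      · exact ⟨h1, h2.trans_le hbc⟩
      · exact ⟨hab.trans h1, h2⟩
  · rw [Set.disjoint_left]; intro x hx hx'
    exact absurd hx.2.2 (not_lt.2 hx'.2.1)

lemma Eb_sum (h : DTest v) {a δ : ℝ} (hδ : 0 ≤ δ) (m : ℕ) :
    Eb v a (a + m * δ) = ∑ j ∈ Finset.range m, Eb v (a + j * δ) (a + (j + 1 : ℕ) * δ) := by
  induction m with
  | zero =>
    simp only [Nat.cast_zero, zero_mul, add_zero, Finset.range_zero, Finset.sum_empty]
    have : {x : ℂ | a ≤ |v x| ∧ |v x| < a} = ∅ := by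
      ext x; simp only [mem_ofPred_eq, mem_empty_iff_false, iff_false]; rintro ⟨h1, h2⟩; linarith
    rw [Eb, this]; simp
  | succ m ih =>
    rw [Finset.sum_range_succ, ← ih]
    apply h.Eb_add
    · have : 0 ≤ (m:ℝ) * δ := by positivity
      linarith
    · push_cast; nlinarith

lemma tangent_ineq {r a : ℝ} (hr : 0 < r) (ha : 0 < a) :
    1 / (exp a - 1) - exp a / (exp a - 1) ^ 2 * (r - a) ≤ 1 / (exp r - 1) := by
  have hp : 0 < exp a - 1 := by have := Real.add_one_lt_exp ha.ne'; linarith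
  have hq : 0 < exp r - 1 := by have := Real.add_one_lt_exp hr.ne'; linarith
  have h1 : 1 - exp a / exp r ≤ r - a := by
    have := Real.add_one_le_exp (a - r)
    rw [exp_sub] at this; linarith
  have er := exp_pos r
  have ea := exp_pos a
  have h2 : 1 / (exp a - 1) - exp a / (exp a - 1) ^ 2 * (1 - exp a / exp r) ≤ 1 / (exp r - 1) := by
    generalize exp a = A at *
    generalize exp r = B at *
    rw [← sub_nonneg]
    have : 1 / (B - 1) - (1 / (A - 1) - A / (A - 1) ^ 2 * (1 - A / B)) =
        (B - A) ^ 2 / ((A - 1) ^ 2 * (B - 1) * B) := by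
      field_simp; ring
    rw [this]; positivity
  have h3 : exp a / (exp a - 1) ^ 2 * (1 - exp a / exp r) ≤ exp a / (exp a - 1) ^ 2 * (r - a) := by gcongr
  linarith

lemma isocap_m (h : DTest v) {t t' : ℝ} (ht : 0 ≤ t) (htt : t < t') (hn : 0 < nu v t') {m : ℕ} (hm : 0 < m) :
    4 * π * (t' - t) ^ 2 ≤ Eb v t t' * (m * (exp (log (nu v t / nu v t') / m) - 1)) := by
  set δ := (t' - t) / m with hδ
  have m0 : (0:ℝ) < m := by exact_mod_cast hm
  have δ0 : 0 < δ := div_pos (sub_pos.2 htt) m0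
  have et : t + m * δ = t' := by rw [hδ]; field_simp; ring
  set T : ℕ → ℝ := fun j => t + j * δ with hT
  have T0 : ∀ j, 0 ≤ T j := fun j => by positivity
  have Tlt : ∀ j, T j < T (j + 1) := fun j => by simp only [hT]; push_cast; nlinarith
  have Tle : ∀ j ≤ m, T j ≤ t' := fun j hj => by
    rw [← et]; simp only [hT]; gcongr
  have npos : ∀ j ≤ m, 0 < nu v (T j) := fun j hj => hn.trans_le (h.nu_anti (Tle j hj))
  have b : ∀ j < m, 4 * π * δ ^ 2 * nu v (T (j+1)) ≤ (nu v (T j) - nu v (T (j + 1))) * Eb v (T j) (T (j+1)) := by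
    intro j hj
    have := h.band2 (T0 j) (Tlt j)
    have e : T (j + 1) - T j = δ := by simp only [hT]; push_cast; ring
    rwa [e] at this
  have nlt : ∀ j < m, nu v (T (j+1)) < nu v (T j) := by
    intro j hj
    have h1 := b j hj
    have h2 : 0 < 4 * π * δ ^ 2 * nu v (T (j+1)) := by have := npos (j+1) hj; positivity
    have h3 := Eb_nonneg (v := v) (T j) (T (j+1))
    by_contra hc
    nlinarith
  set R := log (nu v t / nu v t') with hR
  set r : ℕ → ℝ := fun j => log (nu v (T j)) - log (nu v (T (j+1))) with hr
  have rsum : ∑ j ∈ Finset.range m, r j = R := by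
    rw [hr, Finset.sum_range_sub' (fun j => log (nu v (T j)))]
    have e0 : T 0 = t := by simp [hT]
    have em : T m = t' := et
    rw [e0, em, hR, log_div _ hn.ne']
    have := npos 0 (Nat.zero_le _); rw [e0] at this; exact this.ne'
  have rpos : ∀ j < m, 0 < r j := fun j hj => by
    rw [hr]; simp only [sub_pos]; exact log_lt_log (npos _ hj) (nlt j hj)
  have Rpos : 0 < R := by
    rw [← rsum]; apply Finset.sum_pos (fun j hj => rpos j (Finset.mem_range.1 hj)) ⟨0, by simpa using hm⟩
  set a := R / m with ha
  have apos : 0 < a := div_pos Rpos m0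
  have hp : 0 < exp a - 1 := by have := Real.add_one_lt_exp apos.ne'; linarith
  have each : ∀ j ∈ Finset.range m, 4 * π * δ ^ 2 * (1 / (exp a - 1) - exp a / (exp a - 1) ^ 2 * (r j - a)) ≤
      Eb v (T j) (T (j+1)) := by
    intro j hj
    rw [Finset.mem_range] at hj
    have h1 := tangent_ineq (rpos j hj) apos
    have h2 := b j hj
    have h3 := npos (j+1) hj
    have er : exp (r j) - 1 = (nu v (T j) - nu v (T (j+1))) / nu v (T (j+1)) := by
      rw [hr]; simp only [exp_sub]; rw [exp_log (npos j hj.le), exp_log h3]; field_simp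
    have hq : 0 < exp (r j) - 1 := by have := Real.add_one_lt_exp (rpos j hj).ne'; linarith [rpos j hj]
    have : 4 * π * δ ^ 2 * (1 / (exp (r j) - 1)) ≤ Eb v (T j) (T (j+1)) := by
      rw [mul_one_div, div_le_iff₀ hq, er, mul_div_assoc', le_div_iff₀ h3]; linarith
    exact le_trans (by gcongr) this
  have sum := Finset.sum_le_sum each
  have eE := h.Eb_sum (a := t) δ0.le m
  rw [et] at eE
  have eE' : Eb v t t' = ∑ j ∈ Finset.range m, Eb v (T j) (T (j+1)) := eE
  rw [← eE', ← Finset.mul_sum, Finset.sum_sub_distrib, ← Finset.mul_sum, Finset.sum_sub_distrib, rsum] at sum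
  simp only [Finset.sum_const, Finset.card_range, nsmul_eq_mul] at sum
  have : R - m * a = 0 := by rw [ha]; field_simp; ring
  rw [this, mul_zero, sub_zero, mul_one_div, mul_div_assoc', div_le_iff₀ hp] at sum
  have e5 : 4 * π * (t' - t) ^ 2 = 4 * π * δ ^ 2 * m * m := by rw [hδ]; field_simp
  rw [e5]
  calc _ ≤ Eb v t t' * (exp a - 1) * m := by gcongr
    _ = _ := by ring

theorem isocap (h : DTest v) {t t' : ℝ} (ht : 0 ≤ t) (htt : t < t') (hn : 0 < nu v t') :
    4 * π * (t' - t) ^ 2 ≤ Eb v t t' * log (nu v t / nu v t') := by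
  set R := log (nu v t / nu v t') with hR
  have R0 : 0 ≤ R := by
    apply log_nonneg; rw [le_div_iff₀ hn, one_mul]; exact h.nu_anti htt.le
  have hm : ∀ m : ℕ, 4 * π * (t' - t) ^ 2 ≤ Eb v t t' * (R * exp (R * (1 / ((m:ℝ) + 1)))) := by
    intro m
    refine (h.isocap_m ht htt hn (Nat.succ_pos m)).trans ?_
    apply mul_le_mul_of_nonneg_left _ (Eb_nonneg _ _)
    rw [← hR]
    push_cast
    set M := (m:ℝ) + 1
    have M0 : 0 < M := by positivity
    have h1 : exp (R / M) - 1 ≤ R / M * exp (R / M) := by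
      have := Real.add_one_le_exp (-(R / M))
      rw [exp_neg] at this
      have e := exp_pos (R / M)
      have := mul_le_mul_of_nonneg_left this e.le
      rw [mul_inv_cancel₀ e.ne'] at this
      linarith
    calc M * (exp (R / M) - 1) ≤ M * (R / M * exp (R / M)) := by gcongr
      _ = R * exp (R * (1 / M)) := by rw [mul_one_div]; field_simp
  have lim : Tendsto (fun m : ℕ => Eb v t t' * (R * exp (R * (1 / ((m:ℝ) + 1))))) atTop
      (𝓝 (Eb v t t' * (R * exp (R * 0)))) :=
    tendsto_const_nhds.mul (tendsto_const_nhds.mul ((continuous_exp.tendsto _).comp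
      (tendsto_const_nhds.mul tendsto_one_div_add_atTop_nhds_zero_nat)))
  have := ge_of_tendsto' lim hm
  simpa using this

end DTest

lemma step_slope (s : ℕ → ℝ) (h0 : s 0 = 0) {δ : ℝ} (hδ : 0 ≤ δ) (n : ℕ) (hs : ∀ k < n, s k < s (k+1)) :
    ∃ g C, Slope g C (s n) ∧ (∫ x in Ioi (0:ℝ), g x ^ 2) = ∑ k ∈ Finset.range n, δ ^ 2 / (s (k+1) - s k) ∧
      (∀ k ≤ n, ∫ x in (0:ℝ)..(s k), g x = k * δ) ∧ ∀ x, s n ≤ x → ∫ y in (0:ℝ)..x, g y = n * δ := by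
  induction n with
  | zero =>
    refine ⟨fun _ => 0, 0, ⟨measurable_const, fun _ => le_rfl, fun _ => le_rfl, fun _ _ => rfl, le_rfl, h0.ge⟩, ?_, ?_, ?_⟩
    · simp
    · intro k hk; simp [Nat.le_zero.1 hk]
    · simp
  | succ n ih =>
    obtain ⟨g, C, hg, h1, h2, h3⟩ := ih (fun k hk => hs k (hk.trans (Nat.lt_succ_self n)))
    set a := s n with ha
    set b := s (n+1) with hb
    have hab : a < b := hs n (Nat.lt_succ_self n)
    have a0 : 0 ≤ a := hg.R0
    set c := δ / (b - a) with hc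
    have c0 : 0 ≤ c := div_nonneg hδ (sub_nonneg.2 hab.le)
    set i : ℝ → ℝ := (Ioc a b).indicator (fun _ => c) with hi
    have im : Measurable i := measurable_const.indicator measurableSet_Ioc
    have i0 : ∀ x, 0 ≤ i x := fun x => indicator_nonneg (fun _ _ => c0) x
    have ile : ∀ x, i x ≤ c := fun x => indicator_le_self' (fun _ _ => c0) x
    have iint : Integrable i := by
      rw [hi, integrable_indicator_iff measurableSet_Ioc]; exact integrableOn_const (by simp)
    have iloc : ∀ x y, IntervalIntegrable i volume x y := fun x y => iint.intervalIntegrable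
    have ibig : ∀ x, b ≤ x → ∫ y in (0:ℝ)..x, i y = δ := by
      intro x hx
      have hx0 : 0 ≤ x := by linarith
      rw [intervalIntegral.integral_of_le hx0, hi, setIntegral_indicator measurableSet_Ioc,
        inter_eq_right.2 (Ioc_subset_Ioc a0 hx), setIntegral_const, measureReal_def, Real.volume_Ioc,
        ENNReal.toReal_ofReal (sub_nonneg.2 hab.le), smul_eq_mul, hc]
      have : b - a ≠ 0 := (sub_pos.2 hab).ne'
      field_simp
    have ismall : ∀ x, 0 ≤ x → x ≤ a → ∫ y in (0:ℝ)..x, i y = 0 := by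
      intro x hx0 hx
      rw [intervalIntegral.integral_of_le hx0, hi, setIntegral_indicator measurableSet_Ioc]
      have : Ioc 0 x ∩ Ioc a b = ∅ := by
        ext y; simp only [mem_inter_iff, mem_Ioc, mem_empty_iff_false, iff_false]
        rintro ⟨⟨_, h1⟩, h2, _⟩; linarith
      rw [this]; simp
    have add : ∀ x, ∫ y in (0:ℝ)..x, (g y + i y) = (∫ y in (0:ℝ)..x, g y) + ∫ y in (0:ℝ)..x, i y :=
      fun x => intervalIntegral.integral_add (hg.locInt _ _) (iloc _ _)
    have big : ∀ x, b ≤ x → ∫ y in (0:ℝ)..x, (g y + i y) = (n+1 : ℕ) * δ := by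
      intro x hx; rw [add, h3 x (hab.le.trans hx), ibig x hx]; push_cast; ring
    have sm : ∀ k ≤ n, 0 ≤ s k ∧ s k ≤ a := by
      have mono : ∀ m ≤ n, ∀ k ≤ m, s k ≤ s m := by
        intro m
        induction m with
        | zero => intro _ k hk; rw [Nat.le_zero.1 hk]
        | succ m ihm =>
          intro hm k hk
          rcases Nat.le_succ_iff.1 hk with h | h
          · exact (ihm (by omega) k h).trans (hs m (by omega)).le
          · rw [h]
      intro k hk
      refine ⟨by rw [← h0]; exact mono k hk 0 (Nat.zero_le _), mono n le_rfl k hk⟩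
    refine ⟨fun x => g x + i x, C + c, ⟨hg.meas.add im, fun x => add_nonneg (hg.nonneg x) (i0 x),
      fun x => add_le_add (hg.le x) (ile x), fun x hx => ?_, add_nonneg hg.C0 c0, a0.trans hab.le⟩, ?_, ?_, big⟩
    · rw [hg.zero x (hab.trans hx), hi, indicator_of_notMem (fun h => absurd h.2 (not_le.2 hx))]; simp
    · have e : ∀ x, (g x + i x) ^ 2 = g x ^ 2 + c * i x := by
        intro x
        by_cases hx : x ∈ Ioc a b
        · rw [hg.zero x hx.1, hi, indicator_of_mem hx]; ring
        · rw [hi, indicator_of_notMem hx]; ring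
      simp_rw [e]
      rw [integral_add (hg.sq_int_Ioi 0) (iint.integrableOn.const_mul c), h1, Finset.sum_range_succ,
        integral_const_mul, hi, setIntegral_indicator measurableSet_Ioc, inter_eq_right.2 (fun x (hx : x ∈ Ioc a b) => mem_Ioi.2 (lt_of_le_of_lt a0 hx.1)),
        setIntegral_const, measureReal_def, Real.volume_Ioc,
        ENNReal.toReal_ofReal (sub_nonneg.2 hab.le), smul_eq_mul, hc]
      have : b - a ≠ 0 := (sub_pos.2 hab).ne'
      congr 1
      rw [← ha, ← hb]
      field_simp
    · intro k hk
      rcases Nat.le_succ_iff.1 hk with h | h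
      · rw [add, h2 k h, ismall _ (sm k h).1 (sm k h).2, add_zero]
      · rw [h]; exact big b le_rfl

namespace DTest
variable {v : ℂ → ℝ}

lemma int_split (h : DTest v) {F : ℂ → ℝ} (hF : IntegrableOn F (Metric.ball 0 1)) {a b : ℝ} (hab : a ≤ b) :
    ∫ x in Metric.ball (0:ℂ) 1 ∩ {x | a ≤ |v x|}, F x =
      (∫ x in Metric.ball (0:ℂ) 1 ∩ {x | a ≤ |v x| ∧ |v x| < b}, F x) +
      ∫ x in Metric.ball (0:ℂ) 1 ∩ {x | b ≤ |v x|}, F x := by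
  rw [← setIntegral_union _ (Metric.isOpen_ball.measurableSet.inter (h.mle b)) (hF.mono_set inter_subset_left)
    (hF.mono_set inter_subset_left), ← inter_union_distrib_left]
  · congr 3; ext x; simp only [mem_ofPred_eq, mem_union]
    constructor
    · intro h1
      rcases lt_or_ge |v x| b with h3 | h3
      · exact Or.inl ⟨h1, h3⟩
      · exact Or.inr h3
    · rintro (⟨h1, h2⟩ | h1)
      · exact h1
      · exact hab.trans h1
  · rw [Set.disjoint_left]; intro x hx hx'
    exact absurd hx.2.2 (not_lt.2 hx'.2)

lemma nu_pos (h : DTest v) {t M : ℝ} (ht : t < M) (ht0 : 0 ≤ t) {x0 : ℂ} (hx0 : |v x0| = M) : 0 < nu v t := by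
  have hne : volume (Metric.ball (0:ℂ) 1 ∩ {x | t ≤ |v x|}) ≠ 0 := by
    have ho : IsOpen (Metric.ball (0:ℂ) 1 ∩ {x | t < |v x|}) :=
      Metric.isOpen_ball.inter (isOpen_lt continuous_const h.smooth.continuous.abs)
    have hx : x0 ∈ Metric.ball (0:ℂ) 1 := by
      by_contra hc
      rw [h.zero_out hc] at hx0; simp at hx0; linarith
    have := ho.measure_pos volume ⟨x0, hx, by simp only [mem_ofPred_eq]; rw [hx0]; exact ht⟩
    exact (this.trans_le (measure_mono (inter_subset_inter_right _ fun x (hx : t < |v x|) => le_of_lt hx))).ne'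
  exact ENNReal.toReal_pos hne (Metric.isBounded_ball.measure_lt_top.trans_le' (measure_mono inter_subset_left)).ne

lemma expint (h : DTest v) (s : Set ℂ) : IntegrableOn (fun x => exp (4 * π * v x ^ 2) - 1) s := by
  apply Integrable.integrableOn
  have := h.smooth.continuous
  apply (by fun_prop : Continuous fun x => exp (4 * π * v x ^ 2) - 1).integrable_of_hasCompactSupport
  exact h.cpt.comp_left (g := fun t : ℝ => exp (4 * π * t ^ 2) - 1) (by norm_num)

lemma disc_step (h : DTest v) (hE : ∫ x, ‖fderiv ℝ v x‖ ^ 2 ≤ 1) {M : ℝ} (hM : 0 < M) (hvM : ∀ x, |v x| ≤ M)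
    {x0 : ℂ} (hx0 : |v x0| = M) (n : ℕ) {A η t0 : ℝ} (hA : 0 < A) (ht0 : 0 < t0)
    (hη : √(4 * π) * (t0 + M / (n + 1)) ≤ η) (hnu : nu v t0 ≤ π * exp (-A)) :
    ∃ g C R, Slope g C R ∧ (∫ s in Ioi (0:ℝ), g s ^ 2) ≤ 1 ∧ (∫ s in (0:ℝ)..A, g s) ≤ η ∧
      ∫ x in Metric.ball (0:ℂ) 1, (exp (4 * π * v x ^ 2) - 1) ≤
        π * (exp (8 * π * M ^ 2 / (n + 1)) * (∫ s in Ioi (0:ℝ), (exp ((∫ x in (0:ℝ)..s, g x) ^ 2) - 1) * exp (-s))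
          + (exp (8 * π * M ^ 2 / (n + 1)) - 1)) := by
  set δ := M / ((n:ℝ) + 1) with hδ
  have δ0 : 0 < δ := by positivity
  have eM : ((n:ℝ) + 1) * δ = M := by rw [hδ]; field_simp
  set T : ℕ → ℝ := fun k => 0 + k * δ with hT
  have T0 : ∀ k, 0 ≤ T k := fun k => by positivity
  have Ts : ∀ k, T (k+1) = T k + δ := fun k => by simp only [hT]; push_cast; ring
  have Tmono : ∀ j k, j ≤ k → T j ≤ T k := fun j k hjk => by simp only [hT]; gcongr
  have TM : T (n+1) = M := by simp only [hT]; push_cast; linarith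
  have TnM : ∀ k ≤ n, T k < M := fun k hk => by rw [← TM, Ts]; linarith [Tmono k n hk]
  have npos : ∀ k ≤ n, 0 < nu v (T k) := fun k hk => h.nu_pos (TnM k hk) (T0 k) hx0
  set s : ℕ → ℝ := fun k => log (π / nu v (T k)) with hs
  have es : ∀ k ≤ n, nu v (T k) = π * exp (- s k) := by
    intro k hk
    have := npos k hk
    simp only [hs]; rw [exp_neg, exp_log (by positivity)]; field_simp
  have s0 : s 0 = 0 := by
    simp only [hs, hT]; simp [h.nu_zero]
  have sd : ∀ k < n, log (nu v (T k) / nu v (T (k+1))) = s (k+1) - s k := by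
    intro k hk
    have h1 := npos k hk.le
    have h2 := npos (k+1) hk
    simp only [hs]
    rw [log_div h1.ne' h2.ne', log_div pi_ne_zero h1.ne', log_div pi_ne_zero h2.ne']; ring
  have iso : ∀ k < n, 4 * π * δ ^ 2 ≤ Eb v (T k) (T (k+1)) * (s (k+1) - s k) := by
    intro k hk
    have := h.isocap (T0 k) (by rw [Ts]; linarith : T k < T (k+1)) (npos _ hk)
    rw [sd k hk, Ts] at this
    have e : T k + δ - T k = δ := by ring
    rw [e, ← Ts] at this; exact this
  have slt : ∀ k < n, s k < s (k+1) := by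
    intro k hk
    have h1 := iso k hk
    have h2 := Eb_nonneg (v := v) (T k) (T (k+1))
    have h3 : 0 < 4 * π * δ ^ 2 := by positivity
    by_contra hc
    nlinarith
  set d := √(4 * π) * δ with hd
  have d0 : 0 ≤ d := by positivity
  obtain ⟨g, C, hg, hg2, hgk, hgx⟩ := step_slope s s0 d0 n slt
  refine ⟨g, C, s n, hg, ?_, ?_, ?_⟩
  · rw [hg2]
    calc _ ≤ ∑ k ∈ Finset.range n, Eb v (T k) (T (k+1)) := by
          apply Finset.sum_le_sum
          intro k hk
          rw [Finset.mem_range] at hk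
          rw [div_le_iff₀ (sub_pos.2 (slt k hk)), hd, mul_pow, Real.sq_sqrt (by positivity)]
          exact iso k hk
      _ = Eb v 0 (0 + n * δ) := (h.Eb_sum δ0.le n).symm
      _ ≤ _ := le_trans (setIntegral_le_integral h.dint2 (ae_of_all _ fun x => sq_nonneg _)) hE
  · by_cases hex : ∃ k, k ≤ n ∧ t0 ≤ T k
    · obtain ⟨hk1, hk2⟩ := Nat.find_spec hex
      set k := Nat.find hex with hk
      have kpos : k ≠ 0 := by
        intro hk0; rw [hk0] at hk2; simp [hT] at hk2; linarith
      obtain ⟨j, hj⟩ := Nat.exists_eq_succ_of_ne_zero kpos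
      have hjlt : T j < t0 := by
        have := Nat.find_min hex (m := j) (by rw [← hk, hj]; exact Nat.lt_succ_self j)
        by_contra hc; exact this ⟨by omega, not_lt.1 hc⟩
      have hTk : T k ≤ t0 + δ := by rw [hj, Nat.succ_eq_add_one, Ts]; linarith
      have hAs : A ≤ s k := by
        have h1 := (h.nu_anti hk2).trans hnu
        rw [es k hk1] at h1
        have := le_of_mul_le_mul_left h1 pi_pos
        rw [exp_le_exp] at this; linarith
      refine (hg.prim_mono hAs).trans ?_
      rw [hgk k hk1]
      have : (k:ℝ) * d = √(4 * π) * T k := by simp only [hT, hd]; ring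
      rw [this]
      exact le_trans (by gcongr) hη
    · push Not at hex
      have h1 := hg.prim_mono (le_max_left A (s n))
      rw [hgx _ (le_max_right A (s n))] at h1
      have : (n:ℝ) * d = √(4 * π) * T n := by simp only [hT, hd]; ring
      rw [this] at h1
      refine h1.trans (le_trans ?_ hη)
      have := hex n le_rfl
      gcongr; linarith
  · set K := exp (8 * π * M ^ 2 / (n + 1)) with hK
    set w : ℝ → ℝ := fun s => ∫ x in (0:ℝ)..s, g x with hw
    have K1 : 1 ≤ K := by rw [hK]; apply one_le_exp; positivity
    have wk : ∀ k ≤ n, w (s k) ^ 2 = 4 * π * T k ^ 2 := by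
      intro k hk
      simp only [hw]; rw [hgk k hk, hd]
      have e : (k:ℝ) * (√(4 * π) * δ) = √(4 * π) * T k := by simp only [hT]; ring
      rw [e, mul_pow, Real.sq_sqrt (by positivity)]
    have expK : ∀ k ≤ n, exp (4 * π * T (k+1) ^ 2) - 1 ≤ K * (exp (w (s k) ^ 2) - 1) + (K - 1) := by
      intro k hk
      have : exp (4 * π * T (k+1) ^ 2) ≤ K * exp (w (s k) ^ 2) := by
        rw [hK, wk k hk, ← exp_add, exp_le_exp, Ts]
        have h1 := TnM k hk
        have h3 : T k + δ ≤ M := by rw [← Ts, ← TM]; exact Tmono _ _ (by omega)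
        have h2 : 8 * π * M ^ 2 / (n + 1) = 4 * π * (δ * (2 * M)) := by rw [hδ]; ring
        rw [h2]
        have : (T k + δ) ^ 2 ≤ δ * (2 * M) + T k ^ 2 := by nlinarith
        nlinarith [pi_pos]
      linarith
    have sn0 : ∀ k ≤ n, 0 ≤ s k := by
      intro k hk
      have h1 := h.nu_anti (T0 k)
      rw [es k hk, h.nu_zero] at h1
      have : exp (- s k) ≤ 1 := by nlinarith [pi_pos]
      rw [exp_le_one_iff] at this; linarith
    set G : ℝ → ℝ := fun s => (exp (w s ^ 2) - 1) * exp (-s) with hG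
    have Gint : IntegrableOn G (Ioi 0) := by
      have i1 : IntegrableOn (fun s => exp (w s ^ 2 - s) - exp (-s)) (Ioi 0) := (hg.exp_sq_int le_rfl).sub (exp_neg_int 0)
      refine i1.congr_fun ?_ measurableSet_Ioi
      intro s _
      show exp (w s ^ 2 - s) - exp (-s) = _
      rw [sub_eq_add_neg (w s ^ 2) s, exp_add]; simp only [hG]; ring
    have Gint' : ∀ k ≤ n, IntegrableOn G (Ioi (s k)) := fun k hk => Gint.mono_set (Ioi_subset_Ioi (sn0 k hk))
    have wmono : ∀ k ≤ n, ∀ y ∈ Ioi (s k), (exp (w (s k) ^ 2) - 1) * exp (-y) ≤ G y := by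
      intro k hk y hy
      have h1 : w (s k) ≤ w y := hg.prim_mono (le_of_lt hy)
      have h2 : 0 ≤ w (s k) := hg.prim_nonneg (sn0 k hk)
      simp only [hG]
      gcongr
    have mb : MeasurableSet (Metric.ball (0:ℂ) 1) := Metric.isOpen_ball.measurableSet
    have main : ∀ j k, k + j = n → ∫ x in Metric.ball (0:ℂ) 1 ∩ {x | T k ≤ |v x|}, (exp (4 * π * v x ^ 2) - 1) ≤
        π * (K * (∫ y in Ioi (s k), G y) + (K - 1) * exp (- s k)) := by
      intro j
      induction j with
      | zero =>
        intro k hk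
        rw [add_zero] at hk; subst hk
        have J : (exp (w (s k) ^ 2) - 1) * exp (- s k) ≤ ∫ y in Ioi (s k), G y := by
          rw [← integral_exp_neg_Ioi' (s k), ← integral_const_mul]
          exact setIntegral_mono_on ((exp_neg_int _).const_mul _) (Gint' k le_rfl) measurableSet_Ioi (wmono k le_rfl)
        have I : ∫ x in Metric.ball (0:ℂ) 1 ∩ {x | T k ≤ |v x|}, (exp (4 * π * v x ^ 2) - 1) ≤
            nu v (T k) * (exp (4 * π * T (k+1) ^ 2) - 1) := by
          have fin : volume (Metric.ball (0:ℂ) 1 ∩ {x | T k ≤ |v x|}) ≠ ⊤ :=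
            (Metric.isBounded_ball.measure_lt_top.trans_le' (measure_mono inter_subset_left)).ne
          have := setIntegral_mono_on (h.expint _) (integrableOn_const fin (C := exp (4 * π * T (k+1) ^ 2) - 1)) (mb.inter (h.mle (T k)))
            (fun x hx => by
              rw [TM]
              have h1 : v x ^ 2 ≤ M ^ 2 := sq_le_sq' (by linarith [(abs_le.1 (hvM x)).1]) (abs_le.1 (hvM x)).2
              show exp (4 * π * v x ^ 2) - 1 ≤ _
              gcongr)
          rw [setIntegral_const, smul_eq_mul] at this
          exact this
        refine I.trans ?_
        rw [es k le_rfl]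
        have h1 := expK k le_rfl
        have e0 := exp_pos (- s k)
        calc _ ≤ π * exp (- s k) * (K * (exp (w (s k) ^ 2) - 1) + (K - 1)) := by gcongr
          _ = π * (K * ((exp (w (s k) ^ 2) - 1) * exp (- s k)) + (K - 1) * exp (- s k)) := by ring
          _ ≤ _ := by gcongr
      | succ j ih =>
        intro k hk
        have hkn : k < n := by omega
        have ih' := ih (k+1) (by omega)
        have sk := slt k hkn
        have J : (exp (w (s k) ^ 2) - 1) * (exp (- s k) - exp (- s (k+1))) + (∫ y in Ioi (s (k+1)), G y)
            ≤ ∫ y in Ioi (s k), G y := by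
          have e : ∀ F : ℝ → ℝ, IntegrableOn F (Ioi (s k)) → ∫ y in Ioi (s k), F y =
              (∫ y in Ioc (s k) (s (k+1)), F y) + ∫ y in Ioi (s (k+1)), F y := by
            intro F hF
            rw [← Ioc_union_Ioi_eq_Ioi sk.le]
            exact setIntegral_union (Ioc_disjoint_Ioi le_rfl) measurableSet_Ioi
              (hF.mono_set Ioc_subset_Ioi_self) (hF.mono_set (Ioi_subset_Ioi sk.le))
          have e1 := e _ (exp_neg_int (s k))
          rw [integral_exp_neg_Ioi', integral_exp_neg_Ioi'] at e1
          rw [e G (Gint' k hkn.le)]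
          have e2 : exp (- s k) - exp (- s (k+1)) = ∫ y in Ioc (s k) (s (k+1)), exp (-y) := by linarith
          rw [e2, ← integral_const_mul]
          refine add_le_add ?_ le_rfl
          exact setIntegral_mono_on (((exp_neg_int (s k)).mono_set Ioc_subset_Ioi_self).const_mul _)
            ((Gint' k hkn.le).mono_set Ioc_subset_Ioi_self) measurableSet_Ioc (fun y hy => wmono k hkn.le y hy.1)
        have I : ∫ x in Metric.ball (0:ℂ) 1 ∩ {x | T k ≤ |v x| ∧ |v x| < T (k+1)}, (exp (4 * π * v x ^ 2) - 1) ≤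
            (nu v (T k) - nu v (T (k+1))) * (exp (4 * π * T (k+1) ^ 2) - 1) := by
          have fin : volume (Metric.ball (0:ℂ) 1 ∩ {x | T k ≤ |v x| ∧ |v x| < T (k+1)}) ≠ ⊤ :=
            (Metric.isBounded_ball.measure_lt_top.trans_le' (measure_mono inter_subset_left)).ne
          have := setIntegral_mono_on (h.expint _) (integrableOn_const fin (C := exp (4 * π * T (k+1) ^ 2) - 1)) (h.mband _ _)
            (fun x hx => by
              have h2 := hx.2.2
              have h1 : v x ^ 2 ≤ T (k+1) ^ 2 := by
                rw [← sq_abs (v x)]; exact pow_le_pow_left₀ (abs_nonneg _) h2.le 2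
              show exp (4 * π * v x ^ 2) - 1 ≤ _
              gcongr)
          rw [setIntegral_const, smul_eq_mul, h.nu_sub (Tmono _ _ (Nat.le_succ k))] at this
          exact this
        rw [h.int_split (h.expint _) (Tmono _ _ (Nat.le_succ k))]
        have h1 := expK k hkn.le
        have e0 : 0 ≤ exp (- s k) - exp (- s (k+1)) := by
          rw [sub_nonneg, exp_le_exp]; linarith
        rw [es k hkn.le, es (k+1) hkn, ← mul_sub] at I
        have I2 : π * (exp (- s k) - exp (- s (k+1))) * (exp (4 * π * T (k+1) ^ 2) - 1) ≤
          π * (exp (- s k) - exp (- s (k+1))) * (K * (exp (w (s k) ^ 2) - 1) + (K - 1)) := by gcongr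
        have J2 := mul_le_mul_of_nonneg_left J (by positivity : 0 ≤ π * K)
        linarith
    have := main n 0 (by simp)
    have e0 : {x : ℂ | T 0 ≤ |v x|} = univ := by ext x; simp [hT]
    rw [e0, inter_univ, s0] at this
    simpa using this

/-- Concentration level on the disc. -/
theorem disc_cc (ε : ℝ) (hε : 0 < ε) : ∃ t0 : ℝ, 0 < t0 ∧ ∃ η' : ℝ, 0 < η' ∧ ∀ v : ℂ → ℝ, DTest v →
    ∫ x, ‖fderiv ℝ v x‖ ^ 2 ≤ 1 → nu v t0 ≤ η' →
    ∫ x in Metric.ball (0:ℂ) 1, (exp (4 * π * v x ^ 2) - 1) ≤ π * (exp 1 + ε) := by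
  obtain ⟨A, hA, η, hη, H⟩ := cc1 ε hε
  have q : 0 < √(4 * π) := Real.sqrt_pos.2 (by positivity)
  refine ⟨η / (2 * √(4 * π)), by positivity, π * exp (-A), by positivity, fun v h hE hnu => ?_⟩
  obtain ⟨x0, hx0⟩ : ∃ x0, ∀ x, |v x| ≤ |v x0| := by
    have h1 : HasCompactSupport fun x => |v x| := h.cpt.comp_left (g := fun t : ℝ => |t|) abs_zero
    exact h.smooth.continuous.abs.exists_forall_ge_of_hasCompactSupport h1
  rcases (abs_nonneg (v x0)).eq_or_lt with hM | hM
  · have hv : ∀ x, v x = 0 := fun x => by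
      have := hx0 x; rw [← hM] at this; exact abs_nonpos_iff.1 this
    simp only [hv]; simp; positivity
  set M := |v x0| with hMdef
  set I := ∫ x in Metric.ball (0:ℂ) 1, (exp (4 * π * v x ^ 2) - 1) with hI
  have l1 : Tendsto (fun n : ℕ => 8 * π * M ^ 2 / ((n:ℝ) + 1)) atTop (𝓝 0) := by
    have := tendsto_one_div_add_atTop_nhds_zero_nat (𝕜 := ℝ)
    simpa [div_eq_mul_inv] using this.const_mul (8 * π * M ^ 2)
  have l2 : Tendsto (fun n : ℕ => M / ((n:ℝ) + 1)) atTop (𝓝 0) := by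
    have := tendsto_one_div_add_atTop_nhds_zero_nat (𝕜 := ℝ)
    simpa [div_eq_mul_inv] using this.const_mul M
  have ev : ∀ᶠ n : ℕ in atTop, I ≤ π * (exp (8 * π * M ^ 2 / ((n:ℝ) + 1)) * (exp 1 + ε) +
      (exp (8 * π * M ^ 2 / ((n:ℝ) + 1)) - 1)) := by
    have : ∀ᶠ n : ℕ in atTop, M / ((n:ℝ) + 1) < η / (2 * √(4 * π)) := l2.eventually_lt_const (by positivity)
    filter_upwards [this] with n hn
    obtain ⟨g, C, R, hg, h1, h2, h3⟩ := h.disc_step hE hM hx0 rfl n (A := A) (η := η) hA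
      (t0 := η / (2 * √(4 * π))) (by positivity) (by
        calc √(4 * π) * (η / (2 * √(4 * π)) + M / (n + 1)) ≤ √(4 * π) * (η / (2 * √(4 * π)) + η / (2 * √(4 * π))) := by gcongr
          _ = η := by field_simp; norm_num) hnu
    refine h3.trans ?_
    have := H g C R hg h1 h2
    gcongr
  have lim : Tendsto (fun n : ℕ => π * (exp (8 * π * M ^ 2 / ((n:ℝ) + 1)) * (exp 1 + ε) +
      (exp (8 * π * M ^ 2 / ((n:ℝ) + 1)) - 1))) atTop (𝓝 (π * (exp 0 * (exp 1 + ε) + (exp 0 - 1)))) := by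
    have := (continuous_exp.tendsto 0).comp l1
    exact ((this.mul_const _).add (this.sub_const _)).const_mul _
  have := ge_of_tendsto lim ev
  simpa using this

end DTest

/-- smooth compactly supported in `U`. -/
structure TestOn (U : Set ℂ) (u : ℂ → ℝ) : Prop where
  smooth : ContDiff ℝ ∞ u
  cpt : HasCompactSupport u
  supp : tsupport u ⊆ U

lemma TestOn.dtest {u : ℂ → ℝ} (h : TestOn (Metric.ball 0 1) u) : DTest u := ⟨h.smooth, h.cpt, h.supp⟩

/-- A conformal bijection between open sets. -/
structure Conf (U V : Set ℂ) (f φ : ℂ → ℂ) : Prop where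
  oU : IsOpen U
  oV : IsOpen V
  fm : MapsTo f V U
  pm : MapsTo φ U V
  fp : ∀ z ∈ U, f (φ z) = z
  pf : ∀ w ∈ V, φ (f w) = w
  fd : DifferentiableOn ℂ f V
  pd : DifferentiableOn ℂ φ U

/-- multiplication by `c` as a real linear map -/
noncomputable def mulL (c : ℂ) : ℂ →L[ℝ] ℂ := (ContinuousLinearMap.toSpanSingleton ℂ c).restrictScalars ℝ

lemma mulL_apply (c z : ℂ) : mulL c z = z * c := by simp [mulL]

lemma mulL_det (c : ℂ) : (mulL c).det = ‖c‖ ^ 2 := by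
  simp [mulL, ContinuousLinearMap.det, LinearMap.det_restrictScalars, Algebra.norm_complex_eq, Complex.normSq_eq_norm_sq]

lemma mulL_norm_le (c : ℂ) : ‖mulL c‖ ≤ ‖c‖ :=
  ContinuousLinearMap.opNorm_le_bound _ (norm_nonneg _) fun z => by rw [mulL_apply, norm_mul, mul_comm]

lemma norm_comp_mulL (A : ℂ →L[ℝ] ℝ) (c : ℂ) : ‖A.comp (mulL c)‖ = ‖A‖ * ‖c‖ := by
  apply le_antisymm
  · exact (ContinuousLinearMap.opNorm_comp_le _ _).trans (by gcongr; exact mulL_norm_le c)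
  · rcases eq_or_ne c 0 with rfl | hc
    · simp
    have e : A = (A.comp (mulL c)).comp (mulL c⁻¹) := by
      ext z; simp [mulL_apply, hc]
    have h1 : ‖A‖ ≤ ‖A.comp (mulL c)‖ * ‖c‖⁻¹ := by
      conv_lhs => rw [e]
      refine (ContinuousLinearMap.opNorm_comp_le _ _).trans ?_
      gcongr; rw [← norm_inv]; exact mulL_norm_le _
    have : 0 < ‖c‖ := norm_pos_iff.2 hc
    rwa [← div_eq_mul_inv, le_div_iff₀ this] at h1

namespace Conf
variable {U V : Set ℂ} {f φ : ℂ → ℂ}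

lemma symm (h : Conf U V f φ) : Conf V U φ f := ⟨h.oV, h.oU, h.pm, h.fm, h.pf, h.fp, h.pd, h.fd⟩

lemma hasFDerivAt (h : Conf U V f φ) {w : ℂ} (hw : w ∈ V) : HasFDerivAt f (mulL (deriv f w)) w :=
  ((h.fd.differentiableAt (h.oV.mem_nhds hw)).hasDerivAt.hasFDerivAt).restrictScalars ℝ

lemma image (h : Conf U V f φ) : f '' V = U := by
  apply Subset.antisymm
  · rintro _ ⟨w, hw, rfl⟩; exact h.fm hw
  · intro z hz; exact ⟨φ z, h.pm hz, h.fp z hz⟩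

lemma integral (h : Conf U V f φ) (F : ℂ → ℝ) : ∫ z in U, F z = ∫ w in V, ‖deriv f w‖ ^ 2 * F (f w) := by
  rw [← h.image, integral_image_eq_integral_abs_det_fderiv_smul volume h.oV.measurableSet
    (f' := fun w => mulL (deriv f w)) (fun w hw => (h.hasFDerivAt hw).hasFDerivWithinAt)]
  · simp only [mulL_det, smul_eq_mul, abs_pow, abs_norm]
  · intro a ha b hb hab
    rw [← h.pf a ha, ← h.pf b hb, hab]

/-- pull back extended by zero -/
noncomputable def pull (V : Set ℂ) (f : ℂ → ℂ) (u : ℂ → ℝ) : ℂ → ℝ := V.indicator (fun w => u (f w))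

lemma pull_supp (h : Conf U V f φ) {u : ℂ → ℝ} (hu : TestOn U u) : tsupport (pull V f u) ⊆ φ '' tsupport u := by
  have hc : IsCompact (φ '' tsupport u) := hu.cpt.isCompact.image_of_continuousOn (h.pd.continuousOn.mono hu.supp)
  apply closure_minimal _ hc.isClosed
  intro w hw
  have hwV : w ∈ V := by
    by_contra hn; exact hw (indicator_of_notMem hn _)
  refine ⟨f w, subset_tsupport _ ?_, h.pf w hwV⟩
  intro h0; apply hw; rw [pull, indicator_of_mem hwV]; exact h0

lemma pull_test (h : Conf U V f φ) {u : ℂ → ℝ} (hu : TestOn U u) : TestOn V (pull V f u) := by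
  have hc : IsCompact (φ '' tsupport u) := hu.cpt.isCompact.image_of_continuousOn (h.pd.continuousOn.mono hu.supp)
  refine ⟨?_, hc.of_isClosed_subset (isClosed_tsupport _) (h.pull_supp hu), (h.pull_supp hu).trans ?_⟩
  · rw [contDiff_iff_contDiffAt]
    intro w
    by_cases hw : w ∈ V
    · have h1 : ContDiffAt ℝ ∞ f w := ((h.fd.contDiffOn (n := ∞) h.oV).contDiffAt (h.oV.mem_nhds hw)).restrict_scalars ℝ
      have h2 : ContDiffAt ℝ ∞ (fun w => u (f w)) w := hu.smooth.contDiffAt.comp w h1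
      apply h2.congr_of_eventuallyEq
      filter_upwards [h.oV.mem_nhds hw] with x hx
      rw [pull, indicator_of_mem hx]
    · have hw' : w ∉ tsupport (pull V f u) := by
        intro hh
        obtain ⟨z, hz, rfl⟩ := h.pull_supp hu hh
        exact hw (h.pm (hu.supp hz))
      apply (contDiffAt_const (c := (0:ℝ))).congr_of_eventuallyEq
      exact notMem_tsupport_iff_eventuallyEq.1 hw'
  · rintro _ ⟨z, hz, rfl⟩; exact h.pm (hu.supp hz)

lemma pull_energy (h : Conf U V f φ) {u : ℂ → ℝ} (hu : TestOn U u) :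
    ∫ w, ‖fderiv ℝ (pull V f u) w‖ ^ 2 = ∫ z, ‖fderiv ℝ u z‖ ^ 2 := by
  have zero : ∀ {W : Set ℂ} {g : ℂ → ℝ}, TestOn W g → ∫ z in W, ‖fderiv ℝ g z‖ ^ 2 = ∫ z, ‖fderiv ℝ g z‖ ^ 2 := by
    intro W g hg
    apply setIntegral_eq_integral_of_forall_compl_eq_zero
    intro x hx
    have : fderiv ℝ g x = 0 := image_eq_zero_of_notMem_tsupport fun hh => hx (hg.supp (tsupport_fderiv_subset ℝ hh))
    simp [this]
  rw [← zero hu, ← zero (h.pull_test hu), h.integral]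
  apply setIntegral_congr_fun h.oV.measurableSet
  intro w hw
  have e : pull V f u =ᶠ[𝓝 w] fun w => u (f w) := by
    filter_upwards [h.oV.mem_nhds hw] with x hx
    rw [pull, indicator_of_mem hx]
  have hd : HasFDerivAt (fun w => u (f w)) ((fderiv ℝ u (f w)).comp (mulL (deriv f w))) w :=
    ((hu.smooth.differentiable (by simp)) (f w)).hasFDerivAt.comp w (h.hasFDerivAt hw)
  simp only
  rw [e.fderiv_eq, hd.fderiv, norm_comp_mulL]; ring

lemma pull_apply {u : ℂ → ℝ} {w : ℂ} (hw : w ∈ V) : pull V f u w = u (f w) := indicator_of_mem hw _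

end Conf

/-- strip of half-width `H` -/
def SH (H : ℝ) : Set ℂ := {z | |z.im| < H}

noncomputable def fmap (l : ℝ) (a : ℂ) (w : ℂ) : ℂ := Complex.log ((a + (starRingEnd ℂ) a * w) / (1 - w)) / l
noncomputable def phimap (l : ℝ) (a : ℂ) (z : ℂ) : ℂ := (Complex.exp (l * z) - a) / (Complex.exp (l * z) + (starRingEnd ℂ) a)

lemma one_sub_ne {w : ℂ} (hw : w ∈ Metric.ball (0:ℂ) 1) : 1 - w ≠ 0 := by
  intro h
  have : w = 1 := (sub_eq_zero.1 h).symm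
  rw [this] at hw; simp at hw

lemma mob_re {a w : ℂ} (ha : 0 < a.re) (hw : w ∈ Metric.ball (0:ℂ) 1) :
    0 < ((a + (starRingEnd ℂ) a * w) / (1 - w)).re := by
  have h1 := one_sub_ne hw
  have h2 : 0 < Complex.normSq (1 - w) := Complex.normSq_pos.2 h1
  have h3 : w.re ^ 2 + w.im ^ 2 < 1 := by
    rw [mem_ball_zero_iff] at hw
    have := Complex.sq_norm w
    rw [Complex.normSq_apply] at this
    nlinarith [norm_nonneg w]
  rw [Complex.div_re, ← add_div]
  apply div_pos _ h2
  simp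
  nlinarith

lemma exp_re_pos {l H : ℝ} (hH : 0 < H) (hl : l = π / (2 * H)) {z : ℂ} (hz : z ∈ SH H) : 0 < (Complex.exp (l * z)).re := by
  rw [Complex.exp_re]
  have hz' : |z.im| < H := hz
  have l0 : 0 < l := by rw [hl]; positivity
  have e : l * H = π / 2 := by rw [hl]; field_simp
  apply mul_pos (exp_pos _)
  apply cos_pos_of_mem_Ioo
  simp
  rw [abs_lt] at hz'
  constructor <;> nlinarith [hz'.1, hz'.2]

lemma conf_strip {l H : ℝ} (hH : 0 < H) (hl : l = π / (2 * H)) {a : ℂ} (ha : 0 < a.re) :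
    Conf (SH H) (Metric.ball 0 1) (fmap l a) (phimap l a) := by
  have l0 : 0 < l := by rw [hl]; positivity
  have lc : (l : ℂ) ≠ 0 := by exact_mod_cast l0.ne'
  have den : ∀ z ∈ SH H, Complex.exp (l * z) + (starRingEnd ℂ) a ≠ 0 := by
    intro z hz h0
    have h1 := exp_re_pos hH hl hz
    have := congrArg Complex.re h0
    simp only [Complex.add_re, Complex.conj_re, Complex.zero_re] at this; linarith
  have a0 : a + (starRingEnd ℂ) a ≠ 0 := by
    intro h0
    have := congrArg Complex.re h0
    simp at this; linarith
  constructor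
  · exact isOpen_lt (by fun_prop) continuous_const
  · exact Metric.isOpen_ball
  · intro w hw
    have h1 := mob_re ha hw
    have h2 := (Complex.abs_arg_lt_pi_div_two_iff).2 (Or.inl h1)
    show |(fmap l a w).im| < H
    rw [fmap, Complex.div_ofReal_im, Complex.log_im, abs_div, abs_of_pos l0, div_lt_iff₀ l0]
    have e : H * l = π / 2 := by rw [hl]; field_simp
    rw [e]; exact h2
  · intro z hz
    have h1 := exp_re_pos hH hl hz
    have h2 := den z hz
    rw [mem_ball_zero_iff, phimap, norm_div, div_lt_one (norm_pos_iff.2 h2),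
      ← abs_of_nonneg (norm_nonneg (_ - a)), ← abs_of_nonneg (norm_nonneg (_ + _)), ← sq_lt_sq, Complex.sq_norm, Complex.sq_norm]
    simp only [Complex.normSq_apply, Complex.sub_re, Complex.sub_im, Complex.add_re, Complex.add_im, Complex.conj_re, Complex.conj_im]
    nlinarith [mul_pos h1 ha]
  · intro z hz
    have h2 := den z hz
    have hz' : |z.im| < H := hz
    have e : (a + (starRingEnd ℂ) a * phimap l a z) / (1 - phimap l a z) = Complex.exp (l * z) := by
      rw [phimap]
      set X := Complex.exp (l * z)
      set b := (starRingEnd ℂ) a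
      have : 1 - (X - a) / (X + b) = (a + b) / (X + b) := by field_simp; ring
      rw [this]; field_simp; ring
    have e2 : l * H = π / 2 := by rw [hl]; field_simp
    rw [fmap, e, Complex.log_exp]
    · field_simp
    · simp; rw [abs_lt] at hz'; nlinarith [hz'.1, pi_pos]
    · simp; rw [abs_lt] at hz'; nlinarith [hz'.2, pi_pos]
  · intro w hw
    have h1 := one_sub_ne hw
    have h2 := mob_re ha hw
    have hne : (a + (starRingEnd ℂ) a * w) / (1 - w) ≠ 0 := by
      intro h0; rw [h0] at h2; simp at h2
    have e : Complex.exp (l * fmap l a w) = (a + (starRingEnd ℂ) a * w) / (1 - w) := by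
      rw [fmap, mul_div_cancel₀ _ lc, Complex.exp_log hne]
    rw [phimap, e]
    set b := (starRingEnd ℂ) a
    have : (a + b * w) / (1 - w) + b = (a + b) / (1 - w) := by field_simp; ring
    rw [this]; field_simp; ring
  · intro w hw
    apply DifferentiableAt.differentiableWithinAt
    have h1 := one_sub_ne hw
    have h2 := mob_re ha hw
    apply DifferentiableAt.div_const
    apply DifferentiableAt.clog
    · exact DifferentiableAt.div (by fun_prop) (by fun_prop) h1
    · exact Or.inl h2
  · intro z hz
    apply DifferentiableAt.differentiableWithinAt
    exact DifferentiableAt.div (by fun_prop) (by fun_prop) (den z hz)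

lemma fmap_deriv {l : ℝ} {a : ℂ} (ha : 0 < a.re) {w : ℂ} (hw : w ∈ Metric.ball (0:ℂ) 1) :
    HasDerivAt (fmap l a) (((starRingEnd ℂ) a / (a + (starRingEnd ℂ) a * w) + 1 / (1 - w)) / l) w := by
  have h1 := one_sub_ne hw
  have h2 := mob_re ha hw
  have hn : a + (starRingEnd ℂ) a * w ≠ 0 := by
    intro h0; rw [h0] at h2; simp at h2
  set b := (starRingEnd ℂ) a
  have d1 : HasDerivAt (fun w => a + b * w) b w := by
    simpa using ((hasDerivAt_id w).const_mul b).const_add a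
  have d2 : HasDerivAt (fun w : ℂ => 1 - w) (-1) w := by
    simpa using (hasDerivAt_id w).const_sub 1
  have d0 : HasDerivAt (fun w => (a + b * w) / (1 - w)) ((b * (1 - w) - (a + b * w) * (-1)) / (1 - w) ^ 2) w := d1.div d2 h1
  have d3 := (d0.clog (Or.inl h2)).div_const (l:ℂ)
  refine d3.congr_deriv ?_
  field_simp
  ring

lemma clm_norm_sq (L : ℂ →L[ℝ] ℝ) : ‖L‖ ^ 2 = (L 1) ^ 2 + (L Complex.I) ^ 2 := by
  have e : ∀ z : ℂ, L z = z.re * L 1 + z.im * L Complex.I := by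
    intro z
    conv_lhs => rw [← Complex.re_add_im z]
    have e1 : (z.re : ℂ) + z.im * Complex.I = z.re • (1:ℂ) + z.im • Complex.I := by simp
    rw [e1, map_add, map_smul, map_smul, smul_eq_mul, smul_eq_mul]
  apply le_antisymm
  · have : ‖L‖ ≤ √((L 1) ^ 2 + (L Complex.I) ^ 2) := by
      apply ContinuousLinearMap.opNorm_le_bound _ (sqrt_nonneg _)
      intro z
      have hz : ‖z‖ = √(z.re ^ 2 + z.im ^ 2) := by
        rw [← sqrt_sq (norm_nonneg z), Complex.sq_norm, Complex.normSq_apply]; ring_nf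
      rw [hz, ← sqrt_mul (by positivity), norm_eq_abs, ← sqrt_sq_eq_abs]
      apply sqrt_le_sqrt
      rw [e z]
      nlinarith [sq_nonneg (z.re * L Complex.I - z.im * L 1)]
    calc ‖L‖ ^ 2 ≤ (√((L 1) ^ 2 + (L Complex.I) ^ 2)) ^ 2 := by gcongr
      _ = _ := sq_sqrt (by positivity)
  · set q := (L 1) ^ 2 + (L Complex.I) ^ 2 with hq
    have q0 : 0 ≤ q := by positivity
    set z : ℂ := ⟨L 1, L Complex.I⟩
    have h1 := L.le_opNorm z
    rw [e z] at h1
    have h2 : ‖z‖ ^ 2 = q := by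
      rw [Complex.sq_norm, Complex.normSq_apply]; simp [z, hq]; ring
    have h3 : z.re * L 1 + z.im * L Complex.I = q := by simp [z, hq]; ring
    rw [h3, norm_eq_abs, abs_of_nonneg q0] at h1
    rcases q0.eq_or_lt with h0 | h0
    · rw [← h0]; positivity
    have h4 : q ^ 2 ≤ ‖L‖ ^ 2 * q := by
      rw [← h2, ← mul_pow, h2]; gcongr
    nlinarith

noncomputable def En (u : ℂ → ℝ) : ℝ := ∫ z, ‖fderiv ℝ u z‖ ^ 2
noncomputable def Fn (u : ℂ → ℝ) : ℝ := ∫ z, (exp (4 * π * u z ^ 2) - 1)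

lemma En_nonneg (u : ℂ → ℝ) : 0 ≤ En u := integral_nonneg fun _ => by positivity
lemma ae_nn (x : ℝ) : 0 ≤ exp (4 * π * x ^ 2) - 1 := by
  have : 1 ≤ exp (4 * π * x ^ 2) := one_le_exp (by positivity)
  linarith
lemma Fn_nonneg (u : ℂ → ℝ) : 0 ≤ Fn u := integral_nonneg fun _ => ae_nn _

namespace TestOn
variable {U : Set ℂ} {u v : ℂ → ℝ}

lemma cont (h : TestOn U u) : Continuous u := h.smooth.continuous
lemma diff (h : TestOn U u) : Differentiable ℝ u := h.smooth.differentiable (by simp)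
lemma contd (h : TestOn U u) : Continuous (fderiv ℝ u) := h.smooth.continuous_fderiv (by simp)
lemma z0 (_h : TestOn U u) {z : ℂ} (hz : z ∉ tsupport u) : u z = 0 := image_eq_zero_of_notMem_tsupport hz
lemma d0 (_h : TestOn U u) {z : ℂ} (hz : z ∉ tsupport u) : fderiv ℝ u z = 0 :=
  image_eq_zero_of_notMem_tsupport fun hh => hz (tsupport_fderiv_subset ℝ hh)
lemma zU (h : TestOn U u) {z : ℂ} (hz : z ∉ U) : u z = 0 := h.z0 fun hh => hz (h.supp hh)
lemma dU (h : TestOn U u) {z : ℂ} (hz : z ∉ U) : fderiv ℝ u z = 0 := h.d0 fun hh => hz (h.supp hh)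

lemma integ (h : TestOn U u) {g : ℂ → ℝ} (hg : Continuous g) (h0 : ∀ z, z ∉ tsupport u → g z = 0) :
    Integrable g := by
  apply hg.integrable_of_hasCompactSupport
  apply h.cpt.isCompact.of_isClosed_subset (isClosed_tsupport _)
  apply closure_minimal _ (isClosed_tsupport _)
  intro z hz
  by_contra hn
  exact hz (h0 z hn)

lemma iE (h : TestOn U u) : Integrable fun z => ‖fderiv ℝ u z‖ ^ 2 :=
  h.integ (by have := h.contd; fun_prop) fun z hz => by simp [h.d0 hz]
lemma i2 (h : TestOn U u) : Integrable fun z => u z ^ 2 :=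
  h.integ (by have := h.cont; fun_prop) fun z hz => by simp [h.z0 hz]
lemma iF (h : TestOn U u) (c : ℝ) : Integrable fun z => exp (c * u z ^ 2) - 1 :=
  h.integ (by have := h.cont; fun_prop) fun z hz => by simp [h.z0 hz]

lemma mono {V : Set ℂ} (h : TestOn U u) (hUV : U ⊆ V) : TestOn V u := ⟨h.smooth, h.cpt, h.supp.trans hUV⟩

lemma of_zero (h : TestOn U u) (hv : ContDiff ℝ ∞ v) (h0 : ∀ z, u z = 0 → v z = 0) : TestOn U v := by
  have hs : tsupport v ⊆ tsupport u := closure_mono fun z hz => by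
    intro hh; exact hz (h0 z hh)
  exact ⟨hv, h.cpt.isCompact.of_isClosed_subset (isClosed_tsupport _) hs, hs.trans h.supp⟩

lemma mul (h : TestOn U u) {ψ : ℂ → ℝ} (hψ : ContDiff ℝ ∞ ψ) : TestOn U (fun z => ψ z * u z) :=
  h.of_zero (hψ.mul h.smooth) fun z hz => by simp [hz]

lemma smul (h : TestOn U u) (c : ℝ) : TestOn U (fun z => c * u z) := h.mul contDiff_const

lemma add (h : TestOn U u) (k : TestOn U v) : TestOn U (fun z => u z + v z) := by
  have hs : tsupport (fun z => u z + v z) ⊆ tsupport u ∪ tsupport v := tsupport_add u v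
  refine ⟨h.smooth.add k.smooth, ?_, hs.trans (union_subset h.supp k.supp)⟩
  exact (h.cpt.isCompact.union k.cpt.isCompact).of_isClosed_subset (isClosed_tsupport _) hs

lemma sub (h : TestOn U u) (k : TestOn U v) : TestOn U (fun z => u z - v z) := by
  have := h.add (k.smul (-1))
  refine (funext fun z => ?_ : (fun z => u z + -1 * v z) = fun z => u z - v z) ▸ this
  ring

lemma zero : TestOn U (fun _ => 0) := by
  refine ⟨contDiff_const, ?_, ?_⟩
  · exact HasCompactSupport.zero
  · have : tsupport (fun _ : ℂ => (0:ℝ)) = ∅ := by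
      rw [tsupport_eq_empty_iff]; rfl
    rw [this]; exact empty_subset _

lemma sum {ι : Type*} (s : Finset ι) {f : ι → ℂ → ℝ} (h : ∀ i ∈ s, TestOn U (f i)) :
    TestOn U (fun z => ∑ i ∈ s, f i z) := by
  classical
  induction s using Finset.induction_on with
  | empty => simpa using zero
  | insert a s ha ih =>
    simp only [Finset.sum_insert ha]
    exact (h a (Finset.mem_insert_self _ _)).add (ih fun i hi => h i (Finset.mem_insert_of_mem hi))

lemma En_smul (h : TestOn U u) (c : ℝ) : En (fun z => c * u z) = c ^ 2 * En u := by
  rw [En, En, ← integral_const_mul]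
  congr 1; ext z
  rw [fderiv_const_mul (h.diff z), norm_smul, mul_pow, norm_eq_abs, sq_abs]

end TestOn

/-- Moser–Trudinger bound hypothesis -/
def MTB (S : ℝ) : Prop := ∀ u, TestOn (SH 1) u → En u ≤ 1 → Fn u ≤ S

lemma MTB.nonneg {S : ℝ} (h : MTB S) : 0 ≤ S := by
  have := h _ TestOn.zero (by simp [En])
  exact (Fn_nonneg _).trans this

lemma exp_conv {s a : ℝ} (h0 : 0 ≤ s) (h1 : s ≤ 1) : exp (s * a) - 1 ≤ s * (exp a - 1) := by
  have := convexOn_exp.2 (mem_univ a) (mem_univ 0) h0 (by linarith : 0 ≤ 1 - s) (by ring)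
  simp at this
  linarith

lemma MTB.scale {S s : ℝ} (h : MTB S) {u : ℂ → ℝ} (hu : TestOn (SH 1) u) (hs : En u ≤ s) (s0 : 0 < s) (s1 : s ≤ 1) :
    Fn u ≤ s * S := by
  have hv := hu.smul (√s)⁻¹
  have hE : En (fun z => (√s)⁻¹ * u z) ≤ 1 := by
    rw [hu.En_smul, inv_pow, sq_sqrt s0.le, inv_mul_le_iff₀ s0]; linarith
  have h1 := h _ hv hE
  refine le_trans ?_ (mul_le_mul_of_nonneg_left h1 s0.le)
  rw [Fn, Fn, ← integral_const_mul]
  apply integral_mono (hu.iF _) ((hv.iF _).const_mul s)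
  intro z
  have := exp_conv s0.le s1 (a := 4 * π * ((√s)⁻¹ * u z) ^ 2)
  have e : s * (4 * π * ((√s)⁻¹ * u z) ^ 2) = 4 * π * u z ^ 2 := by
    rw [mul_pow, inv_pow, sq_sqrt s0.le]; field_simp
  rw [e] at this
  exact this

lemma window_zero {G : ℂ → ℝ} (hG : ContDiff ℝ 1 G) (hc : HasCompactSupport G) {A : Set ℝ} (hA : MeasurableSet A) :
    ∫ z in Complex.re ⁻¹' A, fderiv ℝ G z Complex.I = 0 := by
  have hcd : Continuous fun z => fderiv ℝ G z Complex.I := by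
    have := hG.continuous_fderiv (by simp); fun_prop
  have hsd : HasCompactSupport fun z => fderiv ℝ G z Complex.I := by
    have h1 := hc.fderiv (𝕜 := ℝ)
    have h2 := h1.comp_left (g := fun L : ℂ →L[ℝ] ℝ => L Complex.I) (by simp)
    exact h2
  have mp := Complex.volume_preserving_equiv_real_prod
  have e1 : ∫ z in Complex.re ⁻¹' A, fderiv ℝ G z Complex.I =
      ∫ p in A ×ˢ (univ : Set ℝ), (fun p : ℝ × ℝ => fderiv ℝ G (Complex.measurableEquivRealProd.symm p) Complex.I) p := by
    rw [← mp.setIntegral_preimage_emb Complex.measurableEquivRealProd.measurableEmbedding]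
    have : Complex.re ⁻¹' A = Complex.measurableEquivRealProd ⁻¹' A ×ˢ (univ : Set ℝ) := by
      ext z; simp [Complex.measurableEquivRealProd_apply]
    rw [this]
    simp
  have hi : Integrable (fun p : ℝ × ℝ => fderiv ℝ G (Complex.measurableEquivRealProd.symm p) Complex.I) := by
    have := (mp.symm).integrable_comp_emb Complex.measurableEquivRealProd.symm.measurableEmbedding
      (g := fun z => fderiv ℝ G z Complex.I)
    exact this.2 (hcd.integrable_of_hasCompactSupport hsd)
  rw [e1, Measure.volume_eq_prod, setIntegral_prod _ (by rw [← Measure.volume_eq_prod]; exact hi.integrableOn)]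
  have : ∀ x : ℝ, ∫ y in (univ : Set ℝ), fderiv ℝ G (Complex.measurableEquivRealProd.symm (x, y)) Complex.I = 0 := by
    intro x
    rw [setIntegral_univ]
    simp only [Complex.measurableEquivRealProd_symm_apply]
    have emb : Topology.IsClosedEmbedding (fun y : ℝ => (⟨x, y⟩ : ℂ)) := by
      apply Isometry.isClosedEmbedding
      apply Isometry.of_dist_eq
      intro a b
      exact Complex.dist_of_re_eq rfl
    have hd : ∀ y, HasDerivAt (fun y : ℝ => G ⟨x, y⟩) (fderiv ℝ G ⟨x, y⟩ Complex.I) y := by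
      intro y
      have h1 : HasDerivAt (fun y : ℝ => (⟨x, y⟩ : ℂ)) Complex.I y := by
        have : (fun y : ℝ => (⟨x, y⟩ : ℂ)) = fun y : ℝ => (x : ℂ) + y * Complex.I := by
          funext y; apply Complex.ext <;> simp
        rw [this]
        have := ((Complex.ofRealCLM.hasDerivAt (x := y)).mul_const Complex.I).const_add (x:ℂ)
        simpa using this
      exact (hG.differentiable (by simp) _).hasFDerivAt.comp_hasDerivAt y h1
    apply integral_eq_zero_of_hasDerivAt_of_integrable hd
    · exact (hcd.comp emb.continuous).integrable_of_hasCompactSupport (hsd.comp_isClosedEmbedding emb)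
    · exact (hG.continuous.comp emb.continuous).integrable_of_hasCompactSupport (hc.comp_isClosedEmbedding emb)
  simp only [this, integral_zero]

lemma poincare {u : ℂ → ℝ} (h : TestOn (SH 1) u) {A : Set ℝ} (hA : MeasurableSet A) :
    ∫ z in Complex.re ⁻¹' A, u z ^ 2 ≤ ∫ z in Complex.re ⁻¹' A, ‖fderiv ℝ u z‖ ^ 2 := by
  set G : ℂ → ℝ := fun z => (-tan z.im) * u z ^ 2 with hGdef
  have cosne : ∀ z ∈ SH 1, cos z.im ≠ 0 := by
    intro z hz
    have hz' : |z.im| < 1 := hz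
    rw [abs_lt] at hz'
    apply (cos_pos_of_mem_Ioo ⟨by linarith [pi_gt_three], by linarith [pi_gt_three]⟩).ne'
  have hev : ∀ z, z ∉ SH 1 → G =ᶠ[𝓝 z] fun _ => 0 := by
    intro z hz
    have : z ∉ tsupport u := fun hh => hz (h.supp hh)
    filter_upwards [notMem_tsupport_iff_eventuallyEq.1 this] with w hw
    simp [hGdef, hw]
  have hG : ContDiff ℝ 1 G := by
    rw [contDiff_iff_contDiffAt]
    intro z
    by_cases hz : z ∈ SH 1
    · have h1 : ContDiffAt ℝ 1 (fun z : ℂ => tan z.im) z :=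
        ContDiffAt.comp (g := Real.tan) (f := fun z : ℂ => z.im) z (Real.contDiffAt_tan.2 (cosne z hz)) Complex.imCLM.contDiff.contDiffAt
      exact h1.neg.mul ((h.smooth.of_le (by exact_mod_cast le_top)).contDiffAt.pow 2)
    · exact contDiffAt_const.congr_of_eventuallyEq (hev z hz)
  have hc : HasCompactSupport G := by
    apply h.cpt.isCompact.of_isClosed_subset (isClosed_tsupport _)
    exact closure_mono fun z hz hh => hz (by simp [hGdef, hh])
  have key : ∀ z, u z ^ 2 ≤ ‖fderiv ℝ u z‖ ^ 2 - fderiv ℝ G z Complex.I := by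
    intro z
    by_cases hz : z ∈ SH 1
    · have c0 := cosne z hz
      have d1 : HasFDerivAt (fun z : ℂ => z.im) Complex.imCLM z := Complex.imCLM.hasFDerivAt
      have d2 : HasFDerivAt (fun z : ℂ => -tan z.im) (-((1 / cos z.im ^ 2) • Complex.imCLM)) z :=
        ((hasDerivAt_tan c0).comp_hasFDerivAt z d1).neg
      have d3 := (h.diff z).hasFDerivAt.pow 2
      have d4 : HasFDerivAt G _ z := d2.mul d3
      rw [d4.fderiv, clm_norm_sq]
      set a := fderiv ℝ u z 1
      set b := fderiv ℝ u z Complex.I with hb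
      simp only [ContinuousLinearMap.add_apply, ContinuousLinearMap.smul_apply, ContinuousLinearMap.neg_apply, Complex.imCLM_apply, Complex.I_im, smul_eq_mul, ← hb]
      have e : 1 / cos z.im ^ 2 = 1 + tan z.im ^ 2 := by
        rw [tan_eq_sin_div_cos]; field_simp; linarith [sin_sq_add_cos_sq z.im]
      rw [e]
      simp
      nlinarith [sq_nonneg (b + tan z.im * u z), sq_nonneg a]
    · rw [(hev z hz).fderiv_eq, h.zU hz]; simp
  have hiG : Integrable fun z => fderiv ℝ G z Complex.I := by
    apply h.integ
    · have := hG.continuous_fderiv (by simp); fun_prop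
    · intro z hz
      have : G =ᶠ[𝓝 z] fun _ => 0 := by
        filter_upwards [notMem_tsupport_iff_eventuallyEq.1 hz] with w hw
        simp [hGdef, hw]
      rw [this.fderiv_eq]; simp
  calc ∫ z in Complex.re ⁻¹' A, u z ^ 2 ≤ ∫ z in Complex.re ⁻¹' A, (‖fderiv ℝ u z‖ ^ 2 - fderiv ℝ G z Complex.I) :=
        integral_mono h.i2.restrict (h.iE.sub hiG).restrict key
    _ = _ := by
      rw [integral_sub h.iE.integrableOn hiG.integrableOn, window_zero hG hc hA, sub_zero]

lemma poincare' {u : ℂ → ℝ} (h : TestOn (SH 1) u) : ∫ z, u z ^ 2 ≤ En u := by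
  have := poincare h MeasurableSet.univ
  simpa [En] using this

lemma exp_conv2 {s a : ℝ} (h0 : 0 ≤ s) (h1 : s ≤ 1) (ha : 0 ≤ a) :
    exp (s * a) - 1 ≤ s * (exp a - 1) - s * (1 - s) / 2 * a ^ 2 := by
  -- monotonicity in `a`
  have key : MonotoneOn (fun a => s * (exp a - 1) - s * (1 - s) / 2 * a ^ 2 - (exp (s * a) - 1)) (Ici 0) := by
    have hd : ∀ x : ℝ, HasDerivAt (fun a => s * (exp a - 1) - s * (1 - s) / 2 * a ^ 2 - (exp (s * a) - 1))
        (s * exp x - s * (1 - s) * x - s * exp (s * x)) x := by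
      intro x
      have d1 := ((hasDerivAt_exp x).sub_const 1).const_mul s
      have d2 := ((hasDerivAt_pow 2 x).const_mul (s * (1 - s) / 2))
      have d3 := (((hasDerivAt_id x).const_mul s).exp).sub_const 1
      refine ((d1.sub d2).sub d3).congr_deriv ?_
      simp; ring
    apply monotoneOn_of_deriv_nonneg (convex_Ici 0)
    · exact fun x _ => (hd x).continuousAt.continuousWithinAt
    · exact fun x _ => (hd x).differentiableAt.differentiableWithinAt
    · intro x hx
      rw [interior_Ici] at hx
      rw [(hd x).deriv]
      have hx0 : 0 < x := hx
      have e1 : exp x = exp (s * x) * exp ((1 - s) * x) := by rw [← exp_add]; ring_nf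
      have e2 : (1 - s) * x + 1 ≤ exp ((1 - s) * x) := add_one_le_exp _
      have e3 : 1 ≤ exp (s * x) := one_le_exp (by positivity)
      have e4 : 0 ≤ (1 - s) * x := mul_nonneg (by linarith) hx0.le
      have : 0 ≤ exp x - (1 - s) * x - exp (s * x) := by
        rw [e1]; nlinarith
      have := mul_nonneg h0 this
      linarith
  have := key (mem_Ici.2 le_rfl) (mem_Ici.2 ha) ha
  simp at this
  linarith

lemma exp_sub_le {x : ℝ} (hx : 0 ≤ x) : exp x - 1 - x ≤ x ^ 2 * exp x := by
  have h1 : -x + 1 ≤ exp (-x) := add_one_le_exp _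
  have h2 : exp x * exp (-x) = 1 := by rw [← exp_add]; simp
  have h3 : exp x - 1 ≤ x * exp x := by nlinarith [exp_pos x]
  nlinarith [exp_pos x]

lemma exp_tail {δ ε : ℝ} (hδ : 0 < δ) (hε : 0 < ε) :
    ∃ C : ℝ, 0 < C ∧ ∀ s a : ℝ, 0 ≤ s → s ≤ 1 - δ → 0 ≤ a → exp (s * a) - 1 - s * a ≤ ε * (exp a - 1) + C * a ^ 2 := by
  set ε' := min ε 1 with hε'
  have e0 : 0 < ε' := lt_min hε one_pos
  set T := log (1 / ε') / δ with hT
  refine ⟨exp T + 1, by positivity, fun s a s0 s1 a0 => ?_⟩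
  have ea : 1 ≤ exp a := one_le_exp a0
  have sa0 : 0 ≤ s * a := by positivity
  rcases le_total a T with h | h
  · have h1 := exp_sub_le sa0
    have h2 : s * a ≤ a := by nlinarith
    have h3 : (s * a) ^ 2 * exp (s * a) ≤ a ^ 2 * exp T := by
      gcongr; exact h2.trans h
    have h4 : 0 ≤ ε * (exp a - 1) := mul_nonneg hε.le (by linarith)
    nlinarith [sq_nonneg a]
  · have h1 : log (1 / ε') ≤ δ * a := by
      rw [hT, div_le_iff₀ hδ] at h; linarith
    have h2 : 1 / ε' ≤ exp (δ * a) := by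
      rw [← exp_log (by positivity : 0 < 1 / ε')]; exact exp_le_exp.2 h1
    have h3 : exp (s * a) * exp (δ * a) ≤ exp a := by
      rw [← exp_add]; apply exp_le_exp.2; nlinarith
    have h4 : exp (s * a) ≤ ε' * exp a := by
      have : exp (s * a) * (1 / ε') ≤ exp a := le_trans (by gcongr) h3
      rw [mul_one_div, div_le_iff₀ e0] at this; linarith
    have h5 : ε' ≤ 1 := min_le_right _ _
    have h6 : ε' * (exp a - 1) ≤ ε * (exp a - 1) := by
      apply mul_le_mul_of_nonneg_right (min_le_left _ _) (by linarith)
    have h7 : 0 ≤ (exp T + 1) * a ^ 2 := by positivity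
    nlinarith

lemma MTB.gain {S : ℝ} (h : MTB S) (hS : 4 * π < S) {δ : ℝ} (hδ : 0 < δ) :
    ∃ c : ℝ, 0 < c ∧ ∀ u s, TestOn (SH 1) u → En u ≤ s → δ ≤ s → s ≤ 1 - δ → Fn u ≤ s * S - c := by
  have S0 : 0 < S := lt_trans (by positivity) hS
  set d := δ * (S - 4 * π) with hd
  have d0 : 0 < d := mul_pos hδ (by linarith)
  obtain ⟨C, C0, hC⟩ := exp_tail hδ (show 0 < d / (4 * S) by positivity)
  set κ := d / (4 * C) with hκ
  have κ0 : 0 < κ := by positivity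
  refine ⟨min (d / 2) (δ * δ / 2 * κ), by positivity, fun u s hu hE hs hs1 => ?_⟩
  have s0 : 0 < s := hδ.trans_le hs
  have hv := hu.smul (√s)⁻¹
  set v : ℂ → ℝ := fun z => (√s)⁻¹ * u z with hvdef
  have hEv : En v ≤ 1 := by
    rw [hu.En_smul, inv_pow, sq_sqrt s0.le, inv_mul_le_iff₀ s0]; linarith
  have h1 := h _ hv hEv
  have e : ∀ z, 4 * π * u z ^ 2 = s * (4 * π * v z ^ 2) := by
    intro z
    simp only [hvdef]
    rw [mul_pow, inv_pow, sq_sqrt s0.le]; field_simp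
  have ia2 : Integrable fun z => (4 * π * v z ^ 2) ^ 2 :=
    hv.integ (by have := hv.cont; fun_prop) fun z hz => by simp [hv.z0 hz]
  have ia1 : Integrable fun z => 4 * π * u z ^ 2 :=
    hu.integ (by have := hu.cont; fun_prop) fun z hz => by simp [hu.z0 hz]
  rcases le_total κ (∫ z, (4 * π * v z ^ 2) ^ 2) with hk | hk
  · have h2 : Fn u ≤ s * Fn v - s * (1 - s) / 2 * ∫ z, (4 * π * v z ^ 2) ^ 2 := by
      rw [Fn, Fn, ← integral_const_mul, ← integral_const_mul, ← integral_sub ((hv.iF _).const_mul s) (ia2.const_mul _)]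
      apply integral_mono (hu.iF _) (((hv.iF _).const_mul s).sub (ia2.const_mul _))
      intro z
      simp only [e z]
      exact exp_conv2 s0.le (by linarith) (by positivity)
    have h3 : δ * δ / 2 * κ ≤ s * (1 - s) / 2 * ∫ z, (4 * π * v z ^ 2) ^ 2 := by
      have : δ * δ ≤ s * (1 - s) := mul_le_mul hs (by linarith) hδ.le s0.le
      have h9 : 0 ≤ s * (1 - s) / 2 := by nlinarith
      exact mul_le_mul (by linarith) hk κ0.le h9
    have h4 : s * Fn v ≤ s * S := by gcongr
    have := min_le_right (d / 2) (δ * δ / 2 * κ)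
    linarith
  · have h2 : Fn u ≤ (∫ z, 4 * π * u z ^ 2) + (d / (4 * S) * Fn v + C * ∫ z, (4 * π * v z ^ 2) ^ 2) := by
      have i3 : Integrable fun z => d / (4 * S) * (exp (4 * π * v z ^ 2) - 1) + C * (4 * π * v z ^ 2) ^ 2 :=
        ((hv.iF _).const_mul _).add (ia2.const_mul _)
      rw [Fn, Fn, ← integral_const_mul, ← integral_const_mul, ← integral_add ((hv.iF _).const_mul _) (ia2.const_mul _),
        ← integral_add ia1 i3]
      apply integral_mono (hu.iF _) (ia1.add i3)
      intro z
      have := hC s (4 * π * v z ^ 2) s0.le hs1 (by positivity)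
      show exp (4 * π * u z ^ 2) - 1 ≤ 4 * π * u z ^ 2 + (d / (4 * S) * (exp (4 * π * v z ^ 2) - 1) + C * (4 * π * v z ^ 2) ^ 2)
      rw [e z]
      linarith
    have h3 : ∫ z, 4 * π * u z ^ 2 ≤ 4 * π * s := by
      rw [integral_const_mul]
      have := (poincare' hu).trans hE
      gcongr
    have h4 : d / (4 * S) * Fn v ≤ d / 4 := by
      calc d / (4 * S) * Fn v ≤ d / (4 * S) * S := by gcongr
        _ = d / 4 := by field_simp
    have h5 : C * ∫ z, (4 * π * v z ^ 2) ^ 2 ≤ d / 4 := by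
      calc _ ≤ C * κ := by gcongr
        _ = d / 4 := by rw [hκ]; field_simp
    have h6 : d ≤ s * (S - 4 * π) := by
      rw [hd]; apply mul_le_mul_of_nonneg_right hs (by linarith)
    have := min_le_left (d / 2) (δ * δ / 2 * κ)
    linarith

lemma fderiv_mul_sq {ψ u : ℂ → ℝ} {z : ℂ} (hψ : DifferentiableAt ℝ ψ z) (hu : DifferentiableAt ℝ u z) {κ : ℝ} (hκ : 0 < κ) :
    ‖fderiv ℝ (fun z => ψ z * u z) z‖ ^ 2 ≤
      (1 + κ) * (ψ z ^ 2 * ‖fderiv ℝ u z‖ ^ 2) + (1 + 1 / κ) * (u z ^ 2 * ‖fderiv ℝ ψ z‖ ^ 2) := by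
  rw [fderiv_fun_mul hψ hu]
  have h1 := norm_add_le (ψ z • fderiv ℝ u z) (u z • fderiv ℝ ψ z)
  rw [norm_smul, norm_smul, norm_eq_abs, norm_eq_abs] at h1
  set a := |ψ z| * ‖fderiv ℝ u z‖
  set b := |u z| * ‖fderiv ℝ ψ z‖
  have ha : ψ z ^ 2 * ‖fderiv ℝ u z‖ ^ 2 = a ^ 2 := by rw [mul_pow, sq_abs]
  have hb : u z ^ 2 * ‖fderiv ℝ ψ z‖ ^ 2 = b ^ 2 := by rw [mul_pow, sq_abs]
  rw [ha, hb]
  have h2 : (a + b) ^ 2 ≤ (1 + κ) * a ^ 2 + (1 + 1 / κ) * b ^ 2 := by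
    have : 0 ≤ (κ * a - b) ^ 2 / κ := by positivity
    have e : (κ * a - b) ^ 2 / κ = κ * a ^ 2 - 2 * a * b + 1 / κ * b ^ 2 := by field_simp; ring
    nlinarith
  calc _ ≤ (a + b) ^ 2 := by gcongr
    _ ≤ _ := h2

/-- smooth step in the real direction -/
noncomputable def cutR (c : ℝ) (z : ℂ) : ℝ := smoothTransition (z.re - c)

lemma cutR_smooth (c : ℝ) : ContDiff ℝ ∞ (cutR c) :=
  smoothTransition.contDiff.comp ((Complex.reCLM.contDiff).sub contDiff_const)

lemma cutR_diff (c : ℝ) (z : ℂ) : DifferentiableAt ℝ (cutR c) z := (cutR_smooth c).differentiable (by simp) z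

lemma cutR_zero {c : ℝ} {z : ℂ} (h : z.re ≤ c) : cutR c z = 0 := smoothTransition.zero_of_nonpos (by linarith)
lemma cutR_one {c : ℝ} {z : ℂ} (h : c + 1 ≤ z.re) : cutR c z = 1 := smoothTransition.one_of_one_le (by linarith)
lemma cutR_nn (c : ℝ) (z : ℂ) : 0 ≤ cutR c z := smoothTransition.nonneg _
lemma cutR_le (c : ℝ) (z : ℂ) : cutR c z ≤ 1 := smoothTransition.le_one _

lemma sT_deriv_bound : ∃ C : ℝ, 0 < C ∧ ∀ x, |deriv smoothTransition x| ≤ C := by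
  have hc : Continuous (deriv smoothTransition) := (smoothTransition.contDiff (n := 1)).continuous_deriv le_rfl
  obtain ⟨C, hC⟩ := (isCompact_Icc (a := (0:ℝ)) (b := 1)).exists_bound_of_continuousOn hc.continuousOn
  refine ⟨max C 1, by positivity, fun x => ?_⟩
  by_cases hx : x ∈ Icc (0:ℝ) 1
  · exact (hC x hx).trans (le_max_left _ _)
  · have : deriv smoothTransition x = 0 := by
      rcases not_and_or.1 hx with h | h
      · have : smoothTransition =ᶠ[𝓝 x] fun _ => 0 := by
          filter_upwards [Iio_mem_nhds (not_le.1 h)] with y hy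
          exact smoothTransition.zero_of_nonpos (le_of_lt hy)
        rw [this.deriv_eq]; simp
      · have : smoothTransition =ᶠ[𝓝 x] fun _ => 1 := by
          filter_upwards [Ioi_mem_nhds (not_le.1 h)] with y hy
          exact smoothTransition.one_of_one_le (le_of_lt hy)
        rw [this.deriv_eq]; simp
    rw [this]; simp

noncomputable def C0 : ℝ := sT_deriv_bound.choose
lemma C0_pos : 0 < C0 := sT_deriv_bound.choose_spec.1

lemma cutR_fderiv (c : ℝ) (z : ℂ) : ‖fderiv ℝ (cutR c) z‖ ≤ C0 := by
  have h1 : HasFDerivAt (fun z : ℂ => z.re - c) Complex.reCLM z := Complex.reCLM.hasFDerivAt.sub_const c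
  have hd : HasDerivAt smoothTransition (deriv smoothTransition (z.re - c)) (z.re - c) :=
    ((smoothTransition.contDiff (n := 1)).differentiable (by simp) _).hasDerivAt
  have h2 : HasFDerivAt (cutR c) (deriv smoothTransition (z.re - c) • Complex.reCLM) z := hd.comp_hasFDerivAt z h1
  rw [h2.fderiv, norm_smul, Complex.reCLM_norm, mul_one]
  exact sT_deriv_bound.choose_spec.2 _

lemma cutR_fderiv0 {c : ℝ} {z : ℂ} (h : z.re ∉ Ioo c (c + 1)) : fderiv ℝ (cutR c) z = 0 := by
  rw [mem_Ioo, not_and_or, not_lt, not_lt] at h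
  rcases h with h | h
  · apply IsLocalMin.fderiv_eq_zero
    filter_upwards with w
    rw [cutR_zero h]; exact cutR_nn _ _
  · apply IsLocalMax.fderiv_eq_zero
    filter_upwards with w
    rw [cutR_one h]; exact cutR_le _ _

/-- energy over a vertical window -/
noncomputable def EA (u : ℂ → ℝ) (A : Set ℝ) : ℝ := ∫ z in Complex.re ⁻¹' A, ‖fderiv ℝ u z‖ ^ 2

lemma re_meas {A : Set ℝ} (hA : MeasurableSet A) : MeasurableSet (Complex.re ⁻¹' A) := Complex.measurable_re hA

lemma EA_mono {U : Set ℂ} {u : ℂ → ℝ} (h : TestOn U u) {A B : Set ℝ} (hAB : A ⊆ B) : EA u A ≤ EA u B :=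
  setIntegral_mono_set h.iE.integrableOn (ae_of_all _ fun _ => by positivity) (preimage_mono hAB).eventuallyLE

lemma EA_le {U : Set ℂ} {u : ℂ → ℝ} (h : TestOn U u) (A : Set ℝ) : EA u A ≤ En u :=
  setIntegral_le_integral h.iE (ae_of_all _ fun _ => by positivity)

lemma EA_nonneg (u : ℂ → ℝ) (A : Set ℝ) : 0 ≤ EA u A := integral_nonneg fun _ => by positivity

noncomputable def C1 : ℝ := 4 + 8 * C0 ^ 2
lemma C1_pos : 0 < C1 := by unfold C1; positivity

/-- a cutoff that is supported, with bounded gradient, over a window. -/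
lemma En_cut {u ψ : ℂ → ℝ} (h : TestOn (SH 1) u) (hψ : ContDiff ℝ ∞ ψ) {A : Set ℝ} (hA : MeasurableSet A)
    (hb : ∀ z, |ψ z| ≤ 1) (h0 : ∀ z, z.re ∉ A → ψ z = 0) (hd0 : ∀ z, z.re ∉ A → fderiv ℝ ψ z = 0)
    (hd : ∀ z, ‖fderiv ℝ ψ z‖ ≤ 2 * C0) : En (fun z => ψ z * u z) ≤ C1 * EA u A := by
  have hv := h.mul hψ
  have e1 : En (fun z => ψ z * u z) = ∫ z in Complex.re ⁻¹' A, ‖fderiv ℝ (fun z => ψ z * u z) z‖ ^ 2 := by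
    rw [En, ← setIntegral_eq_integral_of_forall_compl_eq_zero]
    intro z hz
    rw [fderiv_fun_mul (hψ.differentiable (by simp) z) (h.diff z), h0 z hz, hd0 z hz]; simp
  rw [e1]
  calc _ ≤ ∫ z in Complex.re ⁻¹' A, (2 * ‖fderiv ℝ u z‖ ^ 2 + 8 * C0 ^ 2 * u z ^ 2) := by
        apply integral_mono hv.iE.restrict ((h.iE.const_mul 2).add (h.i2.const_mul (8 * C0 ^ 2))).restrict
        intro z
        have h1 := fderiv_mul_sq (hψ.differentiable (by simp) z) (h.diff z) one_pos
        have h2 : ψ z ^ 2 ≤ 1 := by rw [← sq_abs]; have := hb z; have := abs_nonneg (ψ z); nlinarith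
        have h3 : ‖fderiv ℝ ψ z‖ ^ 2 ≤ (2 * C0) ^ 2 := by gcongr; exact hd z
        have h4 : ψ z ^ 2 * ‖fderiv ℝ u z‖ ^ 2 ≤ 1 * ‖fderiv ℝ u z‖ ^ 2 := by gcongr
        have h5 : u z ^ 2 * ‖fderiv ℝ ψ z‖ ^ 2 ≤ u z ^ 2 * (2 * C0) ^ 2 := by gcongr
        show _ ≤ 2 * ‖fderiv ℝ u z‖ ^ 2 + 8 * C0 ^ 2 * u z ^ 2
        dsimp only
        linarith
    _ = 2 * EA u A + 8 * C0 ^ 2 * ∫ z in Complex.re ⁻¹' A, u z ^ 2 := by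
        rw [integral_add (h.iE.const_mul 2).restrict (h.i2.const_mul _).restrict, integral_const_mul, integral_const_mul]; rfl
    _ ≤ 2 * EA u A + 8 * C0 ^ 2 * EA u A := by gcongr; exact poincare h hA
    _ ≤ C1 * EA u A := by
        have := EA_nonneg u A
        unfold C1; nlinarith

lemma split {u : ℂ → ℝ} (h : TestOn (SH 1) u) (c : ℝ) :
    ∃ L R M : ℂ → ℝ, TestOn (SH 1) L ∧ TestOn (SH 1) R ∧ TestOn (SH 1) M ∧
      Fn u ≤ Fn L + Fn R + Fn M ∧ En M ≤ C1 * EA u (Ico (c - 1) (c + 2)) ∧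
      En L + En R ≤ En u + C1 * EA u (Ico (c - 1) (c + 2)) ∧ EA u (Iic c) ≤ En L ∧ EA u (Ici (c + 1)) ≤ En R := by
  set A := Ico (c - 1) (c + 2) with hA
  have sψ : ContDiff ℝ ∞ (fun z => 1 - cutR c z) := contDiff_const.sub (cutR_smooth c)
  have sη : ContDiff ℝ ∞ (fun z => cutR (c - 1) z * (1 - cutR (c + 1) z)) :=
    (cutR_smooth _).mul (contDiff_const.sub (cutR_smooth _))
  have tL := h.mul sψ
  have tR := h.mul (cutR_smooth c)
  have tM := h.mul sη
  have dL : ∀ z, fderiv ℝ (fun z => 1 - cutR c z) z = - fderiv ℝ (cutR c) z := by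
    intro z; rw [fderiv_const_sub]
  have dη : ∀ z, fderiv ℝ (fun z => cutR (c - 1) z * (1 - cutR (c + 1) z)) z =
      cutR (c - 1) z • (- fderiv ℝ (cutR (c + 1)) z) + (1 - cutR (c + 1) z) • fderiv ℝ (cutR (c - 1)) z := by
    intro z
    rw [fderiv_fun_mul (cutR_diff _ z) ((cutR_diff _ z).const_sub 1), fderiv_const_sub]
  refine ⟨_, _, _, tL, tR, tM, ?_, ?_, ?_, ?_, ?_⟩
  · have i1 : Integrable fun z => (exp (4 * π * ((1 - cutR c z) * u z) ^ 2) - 1) + (exp (4 * π * (cutR c z * u z) ^ 2) - 1) :=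
      (tL.iF _).add (tR.iF _)
    rw [Fn, Fn, Fn, Fn, ← integral_add (tL.iF _) (tR.iF _), ← integral_add i1 (tM.iF _)]
    apply integral_mono (h.iF _) (i1.add (tM.iF _))
    intro z
    show _ ≤ (exp (4 * π * ((1 - cutR c z) * u z) ^ 2) - 1) + (exp (4 * π * (cutR c z * u z) ^ 2) - 1) +
      (exp (4 * π * (cutR (c - 1) z * (1 - cutR (c + 1) z) * u z) ^ 2) - 1)
    have n1 := ae_nn ((1 - cutR c z) * u z)
    have n2 := ae_nn (cutR c z * u z)
    have n3 := ae_nn (cutR (c - 1) z * (1 - cutR (c + 1) z) * u z)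
    dsimp only
    rcases le_total z.re c with h1 | h1
    · rw [cutR_zero h1] at n2 ⊢
      simp only [sub_zero, one_mul] at n2 ⊢; linarith
    rcases le_total (c + 1) z.re with h2 | h2
    · rw [cutR_one h2] at n1 ⊢
      simp only [one_mul] at n1 ⊢; linarith
    · rw [cutR_one (by linarith : c - 1 + 1 ≤ z.re), cutR_zero h2]
      simp only [sub_zero, one_mul]; linarith
  · apply En_cut h sη measurableSet_Ico
    · intro z
      have := cutR_nn (c - 1) z; have := cutR_nn (c + 1) z; have := cutR_le (c - 1) z; have := cutR_le (c + 1) z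
      rw [abs_of_nonneg (mul_nonneg (by assumption) (by linarith))]; nlinarith
    · intro z hz
      rw [mem_Ico, not_and_or, not_le, not_lt] at hz
      rcases hz with hz | hz
      · rw [cutR_zero hz.le]; simp
      · rw [cutR_one (by linarith : c + 1 + 1 ≤ z.re)]; simp
    · intro z hz
      rw [dη z, cutR_fderiv0, cutR_fderiv0]
      · simp
      · intro hh; exact hz ⟨hh.1.le, by linarith [hh.2]⟩
      · intro hh; exact hz ⟨by linarith [hh.1], by linarith [hh.2]⟩
    · intro z
      rw [dη z]
      refine (norm_add_le _ _).trans ?_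
      rw [norm_smul, norm_smul, norm_neg, norm_eq_abs, norm_eq_abs]
      have a1 := cutR_nn (c - 1) z; have a2 := cutR_nn (c + 1) z; have a3 := cutR_le (c - 1) z; have a4 := cutR_le (c + 1) z
      rw [abs_of_nonneg a1, abs_of_nonneg (by linarith)]
      have b1 := cutR_fderiv (c - 1) z; have b2 := cutR_fderiv (c + 1) z
      have := norm_nonneg (fderiv ℝ (cutR (c - 1)) z); have := norm_nonneg (fderiv ℝ (cutR (c + 1)) z)
      nlinarith
  · have ind : ∀ {f : ℂ → ℝ}, Integrable f → Integrable ((Complex.re ⁻¹' A).indicator f) := fun hf =>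
      hf.indicator (re_meas measurableSet_Ico)
    have i3 : Integrable fun z => 4 * ‖fderiv ℝ u z‖ ^ 2 + 4 * C0 ^ 2 * u z ^ 2 := (h.iE.const_mul 4).add (h.i2.const_mul _)
    have pt : ∀ z, ‖fderiv ℝ (fun z => (1 - cutR c z) * u z) z‖ ^ 2 + ‖fderiv ℝ (fun z => cutR c z * u z) z‖ ^ 2 ≤
        ‖fderiv ℝ u z‖ ^ 2 + (Complex.re ⁻¹' A).indicator (fun z => 4 * ‖fderiv ℝ u z‖ ^ 2 + 4 * C0 ^ 2 * u z ^ 2) z := by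
      intro z
      by_cases hz : z.re ∈ Ioo c (c + 1)
      · have hzA : z ∈ Complex.re ⁻¹' A := ⟨by linarith [hz.1], by linarith [hz.2]⟩
        rw [indicator_of_mem hzA]
        have h1 := fderiv_mul_sq ((cutR_diff c z).const_sub 1) (h.diff z) one_pos
        have h2 := fderiv_mul_sq (cutR_diff c z) (h.diff z) one_pos
        rw [dL, norm_neg] at h1
        have a1 := cutR_nn c z; have a2 := cutR_le c z
        have p1 : (1 - cutR c z) ^ 2 * ‖fderiv ℝ u z‖ ^ 2 ≤ 1 * ‖fderiv ℝ u z‖ ^ 2 := by gcongr; nlinarith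
        have p2 : (cutR c z) ^ 2 * ‖fderiv ℝ u z‖ ^ 2 ≤ 1 * ‖fderiv ℝ u z‖ ^ 2 := by gcongr; nlinarith
        have p3 : u z ^ 2 * ‖fderiv ℝ (cutR c) z‖ ^ 2 ≤ u z ^ 2 * C0 ^ 2 := by gcongr; exact cutR_fderiv c z
        nlinarith [sq_nonneg ‖fderiv ℝ u z‖]
      · have hn : 0 ≤ (Complex.re ⁻¹' A).indicator (fun z => 4 * ‖fderiv ℝ u z‖ ^ 2 + 4 * C0 ^ 2 * u z ^ 2) z :=
          indicator_nonneg (fun _ _ => by positivity) z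
        have z0 := cutR_fderiv0 hz
        rw [fderiv_fun_mul ((cutR_diff c z).const_sub 1) (h.diff z), fderiv_fun_mul (cutR_diff c z) (h.diff z), dL, z0]
        rw [mem_Ioo, not_and_or, not_lt, not_lt] at hz
        rcases hz with hz | hz
        · rw [cutR_zero hz]; simp; exact hn
        · rw [cutR_one hz]; simp; exact hn
    calc _ = ∫ z, (‖fderiv ℝ (fun z => (1 - cutR c z) * u z) z‖ ^ 2 + ‖fderiv ℝ (fun z => cutR c z * u z) z‖ ^ 2) :=
          (integral_add tL.iE tR.iE).symm
      _ ≤ ∫ z, (‖fderiv ℝ u z‖ ^ 2 + (Complex.re ⁻¹' A).indicator (fun z => 4 * ‖fderiv ℝ u z‖ ^ 2 + 4 * C0 ^ 2 * u z ^ 2) z) :=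
          integral_mono (tL.iE.add tR.iE) (h.iE.add (ind i3)) pt
      _ = En u + (4 * EA u A + 4 * C0 ^ 2 * ∫ z in Complex.re ⁻¹' A, u z ^ 2) := by
          rw [integral_add h.iE (ind i3), integral_indicator (re_meas measurableSet_Ico),
            integral_add (h.iE.const_mul 4).restrict (h.i2.const_mul _).restrict, integral_const_mul, integral_const_mul]; rfl
      _ ≤ En u + (4 * EA u A + 4 * C0 ^ 2 * EA u A) := by gcongr; exact poincare h measurableSet_Ico
      _ ≤ _ := by
          have := EA_nonneg u A
          unfold C1; nlinarith [mul_nonneg (sq_nonneg C0) this]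
  · refine le_trans (le_of_eq ?_) (EA_le tL (Iic c))
    apply setIntegral_congr_fun (re_meas measurableSet_Iic)
    intro z hz
    have hz' : z.re ≤ c := hz
    simp only
    rw [fderiv_fun_mul ((cutR_diff c z).const_sub 1) (h.diff z), dL, cutR_fderiv0 (fun hh => absurd hh.1 (not_lt.2 hz')), cutR_zero hz']
    simp
  · refine le_trans (le_of_eq ?_) (EA_le tR (Ici (c + 1)))
    apply setIntegral_congr_fun (re_meas measurableSet_Ici)
    intro z hz
    have hz' : c + 1 ≤ z.re := hz
    simp only
    rw [fderiv_fun_mul (cutR_diff c z) (h.diff z), cutR_fderiv0 (fun hh => absurd hh.2 (not_lt.2 hz')), cutR_one hz']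
    simp

lemma MTB.split_gain {S : ℝ} (h : MTB S) (hS : 4 * π < S) {δ : ℝ} (hδ : 0 < δ) (hδ' : δ ≤ 1 / 4) :
    ∃ k : ℝ, 0 < k ∧ ∀ u, TestOn (SH 1) u → En u ≤ 1 → ∀ c e : ℝ, 0 < e → C1 * e ≤ δ →
      EA u (Ico (c - 1) (c + 2)) ≤ e → δ ≤ EA u (Iic c) → δ ≤ EA u (Ici (c + 1)) →
      Fn u ≤ (1 + 2 * C1 * e) * S - k := by
  obtain ⟨k, k0, hk⟩ := h.gain hS hδ
  refine ⟨k, k0, fun u hu hE c e e0 he hw hl hr => ?_⟩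
  obtain ⟨L, R, M, tL, tR, tM, hF, hM, hLR, hL, hR⟩ := split hu c
  have c1 := C1_pos
  have S0 := h.nonneg
  have hw' : C1 * EA u (Ico (c - 1) (c + 2)) ≤ C1 * e := by gcongr
  have b1 : Fn M ≤ C1 * e * S := h.scale tM (hM.trans hw') (by positivity) (by linarith)
  have b2 : Fn L ≤ En L * S := h.scale tL le_rfl (by linarith) (by linarith)
  have b3 : Fn R ≤ En R * S := h.scale tR le_rfl (by linarith) (by linarith)
  have b4 : (En L + En R) * S ≤ (1 + C1 * e) * S := mul_le_mul_of_nonneg_right (by linarith) S0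
  rcases le_total (En L) (3 / 4) with h1 | h1
  · have := hk L (En L) tL le_rfl (by linarith) (by linarith)
    linarith
  · have := hk R (En R) tR le_rfl (by linarith) (by linarith)
    linarith

lemma pigeon {u : ℂ → ℝ} (h : TestOn (SH 1) u) (hE : En u ≤ 1) (a : ℝ) {m : ℕ} (hm : 0 < m) :
    ∃ i : ℕ, i < m ∧ EA u (Ico (a + 3 * i) (a + 3 * i + 3)) ≤ 1 / m := by
  by_contra hcon
  push Not at hcon
  have h1 : ∑ i ∈ Finset.range m, EA u (Ico (a + 3 * i) (a + 3 * i + 3)) ≤ En u := by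
    have e : ∑ i ∈ Finset.range m, EA u (Ico (a + 3 * i) (a + 3 * i + 3)) =
        ∫ z in ⋃ i ∈ Finset.range m, Complex.re ⁻¹' (Ico (a + 3 * i) (a + 3 * i + 3)), ‖fderiv ℝ u z‖ ^ 2 := by
      rw [integral_biUnion_finset]
      · rfl
      · exact fun i _ => re_meas measurableSet_Ico
      · intro i _ j _ hij
        apply Disjoint.preimage
        rw [Set.disjoint_left]
        intro x hx hy
        rcases lt_or_gt_of_ne hij with hh | hh
        · have : (i : ℝ) + 1 ≤ j := by exact_mod_cast hh
          linarith [hx.2, hy.1]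
        · have : (j : ℝ) + 1 ≤ i := by exact_mod_cast hh
          linarith [hy.2, hx.1]
      · exact fun i _ => h.iE.integrableOn
    rw [e]
    exact setIntegral_le_integral h.iE (ae_of_all _ fun _ => by positivity)
  have h2 : ∑ i ∈ Finset.range m, (1 / m : ℝ) < ∑ i ∈ Finset.range m, EA u (Ico (a + 3 * i) (a + 3 * i + 3)) := by
    apply Finset.sum_lt_sum_of_nonempty (by simpa using hm.ne')
    intro i hi
    exact hcon i (Finset.mem_range.1 hi)
  have : (m : ℝ) ≠ 0 := by exact_mod_cast hm.ne'
  rw [Finset.sum_const, Finset.card_range, nsmul_eq_mul, mul_one_div_cancel this] at h2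
  linarith

lemma MTB.dich {S : ℝ} (h : MTB S) (hS : 4 * π < S) {δ : ℝ} (hδ : 0 < δ) (hδ' : δ ≤ 1 / 4) :
    ∃ M τ : ℝ, 0 < M ∧ 0 < τ ∧ ∀ u, TestOn (SH 1) u → En u ≤ 1 → S - τ ≤ Fn u → ∀ a : ℝ,
      δ ≤ EA u (Iic a) → EA u (Ici (a + M)) < δ := by
  obtain ⟨k, k0, hk⟩ := h.split_gain hS hδ hδ'
  have c1 := C1_pos
  have S0 : 0 < S := lt_trans (by positivity) hS
  obtain ⟨m, hm⟩ := exists_nat_gt (max (C1 / δ) (4 * C1 * S / k))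
  have m0 : (0:ℝ) < m := lt_of_le_of_lt (le_max_of_le_left (by positivity)) hm
  have m0' : 0 < m := by exact_mod_cast m0
  refine ⟨3 * m, k / 4, by positivity, by positivity, fun u hu hE hF a ha => ?_⟩
  by_contra hcon
  push Not at hcon
  obtain ⟨i, hi, hw⟩ := pigeon hu hE a m0'
  have hi' : (i : ℝ) + 1 ≤ m := by exact_mod_cast hi
  have i0 : (0:ℝ) ≤ i := by positivity
  have := hk u hu hE (a + 3 * i + 1) (1 / m) (by positivity) ?_ ?_ ?_ ?_
  · have h1 : 4 * C1 * S / k < m := lt_of_le_of_lt (le_max_right _ _) hm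
    rw [div_lt_iff₀ k0] at h1
    have h2 : (2 * C1 * (1 / m)) * S < k / 2 := by
      have : (2 * C1 * (1 / m)) * S = (2 * C1 * S) / m := by ring
      rw [this, div_lt_iff₀ m0]; linarith
    linarith
  · have h1 : C1 / δ < m := lt_of_le_of_lt (le_max_left _ _) hm
    rw [div_lt_iff₀ hδ] at h1
    rw [mul_one_div, div_le_iff₀ m0]; linarith
  · convert hw using 3 <;> ring
  · exact ha.trans (EA_mono hu (Iic_subset_Iic.2 (by linarith)))
  · exact hcon.trans (EA_mono hu (Ici_subset_Ici.2 (by linarith)))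

lemma center {u : ℂ → ℝ} (hu : TestOn (SH 1) u) (hE : 3 / 4 ≤ En u) :
    ∃ k : ℝ, 1 / 4 ≤ EA u (Iic (k + 1)) ∧ 1 / 4 ≤ EA u (Ici k) := by
  obtain ⟨B, hB⟩ := hu.cpt.isCompact.isBounded.exists_norm_le
  have B1 : ∀ k : ℝ, k < -B → EA u (Iic k) = 0 := by
    intro k hk
    apply setIntegral_eq_zero_of_forall_eq_zero
    intro z hz
    have hz' : z.re ≤ k := hz
    rw [hu.d0]; · simp
    intro hh
    have h1 := hB z hh
    have h2 := Complex.abs_re_le_norm z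
    rw [abs_le] at h2
    linarith [h2.1]
  have B2 : ∀ k : ℝ, B < k → EA u (Iic k) = En u := by
    intro k hk
    apply setIntegral_eq_integral_of_forall_compl_eq_zero
    intro z hz
    have hz' : ¬ z.re ≤ k := hz
    rw [hu.d0]; · simp
    intro hh
    have h1 := hB z hh
    have h2 := Complex.abs_re_le_norm z
    rw [abs_le] at h2
    linarith [h2.2]
  have ex := Int.exists_greatest_of_bdd (P := fun k : ℤ => EA u (Iic (k:ℝ)) ≤ 1 / 2) ?_ ?_
  · obtain ⟨k, hk, hk'⟩ := ex
    refine ⟨k, ?_, ?_⟩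
    · by_contra hcon
      push Not at hcon
      have := hk' (k + 1) (by push_cast; linarith)
      linarith
    · have : En u ≤ EA u (Iic (k:ℝ)) + EA u (Ici (k:ℝ)) := by
        have e : En u = EA u (Iic (k:ℝ)) + EA u (Ioi (k:ℝ)) := by
          rw [En, ← integral_add_compl (re_meas (measurableSet_Iic (a := (k:ℝ)))) hu.iE, ← preimage_compl, compl_Iic]
          rfl
        rw [e]
        have := EA_mono hu (Ioi_subset_Ici_self (a := (k:ℝ)))
        linarith
      linarith
  · obtain ⟨n, hn⟩ := exists_nat_gt B
    refine ⟨n, fun z hz => ?_⟩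
    by_contra hcon
    push Not at hcon
    have : (n : ℝ) < z := by exact_mod_cast hcon
    rw [B2 z (by linarith)] at hz
    linarith
  · obtain ⟨n, hn⟩ := exists_nat_gt B
    refine ⟨-n, ?_⟩
    rw [B1 _ (by push_cast; linarith)]
    norm_num

/-- real translate -/
def trsl (k : ℝ) (u : ℂ → ℝ) (z : ℂ) : ℝ := u (z + k)

lemma trsl_test {u : ℂ → ℝ} (hu : TestOn (SH 1) u) (k : ℝ) : TestOn (SH 1) (trsl k u) := by
  have hs : tsupport (trsl k u) = (Homeomorph.addRight (k:ℂ)) ⁻¹' tsupport u :=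
    tsupport_comp_eq_preimage u (Homeomorph.addRight (k:ℂ))
  refine ⟨hu.smooth.comp (contDiff_id.add contDiff_const), ?_, ?_⟩
  · exact hu.cpt.comp_homeomorph (Homeomorph.addRight (k:ℂ))
  · rw [hs]
    intro z hz
    have := hu.supp hz
    simpa [SH] using this

lemma trsl_fderiv (u : ℂ → ℝ) (k : ℝ) (z : ℂ) : fderiv ℝ (trsl k u) z = fderiv ℝ u (z + k) :=
  fderiv_comp_add_right (k : ℂ)

lemma trsl_En (u : ℂ → ℝ) (k : ℝ) : En (trsl k u) = En u := by
  simp only [En, trsl_fderiv]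
  exact integral_add_right_eq_self (fun z => ‖fderiv ℝ u z‖ ^ 2) (k:ℂ)

lemma trsl_Fn (u : ℂ → ℝ) (k : ℝ) : Fn (trsl k u) = Fn u :=
  integral_add_right_eq_self (fun z => exp (4 * π * u z ^ 2) - 1) (k:ℂ)

lemma trsl_EA (u : ℂ → ℝ) (k : ℝ) (A : Set ℝ) : EA (trsl k u) ((fun x => x + k) ⁻¹' A) = EA u A := by
  simp only [EA, trsl_fderiv]
  rw [← (measurePreserving_add_right volume (k:ℂ)).setIntegral_preimage_emb (measurableEmbedding_addRight (k:ℂ))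
    (fun z => ‖fderiv ℝ u z‖ ^ 2)]
  congr 2

/-- a normalised near-maximiser -/
structure Centered (u : ℂ → ℝ) : Prop where
  l : 1 / 4 ≤ EA u (Iic 1)
  r : 1 / 4 ≤ EA u (Ici 0)

lemma exists_centered {u : ℂ → ℝ} (hu : TestOn (SH 1) u) (hE : 3 / 4 ≤ En u) : ∃ k : ℝ, Centered (trsl k u) := by
  obtain ⟨k, h1, h2⟩ := center hu hE
  refine ⟨k, ?_, ?_⟩
  · rw [← trsl_EA u k] at h1
    convert h1 using 2
    ext x; simp [add_comm]
  · rw [← trsl_EA u k] at h2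
    convert h2 using 2
    ext x; simp

lemma MTB.tight {S : ℝ} (h : MTB S) (hS : 4 * π < S) {δ : ℝ} (hδ : 0 < δ) :
    ∃ K τ : ℝ, 0 < K ∧ 0 < τ ∧ ∀ u, TestOn (SH 1) u → En u ≤ 1 → S - τ ≤ Fn u → Centered u →
      EA u {x | K ≤ |x|} ≤ δ := by
  set d := min (δ / 2) (1 / 4) with hd
  have d0 : 0 < d := by positivity
  obtain ⟨M, τ, M0, τ0, hM⟩ := h.dich hS d0 (min_le_right _ _)
  refine ⟨M + 1, τ, by positivity, τ0, fun u hu hE hF hc => ?_⟩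
  have r := hM u hu hE hF 1 ((min_le_right _ _).trans hc.l)
  have l : EA u (Iic (-M)) < d := by
    by_contra hcon
    push Not at hcon
    have := hM u hu hE hF (-M) hcon
    rw [neg_add_cancel] at this
    linarith [hc.r, min_le_right (δ / 2) (1 / 4 : ℝ)]
  have hsub : EA u {x | M + 1 ≤ |x|} ≤ EA u (Iic (-M) ∪ Ici (1 + M)) := by
    apply EA_mono hu
    intro x hx
    have hx' : M + 1 ≤ |x| := hx
    rcases le_abs.1 hx' with h1 | h1
    · right; exact (by linarith : 1 + M ≤ x)
    · left; exact (by linarith : x ≤ -M)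
  have hun : EA u (Iic (-M) ∪ Ici (1 + M)) = EA u (Iic (-M)) + EA u (Ici (1 + M)) := by
    rw [EA, preimage_union, setIntegral_union]
    · rfl
    · apply Disjoint.preimage
      rw [Set.disjoint_left]
      intro x hx hy
      have h1 : x ≤ -M := hx
      have h2 : 1 + M ≤ x := hy
      linarith
    · exact re_meas measurableSet_Ici
    · exact hu.iE.integrableOn
    · exact hu.iE.integrableOn
  linarith [min_le_left (δ / 2) (1 / 4 : ℝ)]

lemma trsl_sq {U : Set ℂ} {u : ℂ → ℝ} (h : TestOn U u) (t : ℂ) :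
    ∫⁻ x, ENNReal.ofReal ((u (x + t) - u x) ^ 2) ≤ ENNReal.ofReal (‖t‖ ^ 2 * En u) := by
  have hcd := h.contd
  have pt : ∀ x, (u (x + t) - u x) ^ 2 ≤ ∫ s in (0:ℝ)..1, ‖t‖ ^ 2 * ‖fderiv ℝ u (x + s * t)‖ ^ 2 := by
    intro x
    have hd : ∀ s : ℝ, HasDerivAt (fun s : ℝ => u (x + s * t)) (fderiv ℝ u (x + s * t) t) s := by
      intro s
      have h1 : HasDerivAt (fun s : ℝ => x + s * t) t s := by
        simpa using ((Complex.ofRealCLM.hasDerivAt (x := s)).mul_const t).const_add x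
      exact (h.diff _).hasFDerivAt.comp_hasDerivAt s h1
    have hc : Continuous fun s : ℝ => fderiv ℝ u (x + s * t) t := by fun_prop
    have e : u (x + t) - u x = ∫ s in (0:ℝ)..1, fderiv ℝ u (x + s * t) t := by
      rw [intervalIntegral.integral_eq_sub_of_hasDerivAt (fun s _ => hd s) (hc.intervalIntegrable _ _)]
      simp
    have cs := cs_int (μ := volume.restrict (Ioc (0:ℝ) 1)) (f := fun s : ℝ => fderiv ℝ u (x + s * t) t) (g := fun _ => 1)
      ((hc.pow 2).integrableOn_Ioc) (by fun_prop) (by simp only [mul_one]; exact hc.integrableOn_Ioc)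
    simp at cs
    rw [e, intervalIntegral.integral_of_le zero_le_one, intervalIntegral.integral_of_le zero_le_one]
    refine cs.trans ?_
    apply integral_mono (hc.pow 2).integrableOn_Ioc
      (by fun_prop : Continuous fun s : ℝ => ‖t‖ ^ 2 * ‖fderiv ℝ u (x + s * t)‖ ^ 2).integrableOn_Ioc
    intro s
    have := (fderiv ℝ u (x + s * t)).le_opNorm t
    have h2 : ‖fderiv ℝ u (x + s * t) t‖ ^ 2 ≤ (‖fderiv ℝ u (x + s * t)‖ * ‖t‖) ^ 2 := by gcongr
    rw [norm_eq_abs, sq_abs, mul_pow] at h2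
    show (fderiv ℝ u (x + s * t) t) ^ 2 ≤ _
    linarith
  calc ∫⁻ x, ENNReal.ofReal ((u (x + t) - u x) ^ 2)
      ≤ ∫⁻ x, ∫⁻ s in Ioc (0:ℝ) 1, ENNReal.ofReal (‖t‖ ^ 2 * ‖fderiv ℝ u (x + s * t)‖ ^ 2) := by
        apply lintegral_mono
        intro x
        have := pt x
        rw [intervalIntegral.integral_of_le zero_le_one] at this
        refine (ENNReal.ofReal_le_ofReal this).trans ?_
        rw [ofReal_integral_eq_lintegral_ofReal
          (by fun_prop : Continuous fun s : ℝ => ‖t‖ ^ 2 * ‖fderiv ℝ u (x + s * t)‖ ^ 2).integrableOn_Ioc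
          (ae_of_all _ fun s => by positivity)]
    _ = ∫⁻ s in Ioc (0:ℝ) 1, ∫⁻ x, ENNReal.ofReal (‖t‖ ^ 2 * ‖fderiv ℝ u (x + s * t)‖ ^ 2) := by
        apply lintegral_lintegral_swap
        apply Measurable.aemeasurable
        apply ENNReal.measurable_ofReal.comp
        apply Continuous.measurable
        show Continuous fun p : ℂ × ℝ => ‖t‖ ^ 2 * ‖fderiv ℝ u (p.1 + p.2 * t)‖ ^ 2
        fun_prop
    _ = ∫⁻ s in Ioc (0:ℝ) 1, ENNReal.ofReal (‖t‖ ^ 2 * En u) := by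
        congr 1; ext s
        rw [lintegral_add_right_eq_self (fun x => ENNReal.ofReal (‖t‖ ^ 2 * ‖fderiv ℝ u x‖ ^ 2)) (s * t),
          ← ofReal_integral_eq_lintegral_ofReal (h.iE.const_mul _) (ae_of_all _ fun s => by positivity), integral_const_mul]
        rfl
    _ = _ := by simp

/-- ball average -/
noncomputable def Av (h : ℝ) (u : ℂ → ℝ) (x : ℂ) : ℝ := (volume.real (Metric.ball (0:ℂ) h))⁻¹ * ∫ t in Metric.ball (0:ℂ) h, u (x + t)

lemma ball_pos {h : ℝ} (hh : 0 < h) : 0 < volume.real (Metric.ball (0:ℂ) h) :=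
  ENNReal.toReal_pos (Metric.measure_ball_pos _ _ hh).ne' measure_ball_lt_top.ne

lemma intOn_ball {f : ℂ → ℝ} (hf : Continuous f) (x : ℂ) (h : ℝ) : IntegrableOn f (Metric.ball x h) :=
  (hf.continuousOn.integrableOn_compact (isCompact_closedBall x h)).mono_set Metric.ball_subset_closedBall

lemma Av_sq {U : Set ℂ} {u : ℂ → ℝ} (hu : TestOn U u) {h : ℝ} (hh : 0 < h) :
    ∫⁻ x, ENNReal.ofReal ((Av h u x - u x) ^ 2) ≤ ENNReal.ofReal (h ^ 2 * En u) := by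
  have b0 := ball_pos hh
  have hc := hu.cont
  set b := volume.real (Metric.ball (0:ℂ) h) with hb
  have pt : ∀ x, (Av h u x - u x) ^ 2 ≤ b⁻¹ * ∫ t in Metric.ball (0:ℂ) h, (u (x + t) - u x) ^ 2 := by
    intro x
    have c1 : Continuous fun t => u (x + t) - u x := by fun_prop
    have e : Av h u x - u x = b⁻¹ * ∫ t in Metric.ball (0:ℂ) h, (u (x + t) - u x) := by
      rw [integral_sub (intOn_ball (by fun_prop) 0 h) (intOn_ball (by fun_prop) 0 h), setIntegral_const, smul_eq_mul, ← hb, Av, ← hb]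
      field_simp
    have cs := cs_int (μ := volume.restrict (Metric.ball (0:ℂ) h)) (f := fun t => u (x + t) - u x) (g := fun _ => 1)
      (intOn_ball (c1.pow 2) 0 h) (intOn_ball (by fun_prop) 0 h) (intOn_ball (by fun_prop) 0 h)
    simp only [mul_one, one_pow, setIntegral_const, smul_eq_mul, ← hb] at cs
    rw [e, mul_pow]
    calc _ ≤ b⁻¹ ^ 2 * ((∫ t in Metric.ball (0:ℂ) h, (u (x + t) - u x) ^ 2) * b) := by gcongr
      _ = _ := by field_simp
  have ib : ∀ x, IntegrableOn (fun t => (u (x + t) - u x) ^ 2) (Metric.ball (0:ℂ) h) := fun x =>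
    intOn_ball (by fun_prop) 0 h
  calc ∫⁻ x, ENNReal.ofReal ((Av h u x - u x) ^ 2)
      ≤ ∫⁻ x, ENNReal.ofReal b⁻¹ * ∫⁻ t in Metric.ball (0:ℂ) h, ENNReal.ofReal ((u (x + t) - u x) ^ 2) := by
        apply lintegral_mono
        intro x
        refine (ENNReal.ofReal_le_ofReal (pt x)).trans ?_
        rw [ENNReal.ofReal_mul (by positivity), ofReal_integral_eq_lintegral_ofReal (ib x) (ae_of_all _ fun s => by positivity)]
    _ = ENNReal.ofReal b⁻¹ * ∫⁻ x, ∫⁻ t in Metric.ball (0:ℂ) h, ENNReal.ofReal ((u (x + t) - u x) ^ 2) :=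
        lintegral_const_mul' _ _ ENNReal.ofReal_ne_top
    _ = ENNReal.ofReal b⁻¹ * ∫⁻ t in Metric.ball (0:ℂ) h, ∫⁻ x, ENNReal.ofReal ((u (x + t) - u x) ^ 2) := by
        congr 1
        apply lintegral_lintegral_swap
        apply Measurable.aemeasurable
        apply ENNReal.measurable_ofReal.comp
        apply Continuous.measurable
        show Continuous fun p : ℂ × ℂ => (u (p.1 + p.2) - u p.1) ^ 2
        fun_prop
    _ ≤ ENNReal.ofReal b⁻¹ * ∫⁻ t in Metric.ball (0:ℂ) h, ENNReal.ofReal (h ^ 2 * En u) := by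
        refine mul_le_mul le_rfl ?_ (by simp) (by simp)
        apply setLIntegral_mono measurable_const
        intro t ht
        refine (trsl_sq hu t).trans (ENNReal.ofReal_le_ofReal ?_)
        have := En_nonneg u
        have : ‖t‖ ≤ h := by rw [mem_ball_zero_iff] at ht; exact ht.le
        gcongr
    _ = _ := by
        rw [setLIntegral_const, mul_left_comm]
        have : volume (Metric.ball (0:ℂ) h) = ENNReal.ofReal b := by
          rw [hb, Measure.real, ENNReal.ofReal_toReal measure_ball_lt_top.ne]
        rw [this, ← ENNReal.ofReal_mul (by positivity), inv_mul_cancel₀ b0.ne']; simp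

lemma Av_cont {U : Set ℂ} {u : ℂ → ℝ} (hu : TestOn U u) (h : ℝ) : Continuous (Av h u) := by
  unfold Av
  apply Continuous.mul continuous_const
  have hc := hu.cont
  obtain ⟨B, hB⟩ := hu.cont.bounded_above_of_compact_support hu.cpt
  apply continuous_of_dominated (bound := fun _ => B)
  · intro x; exact (by fun_prop : Continuous fun t => u (x + t)).aestronglyMeasurable
  · intro x; exact ae_of_all _ fun t => hB _
  · exact intOn_ball continuous_const 0 h
  · exact ae_of_all _ fun t => by fun_prop

lemma Av_bound {U : Set ℂ} {u : ℂ → ℝ} (hu : TestOn U u) (h2 : ∫ z, u z ^ 2 ≤ 1) {h : ℝ} (hh : 0 < h) (x : ℂ) :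
    Av h u x ^ 2 ≤ (volume.real (Metric.ball (0:ℂ) h))⁻¹ := by
  have b0 := ball_pos hh
  have hc := hu.cont
  unfold Av
  set b := volume.real (Metric.ball (0:ℂ) h) with hb
  have cs := cs_int (μ := volume.restrict (Metric.ball (0:ℂ) h)) (f := fun t => u (x + t)) (g := fun _ => 1)
      (intOn_ball (by fun_prop) 0 h) (intOn_ball (by fun_prop) 0 h) (intOn_ball (by fun_prop) 0 h)
  simp only [mul_one, one_pow, setIntegral_const, smul_eq_mul, ← hb] at cs
  have h3 : ∫ t in Metric.ball (0:ℂ) h, u (x + t) ^ 2 ≤ 1 := by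
    refine (setIntegral_le_integral (hu.i2.comp_add_left x) (ae_of_all _ fun _ => by positivity)).trans ?_
    rw [integral_add_left_eq_self (fun t => u t ^ 2) x]; exact h2
  rw [mul_pow]
  calc _ ≤ b⁻¹ ^ 2 * (1 * b) := by
        gcongr
        exact cs.trans (by gcongr)
    _ = _ := by field_simp

lemma TestOn.memLp {U : Set ℂ} {u : ℂ → ℝ} (h : TestOn U u) : MemLp u 2 volume :=
  h.cont.memLp_of_hasCompactSupport h.cpt

lemma toLp_norm_sq {f : ℂ → ℝ} (hf : MemLp f 2 volume) : ‖hf.toLp f‖ ^ 2 = ∫ z, f z ^ 2 := by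
  rw [← real_inner_self_eq_norm_sq, L2.inner_def]
  apply integral_congr_ae
  filter_upwards [hf.coeFn_toLp] with z hz
  rw [hz]; simp [sq]

lemma weak_subseq {u : ℕ → ℂ → ℝ} (hu : ∀ n, TestOn (SH 1) (u n)) (h2 : ∀ n, ∫ z, u n z ^ 2 ≤ 1) :
    ∃ φ : ℕ → ℕ, StrictMono φ ∧ ∀ B : Set ℂ, MeasurableSet B → volume B ≠ ⊤ →
      ∃ l, Tendsto (fun n => ∫ z in B, u (φ n) z) atTop (𝓝 l) := by
  haveI : Fact ((2:ENNReal) ≠ ⊤) := ⟨by simp⟩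
  set f : ℕ → Lp ℝ 2 (volume : Measure ℂ) := fun n => (hu n).memLp.toLp (u n) with hf
  have hn : ∀ n, ‖f n‖ ≤ 1 := by
    intro n
    have := toLp_norm_sq (hu n).memLp
    have h3 : ‖f n‖ ^ 2 ≤ 1 := by rw [hf]; simp only; rw [this]; exact h2 n
    nlinarith [norm_nonneg (f n)]
  have hc := WeakDual.isSeqCompact_closedBall ℝ (Lp ℝ 2 (volume : Measure ℂ)) 0 1
  obtain ⟨g, _, φ, hφ, hl⟩ := hc (x := fun n => StrongDual.toWeakDual (innerSL ℝ (f n))) (by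
    intro n
    simp
    exact hn n)
  refine ⟨φ, hφ, fun B hB hB' => ⟨g (indicatorConstLp 2 hB hB' 1), ?_⟩⟩
  have h4 := (tendsto_iff_forall_eval_tendsto_topDualPairing.1 hl) (indicatorConstLp 2 hB hB' 1)
  have e : ∀ n, ∫ z in B, u n z = inner ℝ (f n) (indicatorConstLp 2 hB hB' (1:ℝ)) := by
    intro n
    rw [real_inner_comm, L2.inner_indicatorConstLp_one]
    apply setIntegral_congr_ae hB
    filter_upwards [(hu n).memLp.coeFn_toLp] with z hz _
    rw [hz]
  simp only [e]
  exact h4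

lemma l2_add (a b : ℝ) : (a + b) ^ 2 ≤ 2 * a ^ 2 + 2 * b ^ 2 := by nlinarith [sq_nonneg (a - b)]

lemma Av_integ {U : Set ℂ} {u : ℂ → ℝ} (hu : TestOn U u) {h : ℝ} (hh : 0 < h) :
    Integrable (fun x => (Av h u x - u x) ^ 2) ∧ ∫ x, (Av h u x - u x) ^ 2 ≤ h ^ 2 * En u := by
  have h1 := Av_sq hu hh
  have hc := hu.cont
  have hc2 := Av_cont hu h
  have m : AEStronglyMeasurable (fun x => (Av h u x - u x) ^ 2) volume :=
    (by fun_prop : Continuous fun x => (Av h u x - u x) ^ 2).aestronglyMeasurable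
  have hi : Integrable (fun x => (Av h u x - u x) ^ 2) := by
    refine ⟨m, ?_⟩
    rw [hasFiniteIntegral_iff_ofReal (ae_of_all _ fun _ => by positivity)]
    exact h1.trans_lt ENNReal.ofReal_lt_top
  refine ⟨hi, ?_⟩
  rw [← ofReal_integral_eq_lintegral_ofReal hi (ae_of_all _ fun _ => by positivity)] at h1
  exact (ENNReal.ofReal_le_ofReal_iff (mul_nonneg (by positivity) (En_nonneg u))).1 h1

/-- the truncated strip -/
def QK (K : ℝ) : Set ℂ := {z | |z.re| < K ∧ |z.im| < 1}

lemma QK_meas (K : ℝ) : MeasurableSet (QK K) :=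
  (measurableSet_lt (Complex.measurable_re.abs) measurable_const).inter
    (measurableSet_lt (Complex.measurable_im.abs) measurable_const)

lemma QK_fin (K : ℝ) : volume (QK K) < ⊤ := by
  refine (measure_mono (fun z hz => ?_)).trans_lt (measure_closedBall_lt_top (x := (0:ℂ)) (r := K + 1))
  rw [mem_closedBall_zero_iff]
  exact (Complex.norm_le_abs_re_add_abs_im z).trans (by linarith [hz.1, hz.2])

lemma split_int {u : ℂ → ℝ} (hu : TestOn (SH 1) u) {g : ℂ → ℝ} (hg : Integrable g) (h0 : ∀ z, u z = 0 → g z = 0) (K : ℝ) :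
    ∫ z, g z = (∫ z in QK K, g z) + ∫ z in Complex.re ⁻¹' {x | K ≤ |x|}, g z := by
  have hm : MeasurableSet {x : ℝ | K ≤ |x|} := measurableSet_le measurable_const measurable_id.abs
  rw [← integral_add_compl (re_meas hm) hg, add_comm]
  congr 1
  apply setIntegral_eq_of_subset_of_forall_sdiff_eq_zero (re_meas hm).compl
  · intro z hz hh
    have : K ≤ |z.re| := hh
    linarith [hz.1]
  · intro z hz
    apply h0
    apply hu.zU
    intro hh
    apply hz.2
    refine ⟨?_, hh⟩
    by_contra hcon
    exact hz.1 (not_lt.1 hcon)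

lemma l2_cauchy {u : ℕ → ℂ → ℝ} (hu : ∀ n, TestOn (SH 1) (u n)) (hE : ∀ n, En (u n) ≤ 1)
    (ht : ∀ δ : ℝ, 0 < δ → ∃ K : ℝ, ∃ N : ℕ, 0 < K ∧ ∀ n, N ≤ n → EA (u n) {x | K ≤ |x|} ≤ δ)
    (hw : ∀ B : Set ℂ, MeasurableSet B → volume B ≠ ⊤ → ∃ l, Tendsto (fun n => ∫ z in B, u n z) atTop (𝓝 l)) :
    ∀ ε : ℝ, 0 < ε → ∃ N, ∀ n m, N ≤ n → N ≤ m → ∫ z, (u n z - u m z) ^ 2 ≤ ε := by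
  intro ε hε
  have h2 : ∀ n, ∫ z, u n z ^ 2 ≤ 1 := fun n => (poincare' (hu n)).trans (hE n)
  set η := ε / 20 with hη
  have η0 : 0 < η := by positivity
  obtain ⟨K, N1, K0, hK⟩ := ht η η0
  set h := √η with hh
  have h0 : 0 < h := sqrt_pos.2 η0
  have hsq : h ^ 2 = η := sq_sqrt η0.le
  have lim : ∀ x, ∃ l, Tendsto (fun n => Av h (u n) x) atTop (𝓝 l) := by
    intro x
    obtain ⟨l, hl⟩ := hw (Metric.ball x h) measurableSet_ball measure_ball_lt_top.ne
    refine ⟨_, Tendsto.const_mul _ (hl.congr fun n => ?_)⟩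
    have e : Metric.ball (0:ℂ) h = (fun t => x + t) ⁻¹' Metric.ball x h := by
      ext t; simp [Metric.mem_ball, dist_eq_norm]
    rw [e, (measurePreserving_add_left volume x).setIntegral_preimage_emb (measurableEmbedding_addLeft x) (u n)]
  choose A hA using lim
  have DC : Tendsto (fun n => ∫ z in QK K, (Av h (u n) z - A z) ^ 2) atTop (𝓝 0) := by
    have mA : Measurable A := measurable_of_tendsto_metrizable (fun n => (Av_cont (hu n) h).measurable) (tendsto_pi_nhds.2 hA)
    set b := (volume.real (Metric.ball (0:ℂ) h))⁻¹
    have := tendsto_integral_of_dominated_convergence (μ := volume.restrict (QK K)) (F := fun n z => (Av h (u n) z - A z) ^ 2)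
      (f := fun _ => 0) (fun _ => 4 * b) ?_ ?_ ?_ ?_
    · simpa using this
    · intro n
      exact (((Av_cont (hu n) h).measurable.sub mA).pow_const 2).aestronglyMeasurable
    · exact integrableOn_const (QK_fin K).ne
    · intro n
      refine ae_of_all _ fun z => ?_
      have b1 := Av_bound (hu n) (h2 n) h0 z
      have b2 : A z ^ 2 ≤ b := le_of_tendsto ((hA z).pow 2) (Eventually.of_forall fun m => Av_bound (hu m) (h2 m) h0 z)
      rw [norm_eq_abs, abs_of_nonneg (sq_nonneg _)]
      nlinarith [sq_nonneg (Av h (u n) z + A z)]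
    · refine ae_of_all _ fun z => ?_
      have := ((hA z).sub_const (A z)).pow 2
      simpa using this
  obtain ⟨N2, hN2⟩ := eventually_atTop.1 (DC.eventually (gt_mem_nhds (show 0 < η by positivity)))
  have iD : ∀ n, IntegrableOn (fun z => (Av h (u n) z - A z) ^ 2) (QK K) := by
    intro n
    have mA : Measurable A := measurable_of_tendsto_metrizable (fun n => (Av_cont (hu n) h).measurable) (tendsto_pi_nhds.2 hA)
    set b := (volume.real (Metric.ball (0:ℂ) h))⁻¹
    haveI : IsFiniteMeasure (volume.restrict (QK K)) := ⟨by simpa using QK_fin K⟩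
    apply Integrable.of_bound (((Av_cont (hu n) h).measurable.sub mA).pow_const 2).aestronglyMeasurable (4 * b)
    refine ae_of_all _ fun z => ?_
    have b1 := Av_bound (hu n) (h2 n) h0 z
    have b2 : A z ^ 2 ≤ b := le_of_tendsto ((hA z).pow 2) (Eventually.of_forall fun m => Av_bound (hu m) (h2 m) h0 z)
    rw [norm_eq_abs, abs_of_nonneg (sq_nonneg _)]
    show (Av h (u n) z - A z) ^ 2 ≤ 4 * b
    nlinarith [sq_nonneg (Av h (u n) z + A z)]
  -- distance to `A` on the window
  have step : ∀ n, N2 ≤ n → IntegrableOn (fun z => (u n z - A z) ^ 2) (QK K) ∧ ∫ z in QK K, (u n z - A z) ^ 2 ≤ 4 * η := by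
    intro n hn
    have a1 := Av_integ (hu n) h0
    have a2 : ∫ z in QK K, (Av h (u n) z - u n z) ^ 2 ≤ η := by
      refine (setIntegral_le_integral a1.1 (ae_of_all _ fun _ => by positivity)).trans (a1.2.trans ?_)
      rw [hsq]; nlinarith [hE n]
    have mA : Measurable A := measurable_of_tendsto_metrizable (fun n => (Av_cont (hu n) h).measurable) (tendsto_pi_nhds.2 hA)
    have pt : ∀ z, (u n z - A z) ^ 2 ≤ 2 * (Av h (u n) z - u n z) ^ 2 + 2 * (Av h (u n) z - A z) ^ 2 := by
      intro z; nlinarith [sq_nonneg ((Av h (u n) z - u n z) + (Av h (u n) z - A z))]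
    have ii : IntegrableOn (fun z => 2 * (Av h (u n) z - u n z) ^ 2 + 2 * (Av h (u n) z - A z) ^ 2) (QK K) :=
      (a1.1.const_mul 2).integrableOn.add ((iD n).const_mul 2)
    have i3 : IntegrableOn (fun z => (u n z - A z) ^ 2) (QK K) := by
      apply Integrable.mono' ii (((hu n).cont.measurable.sub mA).pow_const 2).aestronglyMeasurable
      refine ae_of_all _ fun z => ?_
      rw [norm_eq_abs, abs_of_nonneg (sq_nonneg _)]; exact pt z
    refine ⟨i3, ?_⟩
    calc _ ≤ ∫ z in QK K, (2 * (Av h (u n) z - u n z) ^ 2 + 2 * (Av h (u n) z - A z) ^ 2) := integral_mono i3 ii pt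
      _ = 2 * (∫ z in QK K, (Av h (u n) z - u n z) ^ 2) + 2 * ∫ z in QK K, (Av h (u n) z - A z) ^ 2 := by
        rw [integral_add (a1.1.const_mul 2).restrict ((iD n).const_mul 2), integral_const_mul, integral_const_mul]
      _ ≤ 4 * η := by linarith [hN2 n hn]
  have hm : MeasurableSet {x : ℝ | K ≤ |x|} := measurableSet_le measurable_const measurable_id.abs
  refine ⟨max N1 N2, fun n m hn hm' => ?_⟩
  have s1 := step n (le_of_max_le_right hn)
  have s2 := step m (le_of_max_le_right hm')
  have tt := (hu n).sub (hu m)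
  rw [split_int tt tt.i2 (fun z hz => by rw [hz]; simp) K]
  have p1 : ∫ z in QK K, (u n z - u m z) ^ 2 ≤ 16 * η := by
    calc _ ≤ ∫ z in QK K, (2 * (u n z - A z) ^ 2 + 2 * (u m z - A z) ^ 2) := by
          apply integral_mono tt.i2.restrict ((s1.1.const_mul 2).add (s2.1.const_mul 2))
          intro z
          show (u n z - u m z) ^ 2 ≤ 2 * (u n z - A z) ^ 2 + 2 * (u m z - A z) ^ 2
          nlinarith [sq_nonneg ((u n z - A z) + (u m z - A z))]
      _ = 2 * (∫ z in QK K, (u n z - A z) ^ 2) + 2 * ∫ z in QK K, (u m z - A z) ^ 2 := by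
        rw [integral_add (s1.1.const_mul 2) (s2.1.const_mul 2), integral_const_mul, integral_const_mul]
      _ ≤ 16 * η := by linarith [s1.2, s2.2]
  have p2 : ∫ z in Complex.re ⁻¹' {x | K ≤ |x|}, (u n z - u m z) ^ 2 ≤ 4 * η := by
    calc _ ≤ ∫ z in Complex.re ⁻¹' {x | K ≤ |x|}, (2 * u n z ^ 2 + 2 * u m z ^ 2) := by
          apply integral_mono tt.i2.restrict (((hu n).i2.const_mul 2).add ((hu m).i2.const_mul 2)).restrict
          intro z
          show (u n z - u m z) ^ 2 ≤ 2 * (u n z) ^ 2 + 2 * (u m z) ^ 2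
          nlinarith [sq_nonneg (u n z + u m z)]
      _ = 2 * (∫ z in Complex.re ⁻¹' {x | K ≤ |x|}, (u n z) ^ 2) + 2 * ∫ z in Complex.re ⁻¹' {x | K ≤ |x|}, (u m z) ^ 2 := by
        rw [integral_add ((hu n).i2.const_mul 2).restrict ((hu m).i2.const_mul 2).restrict, integral_const_mul, integral_const_mul]
      _ ≤ 4 * η := by
        have q1 := (poincare (hu n) hm).trans (hK n (le_of_max_le_left hn))
        have q2 := (poincare (hu m) hm).trans (hK m (le_of_max_le_left hm'))
        linarith
  linarith

lemma rellich {u : ℕ → ℂ → ℝ} (hu : ∀ n, TestOn (SH 1) (u n)) (hE : ∀ n, En (u n) ≤ 1)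
    (ht : ∀ δ : ℝ, 0 < δ → ∃ K : ℝ, ∃ N : ℕ, 0 < K ∧ ∀ n, N ≤ n → EA (u n) {x | K ≤ |x|} ≤ δ) :
    ∃ φ : ℕ → ℕ, StrictMono φ ∧ ∃ v : ℂ → ℝ, Measurable v ∧ MemLp v 2 volume ∧
      (∀ᵐ z, Tendsto (fun n => u (φ n) z) atTop (𝓝 (v z))) ∧
      Tendsto (fun n => ∫ z, (u (φ n) z - v z) ^ 2) atTop (𝓝 0) := by
  obtain ⟨φ, hφ, hw⟩ := weak_subseq hu fun n => (poincare' (hu n)).trans (hE n)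
  have hc := l2_cauchy (fun n => hu (φ n)) (fun n => hE (φ n)) (by
    intro δ hδ
    obtain ⟨K, N, K0, h⟩ := ht δ hδ
    exact ⟨K, N, K0, fun n hn => h _ (hn.trans (hφ.id_le n))⟩) hw
  set f : ℕ → Lp ℝ 2 (volume : Measure ℂ) := fun n => (hu (φ n)).memLp.toLp (u (φ n)) with hf
  have cs : CauchySeq f := by
    rw [Metric.cauchySeq_iff]
    intro ε hε
    obtain ⟨N, hN⟩ := hc (ε ^ 2 / 4) (by positivity)
    refine ⟨N, fun n hn m hm => ?_⟩
    have h1 := hN n m hn hm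
    rw [dist_eq_norm]
    have e : f n - f m = ((hu (φ n)).memLp.sub (hu (φ m)).memLp).toLp _ := (MemLp.toLp_sub _ _).symm
    have h3 := toLp_norm_sq ((hu (φ n)).memLp.sub (hu (φ m)).memLp)
    rw [← e] at h3
    have h4 : ‖f n - f m‖ ^ 2 ≤ (ε / 2) ^ 2 := by
      rw [h3]; refine le_trans h1 (le_of_eq (by ring))
    have := sq_le_sq.1 h4
    rw [abs_of_nonneg (norm_nonneg _), abs_of_pos (by positivity)] at this
    linarith
  obtain ⟨g, hg⟩ := cauchySeq_tendsto_of_complete cs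
  obtain ⟨ns, hns, hae⟩ := (tendstoInMeasure_of_tendsto_Lp hg).exists_seq_tendsto_ae
  refine ⟨φ ∘ ns, hφ.comp hns, g, (Lp.stronglyMeasurable g).measurable, Lp.memLp g, ?_, ?_⟩
  · have hall : ∀ᵐ z, ∀ n, f n z = u (φ n) z := ae_all_iff.2 fun n => (hu (φ n)).memLp.coeFn_toLp
    filter_upwards [hae, hall] with z hz hz2
    refine hz.congr fun n => ?_
    rw [hz2]; rfl
  · have h1 : Tendsto (fun n => ‖f (ns n) - g‖ ^ 2) atTop (𝓝 0) := by
      have := (tendsto_iff_norm_sub_tendsto_zero.1 (hg.comp hns.tendsto_atTop)).pow 2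
      simpa using this
    refine h1.congr fun n => ?_
    have e : f (ns n) - g = ((hu (φ (ns n))).memLp.sub (Lp.memLp g)).toLp _ := by
      rw [MemLp.toLp_sub _ (Lp.memLp g), Lp.toLp_coeFn g (Lp.memLp g)]
    rw [e, toLp_norm_sq]; rfl

lemma MTB.tail {S : ℝ} (h : MTB S) {u : ℂ → ℝ} (hu : TestOn (SH 1) u) {K δ : ℝ} (hK : 0 < K) (δ0 : 0 < δ) (hδ : C1 * δ ≤ 1)
    (hE : EA u {x | K ≤ |x|} ≤ δ) :
    ∫ z in Complex.re ⁻¹' {x | K + 1 ≤ |x|}, (exp (4 * π * u z ^ 2) - 1) ≤ C1 * δ * S := by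
  set ψ : ℂ → ℝ := fun z => (1 - cutR (-K - 1) z) + cutR K z with hψ
  have sψ : ContDiff ℝ ∞ ψ := (contDiff_const.sub (cutR_smooth _)).add (cutR_smooth _)
  have mA : ∀ K : ℝ, MeasurableSet {x : ℝ | K ≤ |x|} := fun K => measurableSet_le measurable_const measurable_id.abs
  have fd : ∀ z, fderiv ℝ ψ z = - fderiv ℝ (cutR (-K - 1)) z + fderiv ℝ (cutR K) z := by
    intro z
    have h1 := ((cutR_diff (-K - 1) z).hasFDerivAt.const_sub 1).add (cutR_diff K z).hasFDerivAt
    exact h1.fderiv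
  have e1 : En (fun z => ψ z * u z) ≤ C1 * EA u {x | K ≤ |x|} := by
    apply En_cut hu sψ (mA K)
    · intro z
      rcases le_total z.re (-K) with hz | hz
      · have : cutR K z = 0 := cutR_zero (by linarith)
        simp only [hψ, this, add_zero]
        rw [abs_le]; constructor <;> linarith [cutR_nn (-K - 1) z, cutR_le (-K - 1) z]
      · have : cutR (-K - 1) z = 1 := cutR_one (by linarith)
        simp only [hψ, this, sub_self, zero_add]
        rw [abs_le]; constructor <;> linarith [cutR_nn K z, cutR_le K z]
    · intro z hz
      have hz' : |z.re| < K := not_le.1 hz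
      rw [abs_lt] at hz'
      simp only [hψ]
      rw [cutR_zero (c := K) (by linarith), cutR_one (by linarith)]; ring
    · intro z hz
      have hz' : |z.re| < K := not_le.1 hz
      rw [abs_lt] at hz'
      rw [fd, cutR_fderiv0, cutR_fderiv0]
      · simp
      · intro hh; linarith [hh.1]
      · intro hh; linarith [hh.2]
    · intro z
      rw [fd]
      refine (norm_add_le _ _).trans ?_
      rw [norm_neg]
      linarith [cutR_fderiv (-K - 1) z, cutR_fderiv K z]
  have e2 : En (fun z => ψ z * u z) ≤ C1 * δ := e1.trans (mul_le_mul_of_nonneg_left hE C1_pos.le)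
  have e3 := h.scale (hu.mul sψ) e2 (mul_pos C1_pos δ0) hδ
  refine le_trans ?_ e3
  refine le_trans (le_of_eq ?_) (setIntegral_le_integral (s := Complex.re ⁻¹' {x | K + 1 ≤ |x|}) ((hu.mul sψ).iF (4 * π)) (ae_of_all _ fun _ => ae_nn _))
  apply setIntegral_congr_fun (re_meas (mA _))
  intro z hz
  have hz' : K + 1 ≤ |z.re| := hz
  have : ψ z = 1 := by
    simp only [hψ]
    rcases le_abs.1 hz' with h1 | h1
    · rw [cutR_one (by linarith), cutR_one (by linarith)]; ring
    · rw [cutR_zero (by linarith), cutR_zero (by linarith)]; ring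
  simp only [this, one_mul]

lemma fatouF {u : ℕ → ℂ → ℝ} {v : ℂ → ℝ} {S : ℝ} (hu : ∀ n, TestOn (SH 1) (u n)) (hF : ∀ n, Fn (u n) ≤ S) (mv : Measurable v)
    (hae : ∀ᵐ z, Tendsto (fun n => u n z) atTop (𝓝 (v z))) :
    Integrable (fun z => exp (4 * π * v z ^ 2) - 1) ∧ Fn v ≤ S := by
  have S0 : 0 ≤ S := (Fn_nonneg _).trans (hF 0)
  have h1 : ∫⁻ z, ENNReal.ofReal (exp (4 * π * v z ^ 2) - 1) ≤ ENNReal.ofReal S := by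
    have e : ∫⁻ z, ENNReal.ofReal (exp (4 * π * v z ^ 2) - 1) =
        ∫⁻ z, liminf (fun n => ENNReal.ofReal (exp (4 * π * u n z ^ 2) - 1)) atTop := by
      apply lintegral_congr_ae
      filter_upwards [hae] with z hz
      have hc : Continuous fun x : ℝ => ENNReal.ofReal (exp (4 * π * x ^ 2) - 1) :=
        ENNReal.continuous_ofReal.comp (by fun_prop)
      exact ((hc.tendsto _).comp hz).liminf_eq.symm
    rw [e]
    refine (lintegral_liminf_le fun n => ?_).trans ?_
    · have := (hu n).cont
      exact (ENNReal.continuous_ofReal.comp (by fun_prop : Continuous fun z => exp (4 * π * u n z ^ 2) - 1)).measurable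
    · refine liminf_le_of_le (by isBoundedDefault) fun b hb => ?_
      obtain ⟨n, hn⟩ := hb.exists
      refine hn.trans ?_
      rw [← ofReal_integral_eq_lintegral_ofReal ((hu n).iF _) (ae_of_all _ fun _ => ae_nn _)]
      exact ENNReal.ofReal_le_ofReal (hF n)
  have m : Measurable (fun z => exp (4 * π * v z ^ 2) - 1) := by fun_prop
  have hi : Integrable (fun z => exp (4 * π * v z ^ 2) - 1) := by
    refine ⟨m.aestronglyMeasurable, ?_⟩
    rw [hasFiniteIntegral_iff_ofReal (ae_of_all _ fun _ => ae_nn _)]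
    exact h1.trans_lt ENNReal.ofReal_lt_top
  refine ⟨hi, ?_⟩
  rw [← ofReal_integral_eq_lintegral_ofReal hi (ae_of_all _ fun _ => ae_nn _)] at h1
  exact (ENNReal.ofReal_le_ofReal_iff S0).1 h1

lemma trunc_le {x t p : ℝ} (ht : 0 ≤ t) (hp : 1 ≤ p) :
    exp (4 * π * x ^ 2) - 1 ≤ min (exp (4 * π * x ^ 2) - 1) (exp (4 * π * t ^ 2) - 1) +
      exp (-(4 * π * (p - 1) * t ^ 2)) * exp (4 * π * p * x ^ 2) := by
  have hpos : 0 ≤ exp (-(4 * π * (p - 1) * t ^ 2)) * exp (4 * π * p * x ^ 2) := by positivity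
  rcases le_total (exp (4 * π * x ^ 2) - 1) (exp (4 * π * t ^ 2) - 1) with h | h
  · rw [min_eq_left h]; linarith
  · rw [min_eq_right h]
    have h1 : 4 * π * t ^ 2 ≤ 4 * π * x ^ 2 := by
      have := exp_le_exp.1 (by linarith : exp (4 * π * t ^ 2) ≤ exp (4 * π * x ^ 2)); exact this
    have h2 : t ^ 2 ≤ x ^ 2 := by
      have : 0 < 4 * π := by positivity
      nlinarith
    have h3 : exp (4 * π * x ^ 2) ≤ exp (-(4 * π * (p - 1) * t ^ 2)) * exp (4 * π * p * x ^ 2) := by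
      rw [← exp_add]
      apply exp_le_exp.2
      have : 0 ≤ 4 * π * (p - 1) * (x ^ 2 - t ^ 2) := mul_nonneg (mul_nonneg (by positivity) (by linarith)) (by linarith)
      nlinarith
    have h4 : 1 ≤ exp (4 * π * t ^ 2) := one_le_exp (by positivity)
    linarith

lemma vitali {A : Set ℂ} (fA : volume A ≠ ⊤) {u : ℕ → ℂ → ℝ} {v : ℂ → ℝ}
    (hu : ∀ n, TestOn (SH 1) (u n)) (mv : Measurable v)
    (hae : ∀ᵐ z, Tendsto (fun n => u n z) atTop (𝓝 (v z))) (vi : Integrable (fun z => exp (4 * π * v z ^ 2) - 1))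
    {p C : ℝ} (hp : 1 < p) (hC : ∀ᶠ n in atTop, ∫ z in A, exp (4 * π * p * u n z ^ 2) ≤ C) {ε : ℝ} (hε : 0 < ε) :
    ∀ᶠ n in atTop, ∫ z in A, (exp (4 * π * u n z ^ 2) - 1) ≤ (∫ z in A, (exp (4 * π * v z ^ 2) - 1)) + ε := by
  haveI : IsFiniteMeasure (volume.restrict A) := ⟨by simpa using fA.lt_top⟩
  -- choice of the truncation level
  have lim : Tendsto (fun t : ℝ => exp (-(4 * π * (p - 1) * t ^ 2)) * C) atTop (𝓝 (0 * C)) := by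
    apply Tendsto.mul_const
    apply tendsto_exp_neg_atTop_nhds_zero.comp
    apply Tendsto.const_mul_atTop (mul_pos (by positivity) (by linarith))
    exact tendsto_pow_atTop (by norm_num)
  rw [zero_mul] at lim
  obtain ⟨t, ht, t0⟩ := ((lim.eventually (gt_mem_nhds (show 0 < ε / 2 by positivity))).and (eventually_ge_atTop 0)).exists
  set g : ℝ → ℝ := fun x => min (exp (4 * π * x ^ 2) - 1) (exp (4 * π * t ^ 2) - 1) with hg
  have gc : Continuous g := by fun_prop
  have g0 : ∀ x, 0 ≤ g x := fun x => le_min (ae_nn _) (ae_nn _)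
  have gb : ∀ x, ‖g x‖ ≤ exp (4 * π * t ^ 2) - 1 := fun x => by
    rw [norm_eq_abs, abs_of_nonneg (g0 x)]; exact min_le_right _ _
  have gm : ∀ n, AEStronglyMeasurable (fun z => g (u n z)) (volume.restrict A) := fun n =>
    (gc.comp (hu n).cont).aestronglyMeasurable
  have DC : Tendsto (fun n => ∫ z in A, g (u n z)) atTop (𝓝 (∫ z in A, g (v z))) := by
    apply tendsto_integral_of_dominated_convergence (fun _ => exp (4 * π * t ^ 2) - 1) gm (integrableOn_const fA)
    · intro n; exact ae_of_all _ fun z => gb _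
    · filter_upwards [ae_restrict_of_ae hae] with z hz
      exact (gc.tendsto _).comp hz
  have gv : ∫ z in A, g (v z) ≤ ∫ z in A, (exp (4 * π * v z ^ 2) - 1) := by
    apply integral_mono (Integrable.of_bound (gc.measurable.comp mv).aestronglyMeasurable _ (ae_of_all _ fun z => gb _)) vi.restrict
    intro z; exact min_le_left _ _
  filter_upwards [hC, DC.eventually (gt_mem_nhds (show ∫ z in A, g (v z) < (∫ z in A, g (v z)) + ε / 2 by linarith))] with n h1 h2
  have ie : IntegrableOn (fun z => exp (4 * π * p * u n z ^ 2)) A := by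
    have : IntegrableOn (fun z => (exp (4 * π * p * u n z ^ 2) - 1) + 1) A :=
      Integrable.add ((hu n).iF _).restrict (integrableOn_const fA)
    simpa using this
  have ig : IntegrableOn (fun z => g (u n z)) A := Integrable.of_bound (gm n) _ (ae_of_all _ fun z => gb _)
  have key : ∫ z in A, (exp (4 * π * u n z ^ 2) - 1) ≤
      ∫ z in A, (g (u n z) + exp (-(4 * π * (p - 1) * t ^ 2)) * exp (4 * π * p * u n z ^ 2)) := by
    apply integral_mono ((hu n).iF _).restrict (ig.add (ie.const_mul _))
    intro z
    exact trunc_le t0 hp.le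
  rw [integral_add ig (ie.const_mul _), integral_const_mul] at key
  have k2 := mul_le_mul_of_nonneg_left h1 (exp_pos (-(4 * π * (p - 1) * t ^ 2))).le
  linarith

/-- exponential integrability gained from an energy drop -/
lemma MTB.lp {S : ℝ} (h : MTB S) {A : Set ℂ} (mA : MeasurableSet A) (fA : volume A ≠ ⊤) {u w : ℂ → ℝ} (hu : TestOn (SH 1) u) (hw : TestOn (SH 1) w)
    {p κ M : ℝ} (hp : 1 < p) (κ0 : 0 < κ) (hM : ∀ z ∈ A, (u z - w z) ^ 2 ≤ M) (hE : p * (1 + κ) * En w ≤ 1) :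
    ∫ z in A, exp (4 * π * p * u z ^ 2) ≤ exp (4 * π * p * (1 + 1 / κ) * M) * (S + volume.real A) := by
  have q0 : 0 < p * (1 + κ) := by positivity
  have hv := hw.smul √(p * (1 + κ))
  have e1 := h _ hv (by rw [hw.En_smul, sq_sqrt q0.le]; exact hE)
  have iw : IntegrableOn (fun z => (exp (4 * π * (√(p * (1 + κ)) * w z) ^ 2) - 1) + 1) A :=
      Integrable.add (hv.iF _).restrict (integrableOn_const fA)
  have e2 : ∫ z in A, ((exp (4 * π * (√(p * (1 + κ)) * w z) ^ 2) - 1) + 1) ≤ S + volume.real A := by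
    rw [integral_add (hv.iF _).restrict (integrableOn_const fA)]
    have := setIntegral_le_integral (s := A) (hv.iF (4 * π)) (ae_of_all _ fun _ => ae_nn _)
    simp only [integral_const, smul_eq_mul, mul_one, measureReal_restrict_apply_univ]
    have e3 : Fn (fun z => √(p * (1 + κ)) * w z) = ∫ z, (exp (4 * π * (√(p * (1 + κ)) * w z) ^ 2) - 1) := rfl
    linarith
  refine le_trans ?_ (mul_le_mul_of_nonneg_left e2 (exp_pos _).le)
  rw [← integral_const_mul]
  have ie : IntegrableOn (fun z => exp (4 * π * p * u z ^ 2)) A := by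
    have : IntegrableOn (fun z => (exp (4 * π * p * u z ^ 2) - 1) + 1) A :=
      Integrable.add (hu.iF _).restrict (integrableOn_const fA)
    simpa using this
  apply setIntegral_mono_on ie (iw.const_mul _) mA
  intro z hz
  rw [sub_add_cancel, ← exp_add]
  apply exp_le_exp.2
  rw [mul_pow, sq_sqrt q0.le]
  have h1 : u z ^ 2 ≤ (1 + κ) * w z ^ 2 + (1 + 1 / κ) * (u z - w z) ^ 2 := by
    have e : (1 + κ) * w z ^ 2 + (1 + 1 / κ) * (u z - w z) ^ 2 - u z ^ 2 = (κ * w z - (u z - w z)) ^ 2 / κ := by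
      field_simp; ring
    have : 0 ≤ (κ * w z - (u z - w z)) ^ 2 / κ := by positivity
    linarith
  have h2 : (1 + 1 / κ) * (u z - w z) ^ 2 ≤ (1 + 1 / κ) * M := mul_le_mul_of_nonneg_left (hM z hz) (by positivity)
  have h3 := mul_le_mul_of_nonneg_left (h1.trans (add_le_add_right h2 _)) (show 0 ≤ 4 * π * p by positivity)
  nlinarith

noncomputable def Bn (u v : ℂ → ℝ) : ℝ :=
  ∫ z, (fderiv ℝ u z 1 * fderiv ℝ v z 1 + fderiv ℝ u z Complex.I * fderiv ℝ v z Complex.I)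

lemma TestOn.iB {U V : Set ℂ} {u v : ℂ → ℝ} (hu : TestOn U u) (hv : TestOn V v) :
    Integrable fun z => fderiv ℝ u z 1 * fderiv ℝ v z 1 + fderiv ℝ u z Complex.I * fderiv ℝ v z Complex.I :=
  hu.integ (by have := hu.contd; have := hv.contd; fun_prop) fun z hz => by simp [hu.d0 hz]

lemma En_add {U : Set ℂ} {u v : ℂ → ℝ} (hu : TestOn U u) (hv : TestOn U v) (t : ℝ) :
    En (fun z => u z + t * v z) = En u + 2 * t * Bn u v + t ^ 2 * En v := by
  have i1 : Integrable fun z => 2 * t * (fderiv ℝ u z 1 * fderiv ℝ v z 1 + fderiv ℝ u z Complex.I * fderiv ℝ v z Complex.I) := (hu.iB hv).const_mul _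
  have i2 : Integrable fun z => t ^ 2 * ‖fderiv ℝ v z‖ ^ 2 := hv.iE.const_mul _
  have i3 : Integrable fun z => ‖fderiv ℝ u z‖ ^ 2 + 2 * t * (fderiv ℝ u z 1 * fderiv ℝ v z 1 + fderiv ℝ u z Complex.I * fderiv ℝ v z Complex.I) := hu.iE.add i1
  rw [En, En, En, Bn, ← integral_const_mul, ← integral_const_mul, ← integral_add hu.iE i1, ← integral_add i3 i2]
  congr 1; ext z
  have : fderiv ℝ (fun z => u z + t * v z) z = fderiv ℝ u z + t • fderiv ℝ v z := by
    exact ((hu.diff z).hasFDerivAt.add ((hv.diff z).hasFDerivAt.const_mul t)).fderiv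
  rw [this, clm_norm_sq, clm_norm_sq, clm_norm_sq]
  simp only [add_apply, ContinuousLinearMap.smul_apply, smul_eq_mul, ContinuousLinearMap.add_apply]
  ring

lemma Bn_add {U : Set ℂ} {u v w : ℂ → ℝ} (hu : TestOn U u) (hv : TestOn U v) (hw : TestOn U w) :
    Bn u (fun z => v z + w z) = Bn u v + Bn u w := by
  rw [Bn, Bn, Bn, ← integral_add (hu.iB hv) (hu.iB hw)]
  congr 1; ext z
  have : fderiv ℝ (fun z => v z + w z) z = fderiv ℝ v z + fderiv ℝ w z :=
    ((hv.diff z).hasFDerivAt.add (hw.diff z).hasFDerivAt).fderiv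
  rw [this]
  simp only [ContinuousLinearMap.add_apply]
  ring

lemma Bn_bound {U : Set ℂ} {u v : ℂ → ℝ} (hu : TestOn U u) (hv : TestOn U v) (h1 : En u ≤ 1) (h2 : En v ≤ 1) :
    Bn u v ∈ Icc (-1:ℝ) 1 := by
  have a1 := En_add hu hv 1
  have a2 := En_add hu hv (-1)
  have b1 := En_nonneg (fun z => u z + 1 * v z)
  have b2 := En_nonneg (fun z => u z + -1 * v z)
  constructor <;> nlinarith

/-- A good maximizing sequence. -/
structure MaxSeq (S : ℝ) (u : ℕ → ℂ → ℝ) (v : ℂ → ℝ) (c : ℕ → ℝ) : Prop where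
  test : ∀ n, TestOn (SH 1) (u n)
  en : ∀ n, En (u n) ≤ 1
  lim : Tendsto (fun n => Fn (u n)) atTop (𝓝 S)
  tight : ∀ δ : ℝ, 0 < δ → ∃ K : ℝ, ∃ N : ℕ, 0 < K ∧ ∀ n, N ≤ n → EA (u n) {x | K ≤ |x|} ≤ δ
  mv : Measurable v
  mem : MemLp v 2 volume
  ae : ∀ᵐ z, Tendsto (fun n => u n z) atTop (𝓝 (v z))
  l2 : Tendsto (fun n => ∫ z, (u n z - v z) ^ 2) atTop (𝓝 0)
  inn : ∀ m, Tendsto (fun n => Bn (u n) (u m)) atTop (𝓝 (c m))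

lemma exists_maxSeq {S : ℝ} (h : MTB S) (hS : 4 * π < S)
    (hsup : ∀ ε : ℝ, 0 < ε → ∃ u, TestOn (SH 1) u ∧ En u ≤ 1 ∧ S - ε < Fn u) :
    ∃ u v c, MaxSeq S u v c := by
  have S0 : 0 < S := lt_trans (by positivity) hS
  have step : ∀ n : ℕ, ∃ u, TestOn (SH 1) u ∧ En u ≤ 1 ∧ S - (S / 4) * (1 / (n + 1)) ≤ Fn u ∧ Centered u := by
    intro n
    obtain ⟨u, hu, hE, hF⟩ := hsup ((S / 4) * (1 / (n + 1))) (by positivity)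
    have h3 : 3 / 4 ≤ En u := by
      by_contra hcon
      push Not at hcon
      have := h.scale hu hcon.le (by norm_num) (by norm_num)
      have h4 : (1:ℝ) / (n + 1) ≤ 1 := by
        rw [div_le_one (by positivity)]; linarith [(Nat.cast_nonneg n : (0:ℝ) ≤ n)]
      nlinarith
    obtain ⟨k, hk⟩ := exists_centered hu h3
    exact ⟨trsl k u, trsl_test hu k, by rw [trsl_En]; exact hE, by rw [trsl_Fn]; exact hF.le, hk⟩
  choose u hu hE hF hc using step
  have t1 : Tendsto (fun n : ℕ => S - (S / 4) * (1 / ((n:ℝ) + 1))) atTop (𝓝 S) := by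
    have := (tendsto_one_div_add_atTop_nhds_zero_nat (𝕜 := ℝ)).const_mul (S / 4)
    have := this.const_sub S
    simpa using this
  have lim : Tendsto (fun n => Fn (u n)) atTop (𝓝 S) :=
    tendsto_of_tendsto_of_tendsto_of_le_of_le t1 tendsto_const_nhds hF fun n => h _ (hu n) (hE n)
  have tight : ∀ δ : ℝ, 0 < δ → ∃ K : ℝ, ∃ N : ℕ, 0 < K ∧ ∀ n, N ≤ n → EA (u n) {x | K ≤ |x|} ≤ δ := by
    intro δ δ0
    obtain ⟨K, τ, K0, τ0, hK⟩ := h.tight hS δ0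
    obtain ⟨N, hN⟩ := eventually_atTop.1 (lim.eventually (lt_mem_nhds (show S - τ < S by linarith)))
    exact ⟨K, N, K0, fun n hn => hK _ (hu n) (hE n) (hN n hn).le (hc n)⟩
  obtain ⟨φ, hφ, v, mv, mem, hae, hl2⟩ := rellich hu hE tight
  -- weak convergence of gradients against the sequence
  have hcpt : IsCompact (Set.univ.pi fun _ : ℕ => Icc (-1:ℝ) 1) := isCompact_univ_pi fun _ => isCompact_Icc
  obtain ⟨c', _, ψ, hψ, hl⟩ := hcpt.tendsto_subseq (x := fun n m => Bn (u (φ n)) (u (φ m)))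
    (fun n m _ => Bn_bound (hu _) (hu _) (hE _) (hE _))
  have hψt := hψ.tendsto_atTop
  refine ⟨fun n => u (φ (ψ n)), v, fun m => c' (ψ m), ?_⟩
  exact {
    test := fun n => hu _
    en := fun n => hE _
    lim := lim.comp (hφ.tendsto_atTop.comp hψt)
    tight := by
      intro δ δ0
      obtain ⟨K, N, K0, hh⟩ := tight δ δ0
      exact ⟨K, N, K0, fun n hn => hh _ (hn.trans ((hψ.id_le n).trans (hφ.id_le _)))⟩
    mv := mv
    mem := mem
    ae := by
      filter_upwards [hae] with z hz
      exact hz.comp hψt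
    l2 := hl2.comp hψt
    inn := fun m => (tendsto_pi_nhds.1 hl) (ψ m) }

lemma MaxSeq.split {S : ℝ} {u v c} (s : MaxSeq S u v c) (h : MTB S) {ε : ℝ} (hε : 0 < ε) :
    ∃ K : ℝ, 0 < K ∧ ∀ᶠ n in atTop, Fn (u n) ≤ (∫ z in QK K, (exp (4 * π * u n z ^ 2) - 1)) + ε := by
  have S0 := h.nonneg
  have c1 := C1_pos
  set δ := min (1 / C1) (ε / (C1 * (S + 1))) with hδ
  have δ0 : 0 < δ := lt_min (by positivity) (by positivity)
  obtain ⟨K, N, K0, hK⟩ := s.tight δ δ0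
  refine ⟨K + 1, by linarith, eventually_atTop.2 ⟨N, fun n hn => ?_⟩⟩
  have e := split_int (s.test n) ((s.test n).iF (4 * π)) (fun z hz => by rw [hz]; simp) (K + 1)
  have d1 : C1 * δ ≤ 1 := by
    have := mul_le_mul_of_nonneg_left (min_le_left (1 / C1) (ε / (C1 * (S + 1)))) c1.le
    rwa [mul_one_div_cancel c1.ne'] at this
  have t := h.tail (s.test n) K0 δ0 d1 (hK n hn)
  have d2 : C1 * δ * S ≤ ε := by
    have h1 := mul_le_mul_of_nonneg_left (min_le_right (1 / C1) (ε / (C1 * (S + 1)))) c1.le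
    have h2 : C1 * (ε / (C1 * (S + 1))) * (S + 1) = ε := by field_simp
    have h3 : 0 ≤ C1 * δ := by positivity
    have h4 := mul_le_mul_of_nonneg_right h1 (show 0 ≤ S + 1 by linarith)
    rw [h2] at h4
    change C1 * δ * (S + 1) ≤ ε at h4
    nlinarith
  have e2 : Fn (u n) = ∫ z, (exp (4 * π * u n z ^ 2) - 1) := rfl
  linarith

lemma MaxSeq.caseA {S : ℝ} {u v c} (s : MaxSeq S u v c) (h : MTB S) {m : ℕ} (hm : 0 < c m) :
    Fn v = S := by
  obtain ⟨vi, vS⟩ := fatouF s.test (fun n => h _ (s.test n) (s.en n)) s.mv s.ae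
  apply le_antisymm vS
  apply le_of_forall_pos_le_add
  intro ε hε
  obtain ⟨K, K0, hK⟩ := s.split h (show 0 < ε / 2 by positivity)
  set d := c m with hd
  have d1 : d ≤ 1 := le_of_tendsto (s.inn m) (Eventually.of_forall fun n => (Bn_bound (s.test n) (s.test m) (s.en n) (s.en m)).2)
  obtain ⟨M, hM⟩ := (s.test m).cpt.exists_bound_of_continuous (s.test m).cont
  -- exponents
  set p := 1 + d ^ 2 / 8 with hp
  have p1 : 1 < p := by rw [hp]; have : 0 < d ^ 2 / 8 := by positivity
                        linarith
  have lp : ∀ᶠ n in atTop, ∫ z in QK K, exp (4 * π * p * u n z ^ 2) ≤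
      exp (4 * π * p * (1 + 1 / (d ^ 2 / 8)) * (M ^ 2)) * (S + volume.real (QK K)) := by
    filter_upwards [(s.inn m).eventually (lt_mem_nhds (show 3 / 4 * d < d by linarith))] with n hn
    have hE := En_add (s.test n) (s.test m) (-d)
    have e2 : En (fun z => u n z + -d * u m z) ≤ 1 - d ^ 2 / 2 := by
      rw [hE]
      have := s.en n
      have := mul_le_mul_of_nonneg_left (s.en m) (sq_nonneg d)
      nlinarith
    apply h.lp (QK_meas K) (QK_fin K).ne (s.test n) ((s.test n).add ((s.test m).smul (-d))) p1 (by positivity)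
    · intro z _
      have := hM z
      rw [norm_eq_abs] at this
      have h2 : u n z - (u n z + -d * u m z) = d * u m z := by ring
      rw [h2, mul_pow]
      have h3 : u m z ^ 2 ≤ M ^ 2 := by
        rw [← sq_abs (u m z)]; gcongr
      have h4 : d ^ 2 ≤ 1 := by nlinarith
      nlinarith [sq_nonneg (u m z)]
    · have h3 : 0 ≤ p * (1 + d ^ 2 / 8) := by positivity
      refine (mul_le_mul_of_nonneg_left e2 h3).trans ?_
      rw [hp]
      set x := d ^ 2 / 8 with hx
      have : d ^ 2 / 2 = 4 * x := by rw [hx]; ring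
      rw [this]
      have x0 : 0 ≤ x := by positivity
      nlinarith [mul_nonneg x0 x0, mul_nonneg x0 (mul_nonneg x0 x0)]
  have vt := vitali (QK_fin K).ne s.test s.mv s.ae vi p1 lp (show 0 < ε / 2 by positivity)
  have vle : ∫ z in QK K, (exp (4 * π * v z ^ 2) - 1) ≤ Fn v :=
    setIntegral_le_integral vi (ae_of_all _ fun _ => ae_nn _)
  refine le_of_tendsto s.lim ?_
  filter_upwards [hK, vt] with n h1 h2
  linarith

lemma MaxSeq.cesaro {S : ℝ} {u v c} (s : MaxSeq S u v c) (hc : ∀ m, c m ≤ 0) {ε : ℝ} (hε : 0 < ε) (k : ℕ) :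
    ∃ w, TestOn (SH 1) w ∧ En w ≤ k + k ^ 2 * ε ∧ ∫ z, (w z - k * v z) ^ 2 ≤ k ^ 2 * ε ∧
      ∀ᶠ n in atTop, Bn (u n) w ≤ k * ε := by
  induction k with
  | zero =>
    refine ⟨fun _ => 0, TestOn.zero, by simp [En], by simp, Eventually.of_forall fun n => by simp [Bn]⟩
  | succ k ih =>
    obtain ⟨w, hw, h1, h2, h3⟩ := ih
    obtain ⟨n, h4, h5⟩ := (h3.and (s.l2.eventually (gt_mem_nhds hε))).exists
    refine ⟨fun z => w z + u n z, hw.add (s.test n), ?_, ?_, ?_⟩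
    · have e := En_add (s.test n) hw 1
      have e' : (fun z => u n z + 1 * w z) = fun z => w z + u n z := by ext z; ring
      rw [e'] at e
      rw [e]
      have := s.en n
      push_cast
      nlinarith
    · have i1 : Integrable fun z => (w z - k * v z) ^ 2 := (hw.memLp.sub (s.mem.const_mul (k:ℝ))).integrable_sq
      have i2 : Integrable fun z => (u n z - v z) ^ 2 := ((s.test n).memLp.sub s.mem).integrable_sq
      have i3 : Integrable fun z => (w z + u n z - (k + 1 : ℕ) * v z) ^ 2 :=
        ((hw.add (s.test n)).memLp.sub (s.mem.const_mul ((k + 1 : ℕ) : ℝ))).integrable_sq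
      rcases Nat.eq_zero_or_pos k with rfl | kp
      · have h6 : ∫ z, w z ^ 2 ≤ 0 := by simpa using h2
        have h7 : ∫ z, (w z + u n z - (0 + 1 : ℕ) * v z) ^ 2 = ∫ z, (u n z - v z) ^ 2 := by
          have hz : (fun z => w z ^ 2) =ᵐ[volume] 0 :=
            (integral_eq_zero_iff_of_nonneg (fun _ => sq_nonneg _) hw.i2).1 (le_antisymm h6 (integral_nonneg fun _ => sq_nonneg _))
          apply integral_congr_ae
          filter_upwards [hz] with z hz
          have : w z = 0 := by simpa using hz
          simp [this]
        rw [h7]; simpa using h5.le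
      · have kp' : (0:ℝ) < k := by exact_mod_cast kp
        calc ∫ z, (w z + u n z - (k + 1 : ℕ) * v z) ^ 2 ≤ ∫ z, ((1 + 1 / (k:ℝ)) * (w z - k * v z) ^ 2 + (1 + k) * (u n z - v z) ^ 2) := by
              apply integral_mono i3 ((i1.const_mul _).add (i2.const_mul _))
              intro z
              show (w z + u n z - (k + 1 : ℕ) * v z) ^ 2 ≤ (1 + 1 / (k:ℝ)) * (w z - k * v z) ^ 2 + (1 + k) * (u n z - v z) ^ 2
              have e : (1 + 1 / (k:ℝ)) * (w z - k * v z) ^ 2 + (1 + k) * (u n z - v z) ^ 2 - (w z + u n z - (k + 1 : ℕ) * v z) ^ 2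
                = ((w z - k * v z) - k * (u n z - v z)) ^ 2 / k := by
                push_cast; field_simp; ring
              have : 0 ≤ ((w z - k * v z) - k * (u n z - v z)) ^ 2 / k := by positivity
              linarith
          _ = (1 + 1 / (k:ℝ)) * (∫ z, (w z - k * v z) ^ 2) + (1 + k) * ∫ z, (u n z - v z) ^ 2 := by
              rw [integral_add (i1.const_mul _) (i2.const_mul _), integral_const_mul, integral_const_mul]
          _ ≤ (1 + 1 / (k:ℝ)) * (k ^ 2 * ε) + (1 + k) * ε := by
              have := h5.le
              gcongr
          _ = ((k + 1 : ℕ) : ℝ) ^ 2 * ε := by push_cast; field_simp; ring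
    · filter_upwards [h3, (s.inn n).eventually (gt_mem_nhds (show c n < ε by linarith [hc n]))] with j h6 h7
      rw [Bn_add (s.test j) hw (s.test n)]
      push_cast
      linarith

lemma MaxSeq.vzero {S : ℝ} {u v c} (s : MaxSeq S u v c) (hc : ∀ m, c m ≤ 0) : ∀ᵐ z, v z = 0 := by
  have i1 : Integrable fun z => v z ^ 2 := s.mem.integrable_sq
  have key : ∀ ε : ℝ, 0 < ε → ∫ z, v z ^ 2 ≤ 0 + ε := by
    intro ε hε
    obtain ⟨k, hk⟩ := exists_nat_gt (8 / ε)
    have k0 : (0:ℝ) < k := lt_trans (by positivity) hk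
    obtain ⟨w, hw, h1, h2, _⟩ := s.cesaro hc (show 0 < ε / 8 by positivity) k
    have i2 : Integrable fun z => (w z - k * v z) ^ 2 := (hw.memLp.sub (s.mem.const_mul (k:ℝ))).integrable_sq
    have h3 : (k:ℝ) ^ 2 * ∫ z, v z ^ 2 ≤ 2 * (∫ z, w z ^ 2) + 2 * ∫ z, (w z - k * v z) ^ 2 := by
      rw [← integral_const_mul, ← integral_const_mul, ← integral_const_mul, ← integral_add (hw.i2.const_mul _) (i2.const_mul _)]
      apply integral_mono (i1.const_mul _) ((hw.i2.const_mul _).add (i2.const_mul _))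
      intro z
      show (k:ℝ) ^ 2 * v z ^ 2 ≤ 2 * w z ^ 2 + 2 * (w z - k * v z) ^ 2
      nlinarith [sq_nonneg (2 * w z - k * v z)]
    have h4 := poincare' hw
    have h5 : (k:ℝ) * 8 ≤ k ^ 2 * ε := by
      rw [div_lt_iff₀ hε] at hk; nlinarith
    have h6 : (k:ℝ) ^ 2 * (∫ z, v z ^ 2) ≤ k ^ 2 * ε := by nlinarith
    rw [zero_add]
    exact le_of_mul_le_mul_left h6 (by positivity)
  have h0 : ∫ z, v z ^ 2 = 0 := le_antisymm (le_of_forall_pos_le_add key) (integral_nonneg fun _ => sq_nonneg _)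
  have hz := (integral_eq_zero_iff_of_nonneg (fun _ => sq_nonneg _) i1).1 h0
  filter_upwards [hz] with z hz
  simpa using hz

lemma cut_pair {u ψ : ℂ → ℝ} (hu : TestOn (SH 1) u) (hψ : ContDiff ℝ ∞ ψ) (h0 : ∀ z, 0 ≤ ψ z) (h1 : ∀ z, ψ z ≤ 1)
    {M κ : ℝ} (hM : ∀ z, ‖fderiv ℝ ψ z‖ ≤ M) (hκ : 0 < κ) :
    En (fun z => ψ z * u z) + En (fun z => (1 - ψ z) * u z) ≤ (1 + κ) * En u + 2 * ((1 + 1 / κ) * M ^ 2) * ∫ z, u z ^ 2 := by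
  have hψ' : ContDiff ℝ ∞ (fun z => 1 - ψ z) := contDiff_const.sub hψ
  have t1 := hu.mul hψ
  have t2 := hu.mul hψ'
  have i1 : Integrable fun z => (1 + κ) * ‖fderiv ℝ u z‖ ^ 2 := hu.iE.const_mul _
  have i2 : Integrable fun z => 2 * ((1 + 1 / κ) * M ^ 2) * u z ^ 2 := hu.i2.const_mul _
  have dψ : ∀ z, DifferentiableAt ℝ ψ z := fun z => hψ.differentiable (by simp) z
  rw [En, En, En, ← integral_const_mul, ← integral_const_mul, ← integral_add t1.iE t2.iE, ← integral_add i1 i2]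
  apply integral_mono (t1.iE.add t2.iE) (i1.add i2)
  intro z
  show ‖fderiv ℝ (fun z => ψ z * u z) z‖ ^ 2 + ‖fderiv ℝ (fun z => (1 - ψ z) * u z) z‖ ^ 2 ≤
    (1 + κ) * ‖fderiv ℝ u z‖ ^ 2 + 2 * ((1 + 1 / κ) * M ^ 2) * u z ^ 2
  have a1 := fderiv_mul_sq (dψ z) (hu.diff z) hκ
  have a2 := fderiv_mul_sq (ψ := fun z => 1 - ψ z) ((dψ z).const_sub 1) (hu.diff z) hκ
  rw [fderiv_const_sub, norm_neg] at a2
  set X := ‖fderiv ℝ u z‖ ^ 2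
  have X0 : 0 ≤ X := by positivity
  have b1 : ‖fderiv ℝ ψ z‖ ^ 2 ≤ M ^ 2 := by have := hM z; gcongr
  have b2 : u z ^ 2 * ‖fderiv ℝ ψ z‖ ^ 2 ≤ u z ^ 2 * M ^ 2 := by gcongr
  have b3 : (1 + 1 / κ) * (u z ^ 2 * ‖fderiv ℝ ψ z‖ ^ 2) ≤ (1 + 1 / κ) * (u z ^ 2 * M ^ 2) := by gcongr
  have b4 : ψ z ^ 2 * X + (1 - ψ z) ^ 2 * X ≤ X := by
    have : ψ z ^ 2 + (1 - ψ z) ^ 2 ≤ 1 := by nlinarith [h0 z, h1 z]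
    nlinarith
  have b5 := mul_le_mul_of_nonneg_left b4 (show 0 ≤ 1 + κ by positivity)
  nlinarith

lemma nu_tendsto {V : Set ℂ} {g : ℕ → ℂ → ℝ} (hg : ∀ n, TestOn V (g n))
    (hae : ∀ᵐ w, w ∈ Metric.ball (0:ℂ) 1 → Tendsto (fun n => g n w) atTop (𝓝 0)) {t : ℝ} (ht : 0 < t) :
    Tendsto (fun n => nu (g n) t) atTop (𝓝 0) := by
  set μ := volume.restrict (Metric.ball (0:ℂ) 1)
  haveI : IsFiniteMeasure μ := ⟨by simp only [μ, Measure.restrict_apply_univ]; exact measure_ball_lt_top⟩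
  have h1 : TendstoInMeasure μ g atTop (fun _ => 0) := by
    apply tendstoInMeasure_of_tendsto_ae (fun n => (hg n).cont.aestronglyMeasurable)
    exact (ae_restrict_iff' measurableSet_ball).2 hae
  have h2 := tendstoInMeasure_iff_norm.1 h1 t ht
  have h3 := (ENNReal.tendsto_toReal (by simp)).comp h2
  refine h3.congr fun n => ?_
  simp only [Function.comp, nu, Measure.real, sub_zero, norm_eq_abs]
  rw [Measure.restrict_apply (measurableSet_le measurable_const (hg n).cont.measurable.abs), inter_comm]

lemma Conf.pull_ae {U V : Set ℂ} {f φ : ℂ → ℂ} (h : Conf U V f φ) {P : ℂ → Prop} (hP : ∀ᵐ z, P z) :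
    ∀ᵐ w, w ∈ V → P (f w) := by
  have h1 : volume ({z | ¬ P z} ∩ U) = 0 := measure_mono_null inter_subset_left hP
  have h2 : volume (φ '' ({z | ¬ P z} ∩ U)) = 0 := by
    apply addHaar_image_eq_zero_of_differentiableOn_of_addHaar_eq_zero volume _ h1
    exact ((h.pd.mono inter_subset_right).restrictScalars ℝ)
  rw [ae_iff]
  refine measure_mono_null ?_ h2
  intro w hw
  simp only [mem_ofPred_eq, Classical.not_imp] at hw
  exact ⟨f w, ⟨hw.2, h.fm hw.1⟩, h.pf w hw.1⟩

/-- good conformal charts -/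
lemma chart {H Λ : ℝ} (hH : 0 < H) (hΛ : 4 * H / π < Λ) {z0 : ℂ} (hz0 : z0 ∈ SH H) :
    ∃ f φ : ℂ → ℂ, Conf (SH H) (Metric.ball 0 1) f φ ∧ ∃ r : ℝ, 0 < r ∧ Metric.ball z0 r ⊆ SH H ∧
      ∀ z ∈ Metric.ball z0 r, ‖deriv f (φ z)‖ ≤ Λ := by
  set l := π / (2 * H) with hl
  have l0 : 0 < l := by positivity
  set a := Complex.exp (l * z0) with ha
  have a0 : 0 < a.re := exp_re_pos hH hl hz0
  have an : a ≠ 0 := Complex.exp_ne_zero _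
  have hc := conf_strip hH hl a0
  set g : ℂ → ℂ := fun w => ((starRingEnd ℂ) a / (a + (starRingEnd ℂ) a * w) + 1 / (1 - w)) / l with hg
  have p0 : phimap l a z0 = 0 := by simp [phimap, ha]
  have gc : ContinuousAt g 0 := by
    apply ContinuousAt.div_const
    apply ContinuousAt.add
    · apply ContinuousAt.div continuousAt_const (by fun_prop)
      simpa using an
    · apply ContinuousAt.div continuousAt_const (by fun_prop)
      simp
  have pc : ContinuousAt (phimap l a) z0 := hc.pd.continuousOn.continuousAt (hc.oU.mem_nhds hz0)
  have cc : ContinuousAt (fun z => ‖g (phimap l a z)‖) z0 := by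
    apply ContinuousAt.norm
    apply ContinuousAt.comp (g := g) _ pc
    rw [p0]; exact gc
  have b : ‖g (phimap l a z0)‖ < Λ := by
    rw [p0]
    refine lt_of_le_of_lt ?_ hΛ
    simp only [hg, mul_zero, add_zero, sub_zero, div_one]
    rw [norm_div, Complex.norm_real, norm_eq_abs, abs_of_pos l0]
    have h1 : ‖(starRingEnd ℂ) a / a + 1‖ ≤ 2 := by
      refine (norm_add_le _ _).trans ?_
      rw [norm_div, Complex.norm_conj, div_self (norm_ne_zero_iff.2 an), norm_one]; norm_num
    rw [div_le_iff₀ l0, hl]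
    refine h1.trans (le_of_eq ?_)
    field_simp; norm_num
  have ev := (cc.eventually (gt_mem_nhds b)).and (hc.oU.mem_nhds hz0)
  obtain ⟨r, r0, hr⟩ := Metric.eventually_nhds_iff_ball.1 ev
  refine ⟨fmap l a, phimap l a, hc, r, r0, fun z hz => (hr z hz).2, fun z hz => ?_⟩
  obtain ⟨h1, h2⟩ := hr z hz
  rw [(fmap_deriv a0 (hc.pm h2)).deriv]
  exact h1.le

lemma conc {H Λ : ℝ} {f φ : ℂ → ℂ} (hc : Conf (SH H) (Metric.ball 0 1) f φ) (h1H : 1 ≤ H) {B : Set ℂ} (mB : MeasurableSet B) (hB : B ⊆ SH H)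
    (hΛ : ∀ z ∈ B, ‖deriv f (φ z)‖ ≤ Λ) {u : ℕ → ℂ → ℝ} (hu : ∀ n, TestOn (SH 1) (u n)) (hE : ∀ n, En (u n) ≤ 1)
    (hae : ∀ᵐ z, Tendsto (fun n => u n z) atTop (𝓝 0)) {ε : ℝ} (hε : 0 < ε) :
    ∀ᶠ n in atTop, ∫ z in B, (exp (4 * π * u n z ^ 2) - 1) ≤ Λ ^ 2 * (π * (exp 1 + ε)) := by
  obtain ⟨t0, t0p, η, η0, hd⟩ := DTest.disc_cc ε hε
  have hsub : SH 1 ⊆ SH H := fun z hz => lt_of_lt_of_le (show |z.im| < 1 from hz) h1H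
  have hu' : ∀ n, TestOn (SH H) (u n) := fun n => (hu n).mono hsub
  have hp : ∀ n, TestOn (Metric.ball 0 1) (Conf.pull (Metric.ball 0 1) f (u n)) := fun n => hc.pull_test (hu' n)
  have hnu := nu_tendsto hp (by
    filter_upwards [hc.pull_ae hae] with w hw hwb
    have := hw hwb
    refine this.congr fun n => ?_
    rw [Conf.pull_apply hwb]) t0p
  filter_upwards [hnu.eventually (gt_mem_nhds η0)] with n hn
  have key := hd _ (hp n).dtest (by rw [hc.pull_energy (hu' n)]; exact hE n) hn.le
  refine le_trans ?_ (mul_le_mul_of_nonneg_left key (sq_nonneg Λ))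
  have e1 : ∫ z in B, (exp (4 * π * u n z ^ 2) - 1) = ∫ z in SH H, B.indicator (fun z => exp (4 * π * u n z ^ 2) - 1) z := by
    rw [integral_indicator mB, Measure.restrict_restrict mB, inter_eq_left.2 hB]
  rw [e1, hc.integral, ← integral_const_mul]
  apply integral_mono_of_nonneg
  · exact ae_of_all _ fun w => mul_nonneg (sq_nonneg _) (indicator_nonneg (fun _ _ => ae_nn _) _)
  · exact ((hp n).iF _).restrict.const_mul _
  · refine (ae_restrict_iff' measurableSet_ball).2 (ae_of_all _ fun w hw => ?_)
    show ‖deriv f w‖ ^ 2 * B.indicator (fun z => exp (4 * π * u n z ^ 2) - 1) (f w) ≤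
      Λ ^ 2 * (exp (4 * π * Conf.pull (Metric.ball 0 1) f (u n) w ^ 2) - 1)
    rw [Conf.pull_apply hw]
    by_cases hfw : f w ∈ B
    · rw [indicator_of_mem hfw]
      have := hΛ _ hfw
      rw [hc.pf w hw] at this
      exact mul_le_mul_of_nonneg_right (by gcongr) (ae_nn _)
    · rw [indicator_of_notMem hfw, mul_zero]
      exact mul_nonneg (sq_nonneg _) (ae_nn _)

lemma bump_bound {z0 : ℂ} (f : ContDiffBump z0) : ∃ M : ℝ, ∀ z, ‖fderiv ℝ f z‖ ≤ M := by
  have h1 : HasCompactSupport (fderiv ℝ f) := f.hasCompactSupport.fderiv (𝕜 := ℝ)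
  have h2 : Continuous (fderiv ℝ f) := (f.contDiff (n := 1)).continuous_fderiv (by simp)
  exact h1.exists_bound_of_continuous h2

lemma MaxSeq.caseB_aux {S : ℝ} {u v c} (s : MaxSeq S u v c) (h : MTB S) (S0 : 0 < S) (hv : ∀ᵐ z, v z = 0)
    {H Λ ε d : ℝ} (h1H : 1 < H) (hΛ : 4 * H / π < Λ) (hε : 0 < ε) (d0 : 0 < d) (d1 : d ≤ 1 / 3) :
    S ≤ Λ ^ 2 * (π * (exp 1 + ε)) + 3 * d * S := by
  have hae : ∀ᵐ z, Tendsto (fun n => u n z) atTop (𝓝 0) := by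
    filter_upwards [hv, s.ae] with z h1 h2
    rwa [h1] at h2
  have hl2 : Tendsto (fun n => ∫ z, u n z ^ 2) atTop (𝓝 0) := by
    refine s.l2.congr fun n => integral_congr_ae ?_
    filter_upwards [hv] with z hz
    simp [hz]
  obtain ⟨K, K0, hK⟩ := s.split h (show 0 < S / 4 by positivity)
  -- charts
  have hch : ∀ z0 : ℂ, z0 ∈ SH H → ∃ f φ : ℂ → ℂ, Conf (SH H) (Metric.ball 0 1) f φ ∧ ∃ r : ℝ, 0 < r ∧ Metric.ball z0 r ⊆ SH H ∧
      ∀ z ∈ Metric.ball z0 r, ‖deriv f (φ z)‖ ≤ Λ := fun z0 hz0 => chart (by linarith) hΛ hz0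
  choose! f φ hconf r r0 hr hrΛ using hch
  set T : Set ℂ := {z | |z.re| ≤ K ∧ |z.im| ≤ 1} with hT
  have Tc : IsCompact T := by
    apply Metric.isCompact_of_isClosed_isBounded
    · exact (isClosed_le (Complex.continuous_re.abs) continuous_const).inter (isClosed_le (Complex.continuous_im.abs) continuous_const)
    · refine (Metric.isBounded_closedBall (x := (0:ℂ)) (r := K + 1)).subset fun z hz => ?_
      rw [mem_closedBall_zero_iff]
      exact (Complex.norm_le_abs_re_add_abs_im z).trans (by linarith [hz.1, hz.2])
  have TH : ∀ z ∈ T, z ∈ SH H := fun z hz => lt_of_le_of_lt hz.2 h1H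
  obtain ⟨t, htT, hcov⟩ := Tc.elim_nhds_subcover (fun z => Metric.ball z (r z / 2)) fun z hz =>
    Metric.ball_mem_nhds _ (by have := r0 z (TH z hz); linarith)
  -- bump functions
  have hbump : ∀ z ∈ T, ∃ ψ : ℂ → ℝ, ContDiff ℝ ∞ ψ ∧ (∀ x, 0 ≤ ψ x) ∧ (∀ x, ψ x ≤ 1) ∧ (∃ M, ∀ x, ‖fderiv ℝ ψ x‖ ≤ M) ∧
      (∀ x ∈ Metric.ball z (r z / 2), ψ x = 1) ∧ ∀ x, x ∉ Metric.ball z (r z) → ψ x = 0 := by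
    intro z hz
    have rp := r0 z (TH z hz)
    let b : ContDiffBump z := ⟨r z / 2, r z, by linarith, by linarith⟩
    refine ⟨b, b.contDiff, fun x => b.nonneg, fun x => b.le_one, bump_bound b, fun x hx => ?_, fun x hx => ?_⟩
    · exact b.one_of_mem_closedBall (Metric.ball_subset_closedBall hx)
    · exact b.zero_of_le_dist (by simpa using hx)
  choose! ψ ψs ψ0 ψ1 ψM ψin ψout using hbump
  by_cases hall : ∀ z ∈ t, ∀ᶠ n in atTop, En (fun x => ψ z x * u n x) ≤ 1 - d
  · -- no concentration
    exfalso
    have loc : ∀ z ∈ t, ∀ᶠ n in atTop, ∫ x in Metric.ball z (r z / 2), (exp (4 * π * u n x ^ 2) - 1) ≤ S / (4 * (t.card + 1)) := by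
      intro z hz
      have hzT := htT z hz
      have lp : ∀ᶠ n in atTop, ∫ x in Metric.ball z (r z / 2), exp (4 * π * (1 + d / 3) * u n x ^ 2) ≤
          exp (4 * π * (1 + d / 3) * (1 + 1 / (d / 3)) * 0) * (S + volume.real (Metric.ball z (r z / 2))) := by
        filter_upwards [hall z hz] with n hn
        apply h.lp measurableSet_ball measure_ball_lt_top.ne (s.test n) ((s.test n).mul (ψs z hzT)) (by linarith) (by positivity)
        · intro x hx
          rw [ψin z hzT x hx]; simp
        · refine (mul_le_mul_of_nonneg_left hn (by positivity)).trans ?_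
          nlinarith [mul_pos d0 d0, mul_pos d0 (mul_pos d0 d0)]
      have vt := vitali (v := fun _ => 0) measure_ball_lt_top.ne s.test measurable_const hae (by simp) (by linarith : 1 < 1 + d / 3) lp
        (show 0 < S / (4 * (t.card + 1)) by positivity)
      simpa using vt
    have hall' := (t.eventually_all).2 loc
    have hlim := s.lim.eventually (lt_mem_nhds (show S * (3 / 4) < S by linarith))
    obtain ⟨n, h1, h2, h3⟩ := (hall'.and (hK.and hlim)).exists
    have h4 : ∫ z in QK K, (exp (4 * π * u n z ^ 2) - 1) ≤ ∑ z ∈ t, ∫ x in Metric.ball z (r z / 2), (exp (4 * π * u n x ^ 2) - 1) := by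
      have i := (s.test n).iF (4 * π)
      have hsub : QK K ⊆ ⋃ z ∈ t, Metric.ball z (r z / 2) := fun z hz => hcov ⟨hz.1.le, hz.2.le⟩
      have i2 : ∀ z ∈ t, Integrable ((Metric.ball z (r z / 2)).indicator fun x => Real.exp (4 * π * u n x ^ 2) - 1) := fun z _ => i.indicator measurableSet_ball
      calc ∫ z in QK K, (Real.exp (4 * π * u n z ^ 2) - 1) = ∫ z, (QK K).indicator (fun z => Real.exp (4 * π * u n z ^ 2) - 1) z :=
            (integral_indicator (QK_meas K)).symm
        _ ≤ ∫ x, ∑ z ∈ t, (Metric.ball z (r z / 2)).indicator (fun x => Real.exp (4 * π * u n x ^ 2) - 1) x := by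
            apply integral_mono (i.indicator (QK_meas K)) (integrable_finsetSum t i2)
            intro x
            by_cases hx : x ∈ QK K
            · have := hsub hx
              simp only [mem_iUnion] at this
              obtain ⟨z, hz, hxz⟩ := this
              simp only [indicator_of_mem hx]
              refine le_trans ?_ (Finset.single_le_sum (f := fun z => (Metric.ball z (r z / 2)).indicator (fun x => Real.exp (4 * π * u n x ^ 2) - 1) x)
                (fun z _ => indicator_nonneg (fun _ _ => ae_nn _) _) hz)
              simp only [indicator_of_mem hxz]; exact le_rfl
            · simp only [indicator_of_notMem hx]
              exact Finset.sum_nonneg fun z _ => indicator_nonneg (fun _ _ => ae_nn _) _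
        _ = _ := by
            rw [integral_finsetSum t i2]
            exact Finset.sum_congr rfl fun z _ => integral_indicator measurableSet_ball
    have h5 : ∑ z ∈ t, ∫ x in Metric.ball z (r z / 2), (Real.exp (4 * π * u n x ^ 2) - 1) ≤ t.card * (S / (4 * (t.card + 1))) := by
      have := Finset.sum_le_sum h1
      simpa using this
    have h6 : (t.card : ℝ) * (S / (4 * (t.card + 1))) ≤ S / 4 := by
      have e : (t.card : ℝ) * (S / (4 * (t.card + 1))) = (S / 4) * (t.card / (t.card + 1)) := by field_simp
      rw [e]
      have : (t.card : ℝ) / (t.card + 1) ≤ 1 := by rw [div_le_one (by positivity)]; linarith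
      nlinarith
    linarith
  · -- concentration at `z`
    push Not at hall
    obtain ⟨z, hz, hfreq⟩ := hall
    have hzT := htT z hz
    have hzH := TH z hzT
    obtain ⟨M, hM⟩ := ψM z hzT
    have hcc := conc (hconf z hzH) h1H.le measurableSet_ball (hr z hzH) (hrΛ z hzH) s.test s.en hae hε
    have hsm : Tendsto (fun n => 2 * ((1 + 1 / d) * M ^ 2) * ∫ z, u n z ^ 2) atTop (𝓝 0) := by
      simpa using hl2.const_mul (2 * ((1 + 1 / d) * M ^ 2))
    refine le_of_forall_pos_le_add fun η η0 => ?_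
    have hlim := s.lim.eventually (lt_mem_nhds (show S - η < S by linarith))
    obtain ⟨n, h1, h2, h3, h4⟩ := (hfreq.and_eventually (hcc.and ((hsm.eventually (gt_mem_nhds d0)).and hlim))).exists
    have cp := cut_pair (s.test n) (ψs z hzT) (ψ0 z hzT) (ψ1 z hzT) hM d0
    have hEn := mul_le_mul_of_nonneg_left (s.en n) (show 0 ≤ 1 + d by linarith)
    have e3 : En (fun x => (1 - ψ z x) * u n x) ≤ 3 * d := by linarith
    have t2 := (s.test n).mul (contDiff_const.sub (ψs z hzT) : ContDiff ℝ ∞ fun x => 1 - ψ z x)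
    have F2 := h.scale t2 e3 (by linarith) (by linarith)
    have i := (s.test n).iF (4 * π)
    have e4 : Fn (u n) ≤ (∫ x in Metric.ball z (r z), (exp (4 * π * u n x ^ 2) - 1)) + Fn (fun x => (1 - ψ z x) * u n x) := by
      rw [Fn, ← integral_add_compl (measurableSet_ball (x := z) (ε := r z)) i]
      gcongr
      refine le_trans (le_of_eq ?_) (setIntegral_le_integral (s := (Metric.ball z (r z))ᶜ) (t2.iF (4 * π)) (ae_of_all _ fun _ => ae_nn _))
      apply setIntegral_congr_fun measurableSet_ball.compl
      intro x hx
      simp only [ψout z hzT x hx, sub_zero, one_mul]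
    linarith

lemma MaxSeq.caseB {S : ℝ} {u v c} (s : MaxSeq S u v c) (h : MTB S) (hS : 16 * exp 1 / π < S) : ¬ ∀ᵐ z, v z = 0 := by
  intro hv
  have S0 : 0 < S := lt_trans (by positivity) hS
  set g : ℝ → ℝ := fun ε => (4 * (1 + ε) / π + ε) ^ 2 * (π * (exp 1 + ε)) + 3 * ε * S with hg
  have gc : Continuous g := by fun_prop
  have g0 : g 0 = 16 * exp 1 / π := by simp only [hg]; field_simp; ring
  have ev := (gc.tendsto 0).eventually (gt_mem_nhds (show g 0 < S by rw [g0]; exact hS))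
  obtain ⟨δ, δ0, hδ⟩ := Metric.eventually_nhds_iff.1 ev
  set ε := min (δ / 2) (1 / 3) with hε
  have ε0 : 0 < ε := by positivity
  have h1 : g ε < S := hδ (by
    rw [dist_zero_right, norm_eq_abs, abs_of_pos ε0]
    exact lt_of_le_of_lt (min_le_left _ _) (by linarith))
  have h2 := s.caseB_aux h S0 hv (H := 1 + ε) (Λ := 4 * (1 + ε) / π + ε) (ε := ε) (d := ε) (by linarith) (by linarith) ε0 ε0 (min_le_right _ _)
  simp only [hg] at h1
  linarith

lemma image_exp_half : (fun s : ℝ => Real.exp (-s / 2)) '' Ioi 0 = Ioo 0 1 := by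
  ext r
  constructor
  · rintro ⟨s, hs, rfl⟩
    exact ⟨Real.exp_pos _, by rw [Real.exp_lt_one_iff]; have : (0:ℝ) < s := hs; linarith⟩
  · rintro ⟨h0, h1⟩
    refine ⟨-2 * Real.log r, ?_, ?_⟩
    · have := Real.log_neg h0 h1
      show (0:ℝ) < _
      linarith
    · show Real.exp (-(-2 * Real.log r) / 2) = r
      rw [show -(-2 * Real.log r) / 2 = Real.log r by ring, Real.exp_log h0]

/-- polar coordinates with logarithmic radius -/
lemma polar_exp {F : ℂ → ENNReal} (hF : Measurable F) (h0 : ∀ w, 1 ≤ ‖w‖ → F w = 0) :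
    ∫⁻ w, F w = ∫⁻ s in Ioi (0:ℝ), ENNReal.ofReal (Real.exp (-s) / 2) *
      ∫⁻ θ in Ioo (-π) π, F (((Real.exp (-s / 2) : ℝ) : ℂ) * (Real.cos θ + Real.sin θ * Complex.I)) := by
  rw [← Complex.lintegral_comp_polarCoord_symm]
  have e1 : polarCoord.target = Ioi (0:ℝ) ×ˢ Ioo (-π) π := rfl
  simp only [Complex.polarCoord_symm_apply, smul_eq_mul]
  rw [e1, Measure.volume_eq_prod, setLIntegral_prod _ (by fun_prop)]
  have hz : ∀ r ∈ Ioi (0:ℝ) \ Ioo 0 1, (∫⁻ y in Ioo (-π) π, ENNReal.ofReal r * F ((r:ℂ) * (Real.cos y + Real.sin y * Complex.I))) = 0 := by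
    rintro r ⟨hr, hr1⟩
    have hr0 : (0:ℝ) < r := hr
    have hr1 : 1 ≤ r := by by_contra hh; exact hr1 ⟨hr, not_le.1 hh⟩
    have : ∀ y : ℝ, F ((r:ℂ) * (Real.cos y + Real.sin y * Complex.I)) = 0 := by
      intro y
      apply h0
      rw [norm_mul, Complex.ofReal_cos, Complex.ofReal_sin, Complex.norm_cos_add_sin_mul_I, mul_one, Complex.norm_real, Real.norm_eq_abs, abs_of_pos hr0]
      exact hr1
    simp only [this, mul_zero, lintegral_zero]
  have : ∫⁻ r in Ioi (0:ℝ), ∫⁻ y in Ioo (-π) π, ENNReal.ofReal r * F ((r:ℂ) * (Real.cos y + Real.sin y * Complex.I))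
      = ∫⁻ r in Ioo (0:ℝ) 1, ∫⁻ y in Ioo (-π) π, ENNReal.ofReal r * F ((r:ℂ) * (Real.cos y + Real.sin y * Complex.I)) := by
    have hs : Ioi (0:ℝ) = Ioo 0 1 ∪ (Ioi 0 \ Ioo 0 1) := by
      rw [union_sdiff_cancel]; exact Ioo_subset_Ioi_self
    conv_lhs => rw [hs]
    rw [lintegral_union (measurableSet_Ioi.diff measurableSet_Ioo) disjoint_sdiff_right,
      setLIntegral_congr_fun (measurableSet_Ioi.diff measurableSet_Ioo) hz]
    simp
  rw [this, ← image_exp_half, lintegral_image_eq_lintegral_abs_deriv_mul (f' := fun s => -Real.exp (-s/2)/2) measurableSet_Ioi]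
  · apply setLIntegral_congr_fun measurableSet_Ioi
    intro s _
    beta_reduce
    rw [lintegral_const_mul _ (by fun_prop), ← mul_assoc]
    congr 1
    rw [← ENNReal.ofReal_mul (abs_nonneg _)]
    congr 1
    rw [abs_div, abs_neg, abs_of_pos (Real.exp_pos _), abs_of_pos (by norm_num : (0:ℝ)<2)]
    rw [show -s = -s/2 + -s/2 by ring, Real.exp_add]
    ring_nf
  · intro s _
    have := ((hasDerivAt_id s).neg.div_const 2).exp
    exact (this.congr_deriv (by simp; ring)).hasDerivWithinAt
  · intro a _ b _ hab
    have := Real.exp_injective hab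
    linarith

/-- mean value inequality on circles -/
lemma mean_sq_ge {h : ℂ → ℂ} (hh : DifferentiableOn ℂ h (Metric.ball 0 1)) {r : ℝ} (hr : 0 < r) (hr1 : r < 1) :
    ENNReal.ofReal (2 * π * ‖h 0‖ ^ 2) ≤ ∫⁻ θ in Ioo (-π) π, ENNReal.ofReal (‖h ((r:ℂ) * (Real.cos θ + Real.sin θ * Complex.I))‖ ^ 2) := by
  have hd : DiffContOnCl ℂ h (Metric.ball 0 |r|) := by
    apply DifferentiableOn.diffContOnCl
    rw [closure_ball _ (by positivity), abs_of_pos hr]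
    exact hh.mono (Metric.closedBall_subset_ball hr1)
  have hav := hd.circleAverage
  rw [circleAverage_eq_integral_add (-π)] at hav
  have hcm : ∀ θ : ℝ, circleMap 0 r θ = (r:ℂ) * (Real.cos θ + Real.sin θ * Complex.I) := by
    intro θ
    simp [circleMap, Complex.exp_mul_I]
  have hin : ∀ θ : ℝ, circleMap 0 r θ ∈ Metric.ball (0:ℂ) 1 := by
    intro θ
    simp [abs_of_pos hr, hr1]
  have hc : Continuous fun θ : ℝ => h (circleMap 0 r θ) :=
    hh.continuousOn.comp_continuous (continuous_circleMap 0 r) hin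
  have hitg : ∫ θ in (-π)..π, h (circleMap 0 r θ) = 2 * π * h 0 := by
    have : ∫ θ in (-π)..π, h (circleMap 0 r θ) = ∫ θ in (0:ℝ)..(2*π), h (circleMap 0 r (θ + -π)) := by
      rw [intervalIntegral.integral_comp_add_right (fun θ => h (circleMap 0 r θ))]
      congr 1 <;> ring
    rw [this, ← hav]
    rw [Complex.real_smul]
    push_cast
    rw [mul_inv_cancel_left₀]
    have := Real.pi_ne_zero
    simp [this]
  have c3 : Continuous fun θ : ℝ => 2 * ((starRingEnd ℂ (h 0)) * (h (circleMap 0 r θ) - h 0)).re :=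
    continuous_const.mul (Complex.continuous_re.comp (continuous_const.mul (hc.sub continuous_const)))
  have c4 : Continuous fun θ : ℝ => ‖h (circleMap 0 r θ)‖^2 := hc.norm.pow 2
  have hre : ∫ θ in (-π)..π, (‖h 0‖^2 + 2 * ((starRingEnd ℂ (h 0)) * (h (circleMap 0 r θ) - h 0)).re) = 2 * π * ‖h 0‖^2 := by
    have e : ∫ θ in (-π)..π, ((starRingEnd ℂ (h 0)) * (h (circleMap 0 r θ) - h 0)).re = 0 := by
      have c2 : Continuous fun θ : ℝ => (starRingEnd ℂ (h 0)) * (h (circleMap 0 r θ) - h 0) := continuous_const.mul (hc.sub continuous_const)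
      have := Complex.reCLM.intervalIntegral_comp_comm (c2.intervalIntegrable (μ := volume) (-π) π)
      simp only [Complex.reCLM_apply] at this
      rw [this, intervalIntegral.integral_const_mul, intervalIntegral.integral_sub (hc.intervalIntegrable _ _) (by simp), hitg]
      simp
      ring_nf
    rw [intervalIntegral.integral_add (by simp) (c3.intervalIntegrable _ _), intervalIntegral.integral_const_mul, e]
    simp only [intervalIntegral.integral_const, smul_eq_mul]; ring
  have hle : 2 * π * ‖h 0‖^2 ≤ ∫ θ in (-π)..π, ‖h (circleMap 0 r θ)‖^2 := by
    rw [← hre]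
    apply intervalIntegral.integral_mono_on (by linarith [Real.pi_pos])
    · exact (continuous_const.add c3).intervalIntegrable _ _
    · exact c4.intervalIntegrable _ _
    · intro θ _
      simp only [← Complex.normSq_eq_norm_sq, Complex.normSq_apply]
      simp
      nlinarith [sq_nonneg ((h (circleMap 0 r θ)).re - (h 0).re), sq_nonneg ((h (circleMap 0 r θ)).im - (h 0).im)]
  have ht : (∫⁻ θ in Ioo (-π) π, ENNReal.ofReal (‖h ((r:ℂ) * (Real.cos θ + Real.sin θ * Complex.I))‖ ^ 2))
      = ENNReal.ofReal (∫ θ in (-π)..π, ‖h (circleMap 0 r θ)‖^2) := by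
    rw [intervalIntegral.integral_of_le (by linarith [Real.pi_pos]), ← integral_Ioc_eq_integral_Ioo.symm, ofReal_integral_eq_lintegral_ofReal]
    · simp only [hcm]
    · exact c4.integrableOn_Icc.mono_set Ioo_subset_Icc_self
    · exact Eventually.of_forall fun _ => by positivity
  rw [ht]
  exact ENNReal.ofReal_le_ofReal hle

/-- admissible profiles -/
structure Prof (W : ℝ → ℝ) (a b C : ℝ) : Prop where
  sm : ContDiff ℝ ∞ W
  a0 : 0 < a
  lo : ∀ s ≤ a, W s = 0
  hi : ∀ s, b ≤ s → W s = C

open Classical in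
noncomputable def Prof.Y (W : ℝ → ℝ) (b C t : ℝ) : ℝ := if t < Real.exp (-b) then C else W (-Real.log t)

lemma Prof.Y_pos {W a b C} (h : Prof W a b C) {t : ℝ} (ht : 0 < t) : Prof.Y W b C t = W (-Real.log t) := by
  unfold Prof.Y
  split_ifs with h1
  · rw [h.hi]
    have := (Real.lt_log_iff_exp_lt (x := -b) (y := t) ht).not
    have := (Real.log_lt_iff_lt_exp ht).2 h1
    linarith
  · rfl

lemma Prof.Y_smooth {W a b C} (h : Prof W a b C) : ContDiff ℝ ∞ (Prof.Y W b C) := by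
  rw [contDiff_iff_contDiffAt]
  intro t
  rcases lt_or_ge t (Real.exp (-b)) with h1 | h1
  · apply (contDiffAt_const (c := C)).congr_of_eventuallyEq
    filter_upwards [Iio_mem_nhds h1] with x hx
    unfold Prof.Y; rw [if_pos (mem_Iio.1 hx)]
  · have ht : 0 < t := (Real.exp_pos _).trans_le h1
    have : ContDiffAt ℝ ∞ (fun t => W (-Real.log t)) t :=
      h.sm.contDiffAt.comp t (Real.contDiffAt_log.2 ht.ne').neg
    apply this.congr_of_eventuallyEq
    filter_upwards [Ioi_mem_nhds ht] with x hx
    exact h.Y_pos hx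

noncomputable def Prof.V (W : ℝ → ℝ) (b C : ℝ) (w : ℂ) : ℝ := Prof.Y W b C (w.re ^ 2 + w.im ^ 2) / √(4 * π)

lemma re_im_pos {w : ℂ} (hw : w ≠ 0) : 0 < w.re ^ 2 + w.im ^ 2 := by
  have := Complex.normSq_pos.2 hw
  rw [Complex.normSq_apply] at this
  nlinarith

lemma Prof.V_smooth {W a b C} (h : Prof W a b C) : ContDiff ℝ ∞ (Prof.V W b C) := by
  unfold Prof.V
  have h1 : ContDiff ℝ ∞ (fun w : ℂ => w.re ^ 2 + w.im ^ 2) :=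
    (Complex.reCLM.contDiff.pow 2).add (Complex.imCLM.contDiff.pow 2)
  exact (h.Y_smooth.comp h1).div_const _

lemma Prof.V_zero {W a b C} (h : Prof W a b C) {w : ℂ} (hw : Real.exp (-a/2) ≤ ‖w‖) : Prof.V W b C w = 0 := by
  have e : w.re ^ 2 + w.im ^ 2 = ‖w‖ ^ 2 := by
    rw [← Complex.normSq_eq_norm_sq, Complex.normSq_apply]; ring
  have hp : 0 < ‖w‖ := (Real.exp_pos _).trans_le hw
  unfold Prof.V
  rw [e, h.Y_pos (by positivity), h.lo, zero_div]
  rw [Real.log_pow]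
  have := (Real.le_log_iff_exp_le hp).2 hw
  push_cast
  linarith

lemma Prof.V_test {W a b C} (h : Prof W a b C) : TestOn (Metric.ball 0 1) (Prof.V W b C) := by
  have hs : tsupport (Prof.V W b C) ⊆ Metric.closedBall 0 (Real.exp (-a/2)) := by
    apply closure_minimal _ Metric.isClosed_closedBall
    intro w hw
    by_contra hh
    simp only [Metric.mem_closedBall, dist_zero_right, not_le] at hh
    exact hw (h.V_zero hh.le)
  refine ⟨h.V_smooth, (isCompact_closedBall 0 _).of_isClosed_subset (isClosed_tsupport _) hs, hs.trans ?_⟩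
  apply Metric.closedBall_subset_ball
  rw [Real.exp_lt_one_iff]
  have := h.a0
  linarith

lemma Prof.V_fderiv {W a b C} (h : Prof W a b C) {w : ℂ} (hw : w ≠ 0) :
    ‖fderiv ℝ (Prof.V W b C) w‖ ^ 2 = (deriv W (-Real.log (‖w‖ ^ 2))) ^ 2 / (π * ‖w‖ ^ 2) := by
  have e : w.re ^ 2 + w.im ^ 2 = ‖w‖ ^ 2 := by
    rw [← Complex.normSq_eq_norm_sq, Complex.normSq_apply]; ring
  have hp := re_im_pos hw
  have h1 : HasFDerivAt (fun w : ℂ => w.re ^ 2 + w.im ^ 2) ((2 * w.re) • Complex.reCLM + (2 * w.im) • Complex.imCLM) w := by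
    have a1 := (Complex.reCLM.hasFDerivAt (x := w)).pow 2
    have a2 := (Complex.imCLM.hasFDerivAt (x := w)).pow 2
    have := a1.add a2
    refine this.congr_fderiv ?_
    ext <;> simp
  have h2 : HasDerivAt (Prof.Y W b C) (deriv W (-Real.log (w.re ^ 2 + w.im ^ 2)) * (-(w.re ^ 2 + w.im ^ 2)⁻¹)) (w.re ^ 2 + w.im ^ 2) := by
    have d := (h.sm.differentiable (by simp)).differentiableAt (x := -Real.log (w.re ^ 2 + w.im ^ 2)) |>.hasDerivAt
    have := HasDerivAt.comp (h := fun t => -Real.log t) (w.re ^ 2 + w.im ^ 2) d (Real.hasDerivAt_log hp.ne').neg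
    apply this.congr_of_eventuallyEq
    filter_upwards [Ioi_mem_nhds hp] with x hx
    exact h.Y_pos hx
  have h3 : HasFDerivAt (Prof.V W b C) ((√(4 * π))⁻¹ • ((deriv W (-Real.log (w.re ^ 2 + w.im ^ 2)) * (-(w.re ^ 2 + w.im ^ 2)⁻¹)) • ((2 * w.re) • Complex.reCLM + (2 * w.im) • Complex.imCLM))) w := by
    have := (h2.comp_hasFDerivAt w h1).const_smul (√(4 * π))⁻¹
    refine this.congr_of_eventuallyEq (Eventually.of_forall fun z => ?_)
    simp [Prof.V, div_eq_inv_mul]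
  rw [h3.fderiv, clm_norm_sq, ← e]
  have hpi := Real.pi_pos
  have hs : ((√(4 * π))⁻¹) ^ 2 = 1 / (4 * π) := by
    rw [inv_pow, Real.sq_sqrt (by positivity), one_div]
  generalize (√(4 * π))⁻¹ = k at hs ⊢
  generalize deriv W _ = D
  simp only [ContinuousLinearMap.smul_apply, ContinuousLinearMap.add_apply, Complex.reCLM_apply, Complex.imCLM_apply,
    Complex.one_re, Complex.one_im, Complex.I_re, Complex.I_im, smul_eq_mul]
  rw [show (k * (D * -(w.re ^ 2 + w.im ^ 2)⁻¹ * (2 * w.re * 1 + 2 * w.im * 0))) ^ 2 +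
    (k * (D * -(w.re ^ 2 + w.im ^ 2)⁻¹ * (2 * w.re * 0 + 2 * w.im * 1))) ^ 2
    = k ^ 2 * D ^ 2 * ((w.re ^ 2 + w.im ^ 2)⁻¹) ^ 2 * (4 * (w.re ^ 2 + w.im ^ 2)) by ring, hs]
  generalize w.re ^ 2 + w.im ^ 2 = t at hp
  field_simp

lemma polar_norm (s θ : ℝ) : ‖((Real.exp (-s / 2) : ℝ) : ℂ) * (Real.cos θ + Real.sin θ * Complex.I)‖ = Real.exp (-s / 2) := by
  rw [norm_mul, Complex.ofReal_cos, Complex.ofReal_sin, Complex.norm_cos_add_sin_mul_I, mul_one, Complex.norm_real,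
    Real.norm_eq_abs, abs_of_pos (Real.exp_pos _)]

lemma exp_half_sq (s : ℝ) : Real.exp (-s / 2) ^ 2 = Real.exp (-s) := by
  rw [← Real.exp_nat_mul]; congr 1; push_cast; ring

lemma Prof.V_energy {W a b C} (h : Prof W a b C) :
    ENNReal.ofReal (En (Prof.V W b C)) = ∫⁻ s in Ioi (0:ℝ), ENNReal.ofReal (deriv W s ^ 2) := by
  have ht := h.V_test
  rw [En, ofReal_integral_eq_lintegral_ofReal ht.iE (Eventually.of_forall fun _ => by positivity),
    polar_exp (F := fun z => ENNReal.ofReal (‖fderiv ℝ (Prof.V W b C) z‖ ^ 2)) (by have := (ht.contd.norm.pow 2).measurable; exact ENNReal.measurable_ofReal.comp this)]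
  · apply setLIntegral_congr_fun measurableSet_Ioi
    intro s _
    beta_reduce
    have : ∀ θ : ℝ, ENNReal.ofReal (‖fderiv ℝ (Prof.V W b C) (((Real.exp (-s / 2) : ℝ) : ℂ) * (Real.cos θ + Real.sin θ * Complex.I))‖ ^ 2)
        = ENNReal.ofReal (deriv W s ^ 2 / (π * Real.exp (-s))) := by
      intro θ
      rw [h.V_fderiv, polar_norm, exp_half_sq, Real.log_exp, neg_neg]
      rw [← norm_pos_iff, polar_norm]
      exact Real.exp_pos _
    simp only [this]
    rw [setLIntegral_const, Real.volume_Ioo, ← ENNReal.ofReal_mul (by positivity), ← ENNReal.ofReal_mul (by positivity)]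
    congr 1
    have := Real.pi_pos
    have := Real.exp_pos (-s)
    field_simp
    ring
  · intro w hw
    rw [ht.dU (by simpa using hw)]
    simp

lemma Prof.bound {W a b C S} (h : Prof W a b C) (hS : MTB S)
    (hE : ∫⁻ s in Ioi (0:ℝ), ENNReal.ofReal (deriv W s ^ 2) ≤ 1) :
    ∫⁻ s in Ioi (0:ℝ), ENNReal.ofReal ((Real.exp (W s ^ 2) - 1) * Real.exp (-s)) ≤ ENNReal.ofReal (π * S / 16) := by
  have hc : Conf (SH 1) (Metric.ball 0 1) (fmap (π/2) 1) (phimap (π/2) 1) := conf_strip one_pos (by norm_num) (by simp)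
  set f := fmap (π/2) 1 with hf
  set V := Prof.V W b C with hV
  have ht : TestOn (Metric.ball 0 1) V := h.V_test
  have hu := hc.symm.pull_test ht
  have hen : En (Conf.pull (SH 1) (phimap (π/2) 1) V) ≤ 1 := by
    have : En (Conf.pull (SH 1) (phimap (π/2) 1) V) = En V := hc.symm.pull_energy ht
    rw [this]
    have := h.V_energy
    rw [← this] at hE
    rwa [ENNReal.ofReal_le_one] at hE
  have hF := hS _ hu hen
  set K := Metric.closedBall (0:ℂ) (Real.exp (-a/2)) with hK
  have hKb : K ⊆ Metric.ball 0 1 := by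
    apply Metric.closedBall_subset_ball
    rw [Real.exp_lt_one_iff]
    have := h.a0
    linarith
  have hFn : Fn (Conf.pull (SH 1) (phimap (π/2) 1) V) = ∫ w in K, ‖deriv f w‖ ^ 2 * (Real.exp (4 * π * V w ^ 2) - 1) := by
    rw [Fn, ← setIntegral_eq_integral_of_forall_compl_eq_zero (s := SH 1), hc.integral]
    · rw [setIntegral_eq_of_subset_of_forall_sdiff_eq_zero Metric.isOpen_ball.measurableSet hKb]
      · apply setIntegral_congr_fun Metric.isClosed_closedBall.measurableSet
        intro w hw
        beta_reduce
        rw [Conf.pull_apply (hc.fm (hKb hw)), hc.pf _ (hKb hw)]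
      · rintro w ⟨hw, hwK⟩
        rw [Conf.pull_apply (hc.fm hw), hc.pf _ hw, hV, h.V_zero]
        · simp
        · simp only [hK, Metric.mem_closedBall, dist_zero_right, not_le] at hwK
          exact hwK.le
    · intro z hz
      rw [hu.zU hz]; simp
  have hdd : DifferentiableOn ℂ (deriv f) (Metric.ball 0 1) := hc.fd.deriv hc.oV
  have hi : IntegrableOn (fun w => ‖deriv f w‖ ^ 2 * (Real.exp (4 * π * V w ^ 2) - 1)) K := by
    apply ContinuousOn.integrableOn_compact (isCompact_closedBall _ _)
    apply ((hdd.continuousOn.mono hKb).norm.pow 2).mul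
    have := ht.cont
    fun_prop
  rw [hFn] at hF
  have hF2 := ENNReal.ofReal_le_ofReal hF
  rw [ofReal_integral_eq_lintegral_ofReal hi (Eventually.of_forall fun w => mul_nonneg (by positivity) (ae_nn _)),
    ← lintegral_indicator Metric.isClosed_closedBall.measurableSet, polar_exp] at hF2
  · have key : ∀ s ∈ Ioi (0:ℝ), ENNReal.ofReal (16 / π) * ENNReal.ofReal ((Real.exp (W s ^ 2) - 1) * Real.exp (-s)) ≤
        ENNReal.ofReal (Real.exp (-s) / 2) * ∫⁻ θ in Ioo (-π) π, K.indicator (fun w => ENNReal.ofReal (‖deriv f w‖ ^ 2 * (Real.exp (4 * π * V w ^ 2) - 1))) (((Real.exp (-s / 2) : ℝ) : ℂ) * (Real.cos θ + Real.sin θ * Complex.I)) := by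
      intro s hs
      have hs : (0:ℝ) < s := hs
      rcases lt_or_ge s a with hsa | hsa
      · rw [h.lo s hsa.le]; simp
      have hV' : ∀ θ : ℝ, V (((Real.exp (-s / 2) : ℝ) : ℂ) * (Real.cos θ + Real.sin θ * Complex.I)) = W s / √(4 * π) := by
        intro θ
        set w := (((Real.exp (-s / 2) : ℝ) : ℂ) * (Real.cos θ + Real.sin θ * Complex.I)) with hw
        have e : w.re ^ 2 + w.im ^ 2 = Real.exp (-s) := by
          rw [← exp_half_sq, ← polar_norm s θ, ← hw, ← Complex.normSq_eq_norm_sq, Complex.normSq_apply]; ring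
        rw [hV, Prof.V, e, h.Y_pos (Real.exp_pos _), Real.log_exp, neg_neg]
      have hsq : 4 * π * (W s / √(4 * π)) ^ 2 = W s ^ 2 := by
        rw [div_pow, Real.sq_sqrt (by positivity)]
        have := Real.pi_pos
        field_simp
      have hind : ∀ θ : ℝ, K.indicator (fun w => ENNReal.ofReal (‖deriv f w‖ ^ 2 * (Real.exp (4 * π * V w ^ 2) - 1))) (((Real.exp (-s / 2) : ℝ) : ℂ) * (Real.cos θ + Real.sin θ * Complex.I))
          = ENNReal.ofReal (Real.exp (W s ^ 2) - 1) * ENNReal.ofReal (‖deriv f (((Real.exp (-s / 2) : ℝ) : ℂ) * (Real.cos θ + Real.sin θ * Complex.I))‖ ^ 2) := by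
        intro θ
        rw [indicator_of_mem, hV', hsq, ENNReal.ofReal_mul (by positivity), mul_comm]
        rw [hK, Metric.mem_closedBall, dist_zero_right, polar_norm]
        apply Real.exp_le_exp.2; linarith
      simp only [hind]
      rw [lintegral_const_mul _ (by have := measurable_deriv f; fun_prop)]
      have m := mean_sq_ge hdd (Real.exp_pos (-s/2)) (by rw [Real.exp_lt_one_iff]; linarith)
      have d0 : ‖deriv f 0‖ ^ 2 = 16 / π ^ 2 := by
        rw [hf, (fmap_deriv (l := π/2) (a := 1) (by simp) (w := 0) (by simp)).deriv]
        simp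
        rw [abs_of_pos Real.pi_pos]
        have := Real.pi_pos
        norm_num
        field_simp
        norm_num
      rw [d0] at m
      have nn : 0 ≤ Real.exp (W s ^ 2) - 1 := by linarith [Real.one_le_exp (sq_nonneg (W s))]
      calc _ = ENNReal.ofReal (Real.exp (-s) / 2) * (ENNReal.ofReal (Real.exp (W s ^ 2) - 1) * ENNReal.ofReal (2 * π * (16 / π ^ 2))) := by
            rw [← ENNReal.ofReal_mul (by positivity), ← ENNReal.ofReal_mul nn, ← ENNReal.ofReal_mul (by positivity)]
            congr 1
            have := Real.pi_pos
            field_simp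
        _ ≤ _ := by gcongr
    have h2 := (setLIntegral_mono' measurableSet_Ioi key).trans hF2
    rw [lintegral_const_mul' _ _ ENNReal.ofReal_ne_top] at h2
    have hpi := Real.pi_pos
    calc _ = ENNReal.ofReal (π / 16) * (ENNReal.ofReal (16 / π) * ∫⁻ s in Ioi (0:ℝ), ENNReal.ofReal ((Real.exp (W s ^ 2) - 1) * Real.exp (-s))) := by
          rw [← mul_assoc, ← ENNReal.ofReal_mul (by positivity), show π / 16 * (16 / π) = 1 by field_simp]
          simp
      _ ≤ ENNReal.ofReal (π / 16) * ENNReal.ofReal S := by gcongr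
      _ = _ := by
          rw [← ENNReal.ofReal_mul (by positivity)]
          congr 1; ring
  · apply Measurable.indicator _ Metric.isClosed_closedBall.measurableSet
    have := measurable_deriv f
    have := ht.cont.measurable
    fun_prop
  · intro w hw
    apply indicator_of_notMem
    intro hh
    have := hKb hh
    simp at this
    linarith

lemma eLp_two {f : ℝ → ℝ} (hf : MemLp f 2 volume) : eLpNorm f 2 volume = ENNReal.ofReal (√(∫ x, f x ^ 2)) := by
  rw [hf.eLpNorm_eq_integral_rpow_norm (by norm_num) (by norm_num)]
  congr 1
  simp [Real.sqrt_eq_rpow]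

/-- one approximating profile -/
lemma prof_mk {g : ℝ → ℝ} (hg : ContDiff ℝ ∞ g) (hgc : HasCompactSupport g) {k : ℝ} (hk : 0 < k) (c : ℝ) :
    ∃ b C, Prof (fun s => c * ∫ t in (0:ℝ)..s, Real.smoothTransition (k * t - 1) * g t) (1 / k) b C := by
  obtain ⟨b0, hb0⟩ := hgc.isCompact.isBounded.subset_closedBall 0
  have hh : ContDiff ℝ ∞ fun t => Real.smoothTransition (k * t - 1) * g t := by
    apply ContDiff.mul _ hg
    exact Real.smoothTransition.contDiff.comp ((contDiff_const.mul contDiff_id).sub contDiff_const)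
  have hd : ∀ s, HasDerivAt (fun s => ∫ t in (0:ℝ)..s, Real.smoothTransition (k * t - 1) * g t) (Real.smoothTransition (k * s - 1) * g s) s := fun s =>
    intervalIntegral.integral_hasDerivAt_right (hh.continuous.intervalIntegrable _ _)
      (hh.continuous.stronglyMeasurableAtFilter _ _) hh.continuous.continuousAt
  refine ⟨|b0|+1, c * ∫ t in (0:ℝ)..(|b0|+1), Real.smoothTransition (k * t - 1) * g t, ?_, by positivity, ?_, ?_⟩
  · apply contDiff_const.mul
    rw [contDiff_infty_iff_deriv]
    refine ⟨fun s => (hd s).differentiableAt, ?_⟩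
    rw [show deriv (fun s => ∫ t in (0:ℝ)..s, Real.smoothTransition (k * t - 1) * g t) = _ from funext fun s => (hd s).deriv]
    exact hh
  · intro s hs
    have : ∫ t in (0:ℝ)..s, Real.smoothTransition (k * t - 1) * g t = ∫ t in (0:ℝ)..s, 0 := by
      apply intervalIntegral.integral_congr
      intro t ht
      have : t ≤ 1 / k := ht.2.trans (max_le (by positivity) hs)
      have : k * t ≤ 1 := by rw [le_div_iff₀ hk] at this; linarith
      beta_reduce
      rw [Real.smoothTransition.zero_of_nonpos (by linarith), zero_mul]
    rw [this]; simp
  · intro s hs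
    beta_reduce
    rw [← intervalIntegral.integral_add_adjacent_intervals (hh.continuous.intervalIntegrable 0 (|b0|+1)) (hh.continuous.intervalIntegrable (|b0|+1) s)]
    have : ∫ t in (|b0|+1)..s, Real.smoothTransition (k * t - 1) * g t = ∫ t in (|b0|+1)..s, 0 := by
      apply intervalIntegral.integral_congr
      intro t ht
      rw [uIcc_of_le hs] at ht
      beta_reduce
      rw [image_eq_zero_of_notMem_tsupport (f := g), mul_zero]
      intro hh
      have := hb0 hh
      simp only [Metric.mem_closedBall, dist_zero_right, Real.norm_eq_abs] at this
      linarith [ht.1, le_abs_self t, le_abs_self b0]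
    rw [this]; simp

lemma prof_limit {S B : ℝ} (hS : MTB S) {g0 : ℝ → ℝ} (hm : Measurable g0) (hb : ∀ t, |g0 t| ≤ 1/2)
    (h0 : ∀ t, t ∉ Ioc 0 B → g0 t = 0) (hE : ∫ t, g0 t ^ 2 ≤ 1) :
    ∫⁻ s in Ioi (0:ℝ), ENNReal.ofReal ((Real.exp ((∫ t in (0:ℝ)..s, g0 t) ^ 2) - 1) * Real.exp (-s)) ≤ ENNReal.ofReal (π * S / 16) := by
  have hL : MemLp g0 2 volume := by
    have h1 : MemLp g0 2 (volume.restrict (Ioc 0 B)) := MemLp.of_bound hm.aestronglyMeasurable (1/2) (Eventually.of_forall hb)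
    rw [← memLp_indicator_iff_restrict measurableSet_Ioc] at h1
    have : (Ioc 0 B).indicator g0 = g0 := by
      rw [indicator_eq_self]; intro t ht; by_contra hh; exact ht (h0 t hh)
    rwa [this] at h1
  have ex : ∀ n : ℕ, ∃ g : ℝ → ℝ, HasCompactSupport g ∧ ContDiff ℝ ∞ g ∧ eLpNorm (g0 - g) 2 volume ≤ ENNReal.ofReal (1 / ((n:ℝ) + 1)) := fun n =>
    hL.exist_eLpNorm_sub_le (by norm_num) (by norm_num) (by positivity)
  choose g gc gs ge using ex
  have gL : ∀ n, MemLp (g n) 2 volume := fun n => (gs n).continuous.memLp_of_hasCompactSupport (gc n)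
  have gd2 : ∀ n, ∫ t, (g0 t - g n t) ^ 2 ≤ (1 / ((n:ℝ) + 1)) ^ 2 := by
    intro n
    have := ge n
    rw [eLp_two (hL.sub (gL n)), ENNReal.ofReal_le_ofReal_iff (by positivity), Real.sqrt_le_left (by positivity)] at this
    simpa using this
  have g2 : ∀ n, ∫ t, (g n t) ^ 2 ≤ (1 + 1 / ((n:ℝ) + 1)) ^ 2 := by
    intro n
    have h1 : eLpNorm (g n) 2 volume ≤ eLpNorm g0 2 volume + eLpNorm (g0 - g n) 2 volume := by
      have := eLpNorm_sub_le (μ := volume) (p := 2) hL.1 (hL.sub (gL n)).1 (by norm_num)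
      simpa using this
    have h2 : eLpNorm g0 2 volume ≤ ENNReal.ofReal 1 := by
      rw [eLp_two hL]
      apply ENNReal.ofReal_le_ofReal
      rw [Real.sqrt_le_one]; exact hE
    have h3 := h1.trans (add_le_add h2 (ge n))
    rw [← ENNReal.ofReal_add (by norm_num) (by positivity), eLp_two (gL n), ENNReal.ofReal_le_ofReal_iff (by positivity), Real.sqrt_le_left (by positivity)] at h3
    exact h3
  set c : ℕ → ℝ := fun n => (1 + 1 / ((n:ℝ) + 1))⁻¹ with hc
  set χ : ℕ → ℝ → ℝ := fun n t => Real.smoothTransition (((n:ℝ)+1) * t - 1) with hχ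
  set W : ℕ → ℝ → ℝ := fun n s => c n * ∫ t in (0:ℝ)..s, χ n t * g n t with hW
  have χc : ∀ n, Continuous (χ n) := fun n => by
    have := Real.smoothTransition.continuous
    simp only [hχ]; fun_prop
  have χ0 : ∀ n t, 0 ≤ χ n t := fun n t => Real.smoothTransition.nonneg _
  have χ1 : ∀ n t, χ n t ≤ 1 := fun n t => Real.smoothTransition.le_one _
  have bd : ∀ n, ∫⁻ s in Ioi (0:ℝ), ENNReal.ofReal ((Real.exp (W n s ^ 2) - 1) * Real.exp (-s)) ≤ ENNReal.ofReal (π * S / 16) := by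
    intro n
    obtain ⟨b, C, hP⟩ := prof_mk (gs n) (gc n) (k := (n:ℝ)+1) (by positivity) (c n)
    apply hP.bound hS
    have hcont : Continuous fun t => χ n t * g n t := (χc n).mul (gs n).continuous
    have hd : ∀ s, deriv (fun s => c n * ∫ t in (0:ℝ)..s, Real.smoothTransition (((n:ℝ)+1) * t - 1) * g n t) s = c n * (χ n s * g n s) := fun s =>
      ((intervalIntegral.integral_hasDerivAt_right (hcont.intervalIntegrable _ _)
      (hcont.stronglyMeasurableAtFilter _ _) hcont.continuousAt).const_mul (c n)).deriv
    simp only [hd]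
    calc _ ≤ ∫⁻ s, ENNReal.ofReal ((c n * (χ n s * g n s)) ^ 2) := setLIntegral_le_lintegral _ _
      _ ≤ ∫⁻ s, ENNReal.ofReal (c n ^ 2 * g n s ^ 2) := by
        apply lintegral_mono
        intro s
        apply ENNReal.ofReal_le_ofReal
        rw [mul_pow, mul_pow]
        have := mul_le_mul_of_nonneg_right (pow_le_one₀ (χ0 n s) (χ1 n s) : χ n s ^ 2 ≤ 1) (sq_nonneg (g n s))
        nlinarith [sq_nonneg (c n)]
      _ = ENNReal.ofReal (∫ s, c n ^ 2 * g n s ^ 2) := by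
        rw [ofReal_integral_eq_lintegral_ofReal ((gL n).integrable_sq.const_mul _) (Eventually.of_forall fun _ => by positivity)]
      _ ≤ 1 := by
        rw [ENNReal.ofReal_le_one, integral_const_mul]
        have := g2 n
        have hp : (0:ℝ) < 1 + 1 / ((n:ℝ) + 1) := by positivity
        rw [hc]
        beta_reduce
        rw [inv_pow, inv_mul_le_iff₀ (by positivity), mul_one]
        exact this
  have ct : Tendsto c atTop (𝓝 1) := by
    have := (tendsto_one_div_add_atTop_nhds_zero_nat (𝕜 := ℝ)).const_add 1
    have := this.inv₀ (by norm_num)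
    simpa [hc] using this
  have Wt : ∀ s ∈ Ioi (0:ℝ), Tendsto (fun n => W n s) atTop (𝓝 (∫ t in (0:ℝ)..s, g0 t)) := by
    intro s hs
    have hs : (0:ℝ) < s := hs
    rw [← one_mul (∫ t in (0:ℝ)..s, g0 t)]
    apply ct.mul
    have i0 : IntervalIntegrable g0 volume 0 s := by
      rw [intervalIntegrable_iff]
      have : IsFiniteMeasure (volume.restrict (uIoc 0 s)) := ⟨by simp [uIoc_of_le hs.le]⟩
      exact Integrable.of_bound hm.aestronglyMeasurable (1/2) (Eventually.of_forall hb)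
    have ig : ∀ n, IntervalIntegrable (g n) volume 0 s := fun n => (gs n).continuous.intervalIntegrable _ _
    have id : ∀ n, IntervalIntegrable (fun t => χ n t * (g n t - g0 t)) volume 0 s := fun n => ((ig n).sub i0).continuousOn_mul (χc n).continuousOn
    have ie : ∀ n, IntervalIntegrable (fun t => χ n t * g0 t) volume 0 s := fun n => i0.continuousOn_mul (χc n).continuousOn
    have e : ∀ n, ∫ t in (0:ℝ)..s, χ n t * g n t = (∫ t in (0:ℝ)..s, χ n t * (g n t - g0 t)) + ∫ t in (0:ℝ)..s, χ n t * g0 t := by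
      intro n
      rw [← intervalIntegral.integral_add (id n) (ie n)]
      congr 1; ext t; ring
    simp only [e]
    rw [← zero_add (∫ t in (0:ℝ)..s, g0 t)]
    apply Tendsto.add
    · apply squeeze_zero_norm (a := fun n : ℕ => √s * (1 / ((n:ℝ)+1)))
      · intro n
        have cs := cs_int (μ := volume.restrict (Ioc 0 s)) (f := χ n) (g := fun t => g n t - g0 t)
          (((χc n).pow 2).integrableOn_Icc.mono_set Ioc_subset_Icc_self) ((gL n).sub hL).integrable_sq.restrict
          ((intervalIntegrable_iff_integrableOn_Ioc_of_le hs.le).1 (id n))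
        rw [intervalIntegral.integral_of_le hs.le, Real.norm_eq_abs]
        apply abs_le_of_sq_le_sq _ (by positivity)
        apply cs.trans
        have k1 : ∫ t in Ioc 0 s, χ n t ^ 2 ≤ s := by
          have : ∫ t in Ioc 0 s, χ n t ^ 2 ≤ ∫ t in Ioc 0 s, (1:ℝ) := by
            apply setIntegral_mono (((χc n).pow 2).integrableOn_Icc.mono_set Ioc_subset_Icc_self) (by simp)
            intro t
            exact pow_le_one₀ (χ0 n t) (χ1 n t)
          refine this.trans ?_
          simp [hs.le]
        have k2 : ∫ t in Ioc 0 s, (g n t - g0 t) ^ 2 ≤ (1 / ((n:ℝ) + 1)) ^ 2 := by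
          refine (setIntegral_le_integral ((gL n).sub hL).integrable_sq (Eventually.of_forall fun _ => by positivity)).trans ?_
          refine le_trans (le_of_eq ?_) (gd2 n)
          congr 1; ext t; simp only [Pi.sub_apply]; ring
        rw [mul_pow, Real.sq_sqrt hs.le]
        exact mul_le_mul k1 k2 (integral_nonneg fun _ => by positivity) hs.le
      · have := (tendsto_one_div_add_atTop_nhds_zero_nat (𝕜 := ℝ)).const_mul (√s)
        simpa using this
    · apply intervalIntegral.tendsto_integral_filter_of_dominated_convergence (fun t => |g0 t|)
      · exact Eventually.of_forall fun n => ((χc n).measurable.mul hm).aestronglyMeasurable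
      · refine Eventually.of_forall fun n => Eventually.of_forall fun t _ => ?_
        rw [norm_mul, Real.norm_eq_abs, Real.norm_eq_abs, abs_of_nonneg (χ0 n t)]
        exact mul_le_of_le_one_left (abs_nonneg _) (χ1 n t)
      · exact i0.abs
      · refine Eventually.of_forall fun t ht => ?_
        rw [uIoc_of_le hs.le] at ht
        apply tendsto_const_nhds.congr'
        have := tendsto_natCast_atTop_atTop.eventually_ge_atTop (2 / t)
        filter_upwards [this] with n hn
        rw [div_le_iff₀ ht.1] at hn
        simp only [hχ]
        rw [Real.smoothTransition.one_of_one_le, one_mul]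
        nlinarith [ht.1]
  calc _ ≤ ∫⁻ s in Ioi (0:ℝ), liminf (fun n => ENNReal.ofReal ((Real.exp (W n s ^ 2) - 1) * Real.exp (-s))) atTop := by
        apply setLIntegral_mono' measurableSet_Ioi
        intro s hs
        have : Tendsto (fun n => ENNReal.ofReal ((Real.exp (W n s ^ 2) - 1) * Real.exp (-s))) atTop
            (𝓝 (ENNReal.ofReal ((Real.exp ((∫ t in (0:ℝ)..s, g0 t) ^ 2) - 1) * Real.exp (-s)))) := by
          apply ENNReal.tendsto_ofReal
          exact ((((Wt s hs).pow 2).rexp).sub_const 1).mul_const _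
        exact this.liminf_eq.ge
    _ ≤ liminf (fun n => ∫⁻ s in Ioi (0:ℝ), ENNReal.ofReal ((Real.exp (W n s ^ 2) - 1) * Real.exp (-s))) atTop := by
        apply lintegral_liminf_le
        intro n
        obtain ⟨b, C, hP⟩ := prof_mk (gs n) (gc n) (k := (n:ℝ)+1) (by positivity) (c n)
        have : Measurable (W n) := hP.sm.continuous.measurable
        fun_prop
    _ ≤ _ := by
        apply liminf_le_of_le
        · isBoundedDefault
        · intro b hb
          obtain ⟨n, hn⟩ := hb.exists
          exact hn.trans (bd n)

noncomputable def g0 (t : ℝ) : ℝ :=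
  if t ≤ 0 then 0 else if t ≤ 2 then 1/2 else if t ≤ 1 + Real.exp 2 then 1 / (2 * √(t - 1)) else 0

lemma g0_meas : Measurable g0 := by
  unfold g0
  refine Measurable.ite measurableSet_Iic measurable_const ?_
  refine Measurable.ite measurableSet_Iic measurable_const ?_
  exact Measurable.ite measurableSet_Iic (by fun_prop) measurable_const

lemma g0_zero (t : ℝ) (ht : t ∉ Ioc 0 (1 + Real.exp 2)) : g0 t = 0 := by
  unfold g0
  have := Real.add_one_le_exp (2:ℝ)
  split_ifs with h1 h2 h3
  · rfl
  · exact absurd ⟨not_le.1 h1, by linarith⟩ ht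
  · exact absurd ⟨not_le.1 h1, by linarith⟩ ht
  · rfl

lemma g0_bd (t : ℝ) : |g0 t| ≤ 1/2 := by
  unfold g0
  split_ifs with h1 h2 h3
  · simp
  · rw [abs_of_pos (by norm_num)]
  · have h : 1 ≤ √(t - 1) := Real.one_le_sqrt.2 (by linarith)
    rw [abs_of_nonneg (by positivity), div_le_div_iff₀ (by positivity) (by norm_num)]
    linarith
  · simp

lemma g0_1 {t : ℝ} (h : 0 < t) (h2 : t ≤ 2) : g0 t = 1/2 := by
  unfold g0; rw [if_neg (by linarith), if_pos h2]
lemma g0_2 {t : ℝ} (h : 2 < t) (h2 : t ≤ 1 + Real.exp 2) : g0 t = 1 / (2 * √(t - 1)) := by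
  unfold g0; rw [if_neg (by linarith), if_neg (by linarith), if_pos h2]
lemma g0_3 {t : ℝ} (h : 1 + Real.exp 2 < t) : g0 t = 0 := g0_zero t fun hh => by linarith [hh.2]

lemma g0_int (a b : ℝ) : IntervalIntegrable g0 volume a b := by
  rw [intervalIntegrable_iff]
  have : IsFiniteMeasure (volume.restrict (uIoc a b)) := ⟨by simp [uIoc]⟩
  exact Integrable.of_bound g0_meas.aestronglyMeasurable (1/2) (Eventually.of_forall g0_bd)

lemma g0_sq_int (a b : ℝ) : IntervalIntegrable (fun t => g0 t ^ 2) volume a b := by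
  rw [intervalIntegrable_iff]
  have : IsFiniteMeasure (volume.restrict (uIoc a b)) := ⟨by simp [uIoc]⟩
  refine Integrable.of_bound (g0_meas.pow_const 2).aestronglyMeasurable (1/4) (Eventually.of_forall fun t => ?_)
  have := g0_bd t
  rw [Real.norm_eq_abs, abs_of_nonneg (sq_nonneg _), ← sq_abs]
  nlinarith [abs_nonneg (g0 t)]

lemma e2_gt : (1:ℝ) < Real.exp 2 := by rw [← Real.exp_zero]; exact Real.exp_lt_exp.2 (by norm_num)

/-- fundamental theorem for functions built from `g0` -/
lemma g0_ftc {q : ℝ → ℝ} {P : ℝ → ℝ} (hP : Continuous P) (hq : ∀ a b, IntervalIntegrable q volume a b)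
    (d1 : ∀ t, 0 < t → t < 2 → HasDerivAt P (q t) t)
    (d2 : ∀ t, 2 < t → t < 1 + Real.exp 2 → HasDerivAt P (q t) t)
    (d3 : ∀ t, 1 + Real.exp 2 < t → HasDerivAt P (q t) t) {s : ℝ} (hs : 0 ≤ s) :
    ∫ t in (0:ℝ)..s, q t = P s - P 0 := by
  refine integral_eq_of_hasDerivAt_off_countable_of_le P q hs (s := {2, 1 + Real.exp 2}) (by simp) hP.continuousOn ?_ (hq _ _)
  rintro t ⟨ht, htn⟩
  simp only [mem_insert_iff, mem_singleton_iff, not_or] at htn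
  rcases lt_or_gt_of_ne htn.1 with h | h
  · exact d1 t ht.1 h
  rcases lt_or_gt_of_ne htn.2 with h' | h'
  · exact d2 t h h'
  · exact d3 t h'

noncomputable def W0 (s : ℝ) : ℝ := min s 2 / 2 + √(max 1 (min (s - 1) (Real.exp 2))) - 1

lemma W0_1 {s : ℝ} (h : s ≤ 2) : W0 s = s / 2 := by
  unfold W0
  rw [min_eq_left h, max_eq_left ((min_le_left _ _).trans (by linarith))]; simp
lemma W0_2 {s : ℝ} (h : 2 ≤ s) (h2 : s ≤ 1 + Real.exp 2) : W0 s = √(s - 1) := by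
  unfold W0
  rw [min_eq_right h, min_eq_left (by linarith), max_eq_right (by linarith)]; ring
lemma W0_3 {s : ℝ} (h : 1 + Real.exp 2 ≤ s) : W0 s = Real.exp 1 := by
  unfold W0
  have := e2_gt
  rw [min_eq_right (by linarith), min_eq_right (by linarith), max_eq_right this.le,
    show Real.exp 2 = Real.exp 1 ^ 2 by rw [← Real.exp_nat_mul]; norm_num, Real.sqrt_sq (Real.exp_pos _).le]
  ring

lemma W0_eq {s : ℝ} (hs : 0 ≤ s) : ∫ t in (0:ℝ)..s, g0 t = W0 s := by
  rw [g0_ftc (P := W0) (by unfold W0; fun_prop) g0_int _ _ _ hs, W0_1 (s := 0) (by norm_num)]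
  · simp
  · intro t h1 h2
    rw [g0_1 h1 h2.le]
    refine ((hasDerivAt_id t).div_const 2).congr_of_eventuallyEq ?_
    filter_upwards [Iio_mem_nhds h2] with x hx
    exact W0_1 (le_of_lt hx)
  · intro t h1 h2
    rw [g0_2 h1 h2.le]
    refine HasDerivAt.congr_of_eventuallyEq (((hasDerivAt_id t).sub_const 1).sqrt (by simp; linarith)) ?_
    filter_upwards [Ioo_mem_nhds h1 h2] with x hx
    exact W0_2 hx.1.le hx.2.le
  · intro t h1
    rw [g0_3 h1]
    refine (hasDerivAt_const t (Real.exp 1)).congr_of_eventuallyEq ?_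
    filter_upwards [Ioi_mem_nhds h1] with x hx
    exact W0_3 (le_of_lt hx)

noncomputable def E0 (s : ℝ) : ℝ := min s 2 / 4 + Real.log (max 1 (min (s - 1) (Real.exp 2))) / 4

lemma g0_energy : ∫ t, g0 t ^ 2 = 1 := by
  have e2 := e2_gt
  have e : ∫ t, g0 t ^ 2 = ∫ t in (0:ℝ)..(1 + Real.exp 2), g0 t ^ 2 := by
    rw [intervalIntegral.integral_of_le (by linarith), setIntegral_eq_integral_of_forall_compl_eq_zero]
    intro t ht
    rw [g0_zero t ht]; simp
  rw [e, g0_ftc (P := E0) _ g0_sq_int _ _ _ (by linarith)]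
  · simp only [E0]
    rw [min_eq_right (by linarith), min_eq_right (by linarith), max_eq_right (by linarith), min_eq_left (by linarith), min_eq_left (by linarith), max_eq_left (by linarith), Real.log_exp]
    simp; norm_num
  · unfold E0
    have : Continuous fun s : ℝ => Real.log (max 1 (min (s - 1) (Real.exp 2))) := by
      apply Continuous.log (by fun_prop)
      intro s
      exact (zero_lt_one.trans_le (le_max_left _ _)).ne'
    fun_prop
  · intro t h1 h2
    rw [g0_1 h1 h2.le]
    refine (((hasDerivAt_id t).div_const 4).congr_deriv (by norm_num)).congr_of_eventuallyEq ?_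
    filter_upwards [Iio_mem_nhds h2] with x hx
    have hx : x < 2 := hx
    unfold E0
    rw [min_eq_left hx.le, max_eq_left ((min_le_left _ _).trans (by linarith))]; simp
  · intro t h1 h2
    rw [g0_2 h1 h2.le]
    have := ((((hasDerivAt_id t).sub_const 1).log (by simp; linarith)).div_const 4).const_add (1/2 : ℝ)
    refine (this.congr_deriv ?_).congr_of_eventuallyEq ?_
    · rw [div_pow, mul_pow, Real.sq_sqrt (by linarith)]
      simp
      rw [div_eq_inv_mul, mul_comm]; norm_num
    filter_upwards [Ioo_mem_nhds h1 h2] with x hx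
    unfold E0
    rw [min_eq_right hx.1.le, min_eq_left (by linarith [hx.2]), max_eq_right (by linarith [hx.1])]
    simp; norm_num
  · intro t h1
    rw [g0_3 h1]
    refine ((hasDerivAt_const t (1 : ℝ)).congr_deriv (by norm_num)).congr_of_eventuallyEq ?_
    filter_upwards [Ioi_mem_nhds h1] with x hx
    have hx : 1 + Real.exp 2 < x := hx
    unfold E0
    rw [min_eq_right (by linarith), min_eq_right (by linarith), max_eq_right (by linarith), Real.log_exp]
    norm_num

lemma exp_quad {y : ℝ} (hy : 0 ≤ y) : 1 + y + y ^ 2 / 2 ≤ Real.exp y := Real.quadratic_le_exp_of_nonneg hy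

theorem MTB.lower {S : ℝ} (h : MTB S) : 16 * Real.exp 1 / π < S := by
  have e2 := e2_gt
  have hl := prof_limit h g0_meas g0_bd g0_zero g0_energy.le
  have hl2 : ∫⁻ s in Ioi (0:ℝ), ENNReal.ofReal ((Real.exp (W0 s ^ 2) - 1) * Real.exp (-s)) ≤ ENNReal.ofReal (π * S / 16) := by
    refine le_trans (le_of_eq ?_) hl
    apply setLIntegral_congr_fun measurableSet_Ioi
    intro s hs
    beta_reduce
    rw [W0_eq (le_of_lt hs)]
  set G : ℝ → ℝ := fun s => (Real.exp (W0 s ^ 2) - 1) * Real.exp (-s) with hG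
  have Wc : Continuous W0 := by unfold W0; fun_prop
  have Gc : Continuous G := by simp only [hG]; fun_prop
  have G0 : ∀ s, 0 ≤ G s := fun s => mul_nonneg (by linarith [Real.one_le_exp (sq_nonneg (W0 s))]) (Real.exp_pos _).le
  have Gi : IntegrableOn G (Ioi 0) := by
    refine ⟨Gc.aestronglyMeasurable, ?_⟩
    rw [hasFiniteIntegral_iff_ofReal (Eventually.of_forall G0)]
    exact hl2.trans_lt ENNReal.ofReal_lt_top
  have hS0 := h.nonneg
  have Gle : ∫ s in Ioi (0:ℝ), G s ≤ π * S / 16 := by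
    rw [← ofReal_integral_eq_lintegral_ofReal Gi (Eventually.of_forall G0), ENNReal.ofReal_le_ofReal_iff (by have := Real.pi_pos; positivity)] at hl2
    exact hl2
  have hsplit : ∫ s in Ioi (0:ℝ), G s = (∫ s in (0:ℝ)..2, G s) + (∫ s in (2:ℝ)..(1 + Real.exp 2), G s) + ∫ s in Ioi (1 + Real.exp 2), G s := by
    rw [intervalIntegral.integral_add_adjacent_intervals (Gc.intervalIntegrable _ _) (Gc.intervalIntegrable _ _)]
    rw [intervalIntegral.integral_interval_add_Ioi Gi (Gi.mono_set (Ioi_subset_Ioi (by linarith)))]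
  have p1 : Real.exp (-1) * (2 + 2/3 + 1/5) + Real.exp (-2) - 1 ≤ ∫ s in (0:ℝ)..2, G s := by
    have hd : ∀ s : ℝ, HasDerivAt (fun s : ℝ => Real.exp (-1) * (s + 2 * (s/2 - 1)^3/3 + (s/2-1)^5/5) + Real.exp (-s))
        (Real.exp (-1) * (1 + (s/2 - 1)^2 + ((s/2-1)^2)^2/2) - Real.exp (-s)) s := by
      intro s
      have a1 := ((hasDerivAt_id s).div_const 2).sub_const 1
      have := ((((hasDerivAt_id s).add (((a1.pow 3).const_mul 2).div_const 3)).add ((a1.pow 5).div_const 5)).const_mul (Real.exp (-1))).add (hasDerivAt_id s).neg.exp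
      refine this.congr_deriv ?_
      simp; ring
    have hi := intervalIntegral.integral_eq_sub_of_hasDerivAt (a := 0) (b := 2) (fun s _ => hd s) ((by fun_prop : Continuous fun s : ℝ => Real.exp (-1) * (1 + (s/2 - 1)^2 + ((s/2-1)^2)^2/2) - Real.exp (-s)).intervalIntegrable _ _)
    have hle : ∫ s in (0:ℝ)..2, (Real.exp (-1) * (1 + (s/2 - 1)^2 + ((s/2-1)^2)^2/2) - Real.exp (-s)) ≤ ∫ s in (0:ℝ)..2, G s := by
      apply intervalIntegral.integral_mono_on (by norm_num) ((by fun_prop : Continuous fun s : ℝ => Real.exp (-1) * (1 + (s/2 - 1)^2 + ((s/2-1)^2)^2/2) - Real.exp (-s)).intervalIntegrable _ _) (Gc.intervalIntegrable _ _)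
      intro s hs
      simp only [hG]
      rw [W0_1 hs.2, sub_mul, one_mul, ← Real.exp_add, show (s/2)^2 + -s = -1 + (s/2-1)^2 by ring, Real.exp_add (-1)]
      have := mul_le_mul_of_nonneg_left (exp_quad (sq_nonneg (s/2-1))) (Real.exp_pos (-1)).le
      linarith
    rw [hi] at hle
    norm_num at hle ⊢
    linarith
  have p2 : ∫ s in (2:ℝ)..(1 + Real.exp 2), G s = Real.exp (-1) * (Real.exp 2 - 1) + Real.exp (-(1 + Real.exp 2)) - Real.exp (-2) := by
    have hd : ∀ s : ℝ, HasDerivAt (fun s : ℝ => Real.exp (-1) * s + Real.exp (-s))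
        (Real.exp (-1) - Real.exp (-s)) s := by
      intro s
      have := ((hasDerivAt_id s).const_mul (Real.exp (-1))).add (hasDerivAt_id s).neg.exp
      refine this.congr_deriv ?_
      simp; ring
    have hi := intervalIntegral.integral_eq_sub_of_hasDerivAt (a := 2) (b := 1 + Real.exp 2) (fun s _ => hd s) ((by fun_prop : Continuous fun s : ℝ => Real.exp (-1) - Real.exp (-s)).intervalIntegrable _ _)
    have : ∫ s in (2:ℝ)..(1 + Real.exp 2), G s = ∫ s in (2:ℝ)..(1 + Real.exp 2), (Real.exp (-1) - Real.exp (-s)) := by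
      apply intervalIntegral.integral_congr
      intro s hs
      rw [uIcc_of_le (by linarith)] at hs
      simp only [hG]
      rw [W0_2 hs.1 hs.2, Real.sq_sqrt (by linarith [hs.1]), sub_mul, one_mul, ← Real.exp_add]
      congr 2; ring
    rw [this, hi]
    ring
  have p3 : ∫ s in Ioi (1 + Real.exp 2), G s = Real.exp (-1) - Real.exp (-(1 + Real.exp 2)) := by
    have : ∫ s in Ioi (1 + Real.exp 2), G s = ∫ s in Ioi (1 + Real.exp 2), (Real.exp (Real.exp 2) - 1) * Real.exp (-s) := by
      apply setIntegral_congr_fun measurableSet_Ioi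
      intro s hs
      simp only [hG]
      rw [W0_3 (le_of_lt hs), ← Real.exp_nat_mul]
      norm_num
    rw [this, integral_const_mul, integral_exp_neg_Ioi, sub_mul, one_mul, ← Real.exp_add]
    congr 2; ring
  have ee : Real.exp (-1) * Real.exp 2 = Real.exp 1 := by rw [← Real.exp_add]; norm_num
  have e1 : Real.exp (-1) * Real.exp 1 = 1 := by rw [← Real.exp_add]; norm_num
  have hlt := Real.exp_one_lt_d9
  have hpos := Real.exp_pos (-1)
  have fin : Real.exp 1 < π * S / 16 := by
    have : 1 < Real.exp (-1) * (2 + 2/3 + 1/5) := by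
      have := mul_lt_mul_of_pos_left (show Real.exp 1 < 2 + 2/3 + 1/5 by linarith) hpos
      linarith
    nlinarith
  rw [div_lt_iff₀ Real.pi_pos]
  linarith

theorem four_pi_lt : 4 * π < 16 * Real.exp 1 / π := by
  rw [lt_div_iff₀ Real.pi_pos]
  have h1 := Real.pi_lt_d2
  have h2 := Real.exp_one_gt_d9
  nlinarith [Real.pi_pos]

noncomputable def Liso : ℂ ≃ₗᵢ[ℝ] EuclideanSpace ℝ (Fin 2) := Complex.orthonormalBasisOneI.repr

lemma Liso_mp : MeasurePreserving Liso := Liso.measurePreserving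

lemma Liso_mem (z : ℂ) : Liso z ∈ strip ↔ z ∈ SH 1 := by
  have : (Liso z) 1 = z.im := by simp [Liso]
  simp only [strip, SH, mem_ofPred_eq, this, mem_Ioo, abs_lt]

lemma Liso_pre : Liso ⁻¹' strip = SH 1 := by ext z; exact Liso_mem z

lemma Liso_int (H : EuclideanSpace ℝ (Fin 2) → ℝ) : ∫ x in strip, H x = ∫ z in SH 1, H (Liso z) := by
  rw [← Liso_pre, Liso_mp.setIntegral_preimage_emb Liso.toHomeomorph.measurableEmbedding]

lemma Liso_fderiv (u : EuclideanSpace ℝ (Fin 2) → ℝ) (z : ℂ) : ‖fderiv ℝ (fun z => u (Liso z)) z‖ = ‖fderiv ℝ u (Liso z)‖ := by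
  have := Liso.toContinuousLinearEquiv.comp_right_fderiv (f := u) (x := z)
  have e : (u ∘ Liso.toContinuousLinearEquiv) = fun z => u (Liso z) := rfl
  rw [e] at this
  rw [this]
  exact ContinuousLinearMap.opNorm_comp_linearIsometryEquiv _ Liso

lemma Liso_fwd {u : EuclideanSpace ℝ (Fin 2) → ℝ} (h : IsTest strip u) : TestOn (SH 1) (fun z => u (Liso z)) := by
  obtain ⟨h1, h2, h3⟩ := h
  refine ⟨h1.comp Liso.contDiff, h2.comp_homeomorph Liso.toHomeomorph, ?_⟩
  have := tsupport_comp_eq_preimage u Liso.toHomeomorph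
  have e : (u ∘ Liso.toHomeomorph) = fun z => u (Liso z) := rfl
  rw [e] at this
  rw [this, ← Liso_pre]
  exact preimage_mono h3

lemma Liso_bwd {v : ℂ → ℝ} (h : TestOn (SH 1) v) : IsTest strip (fun x => v (Liso.symm x)) := by
  obtain ⟨h1, h2, h3⟩ := h
  refine ⟨h1.comp Liso.symm.contDiff, h2.comp_homeomorph Liso.symm.toHomeomorph, ?_⟩
  have := tsupport_comp_eq_preimage v Liso.symm.toHomeomorph
  have e : (v ∘ Liso.symm.toHomeomorph) = fun z => v (Liso.symm z) := rfl
  rw [e] at this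
  rw [this]
  intro x hx
  have := h3 hx
  have h4 := (Liso_mem (Liso.symm x)).2 this
  simpa using h4

lemma Liso_En {u : EuclideanSpace ℝ (Fin 2) → ℝ} (h : TestOn (SH 1) (fun z => u (Liso z))) :
    ∫ x in strip, ‖fderiv ℝ u x‖ ^ 2 = En (fun z => u (Liso z)) := by
  rw [Liso_int, En]
  simp only [← Liso_fderiv]
  apply setIntegral_eq_integral_of_forall_compl_eq_zero
  intro z hz
  rw [h.dU hz]; simp

lemma Liso_Fn {u : EuclideanSpace ℝ (Fin 2) → ℝ} (h : ∀ᵐ z, z ∉ SH 1 → u (Liso z) = 0) :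
    ∫ x in strip, (Real.exp (4 * π * u x ^ 2) - 1) = Fn (fun z => u (Liso z)) := by
  rw [Liso_int, Fn]
  apply setIntegral_eq_integral_of_ae_compl_eq_zero
  filter_upwards [h] with z hz hn
  rw [hz hn]; simp

theorem strip_extremal_aux :
    ∃ (ut : EuclideanSpace ℝ (Fin 2) → ℝ) (φ : ℕ → EuclideanSpace ℝ (Fin 2) → ℝ),
      Measurable ut ∧
      (∀ j : ℕ, IsTest strip (φ j) ∧ (∫ x in strip, ‖fderiv ℝ (φ j) x‖ ^ 2) ≤ 1) ∧
      (∀ᵐ x ∂(volume.restrict strip), Tendsto (fun j => φ j x) atTop (nhds (ut x))) ∧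
      (∫ x in strip, (Real.exp (4 * Real.pi * ut x ^ 2) - 1)) =
        sSup {r : ℝ | ∃ u : EuclideanSpace ℝ (Fin 2) → ℝ, IsTest strip u ∧
          (∫ x in strip, ‖fderiv ℝ u x‖ ^ 2) ≤ 1 ∧
          r = ∫ x in strip, (Real.exp (4 * Real.pi * u x ^ 2) - 1)} := by
  set A := {r : ℝ | ∃ u : EuclideanSpace ℝ (Fin 2) → ℝ, IsTest strip u ∧
          (∫ x in strip, ‖fderiv ℝ u x‖ ^ 2) ≤ 1 ∧
          r = ∫ x in strip, (Real.exp (4 * Real.pi * u x ^ 2) - 1)} with hA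
  have tz : IsTest strip (fun _ => 0) := Liso_bwd TestOn.zero
  by_cases hbdd : BddAbove A
  swap
  · refine ⟨fun _ => 0, fun _ _ => 0, measurable_const, fun j => ⟨tz, by simp⟩,
      Eventually.of_forall fun x => tendsto_const_nhds, ?_⟩
    rw [Real.sSup_of_not_bddAbove hbdd]
    simp
  have hne : A.Nonempty := ⟨_, _, tz, by simp, rfl⟩
  -- transfer to the complex plane
  have val : ∀ v : ℂ → ℝ, TestOn (SH 1) v →
      ∫ x in strip, (Real.exp (4 * π * v (Liso.symm x) ^ 2) - 1) = Fn v := by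
    intro v hv
    have := Liso_Fn (u := fun x => v (Liso.symm x)) (by simpa using Eventually.of_forall fun z hz => hv.zU hz)
    simpa using this
  have ene : ∀ v : ℂ → ℝ, TestOn (SH 1) v → ∫ x in strip, ‖fderiv ℝ (fun x => v (Liso.symm x)) x‖ ^ 2 = En v := by
    intro v hv
    have := Liso_En (u := fun x => v (Liso.symm x)) (by simpa using hv)
    simpa using this
  have hM : MTB (sSup A) := by
    intro v hv he
    apply le_csSup hbdd
    exact ⟨_, Liso_bwd hv, (ene v hv).le.trans he, (val v hv).symm⟩
  have hsup : ∀ ε > 0, ∃ u, TestOn (SH 1) u ∧ En u ≤ 1 ∧ sSup A - ε < Fn u := by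
    intro ε hε
    obtain ⟨r, ⟨u, hu, he, rfl⟩, hr⟩ := exists_lt_of_lt_csSup hne (show sSup A - ε < sSup A by linarith)
    have ht := Liso_fwd hu
    refine ⟨_, ht, (Liso_En ht).symm.le.trans he, ?_⟩
    rw [← Liso_Fn (Eventually.of_forall fun z hz => ht.zU hz)]
    exact hr
  have hlow := hM.lower
  obtain ⟨u, v, c, s⟩ := exists_maxSeq hM (four_pi_lt.trans hlow) hsup
  have hv : Fn v = sSup A := by
    by_cases hc : ∃ m, 0 < c m
    · obtain ⟨m, hm⟩ := hc
      exact s.caseA hM hm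
    · push Not at hc
      exact absurd (s.vzero hc) (s.caseB hM hlow)
  have hoff : ∀ᵐ z, z ∉ SH 1 → v z = 0 := by
    filter_upwards [s.ae] with z hz hn
    have : (fun n => u n z) = fun _ => 0 := funext fun n => (s.test n).zU hn
    rw [this] at hz
    exact tendsto_nhds_unique hz tendsto_const_nhds
  refine ⟨fun x => v (Liso.symm x), fun j x => u j (Liso.symm x), s.mv.comp Liso.symm.continuous.measurable,
    fun j => ⟨Liso_bwd (s.test j), (ene _ (s.test j)).le.trans (s.en j)⟩, ?_, ?_⟩
  · apply ae_restrict_of_ae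
    exact (Liso.symm.measurePreserving.quasiMeasurePreserving).ae s.ae
  · rw [← hv]
    have := Liso_Fn (u := fun x => v (Liso.symm x)) (by simpa using hoff)
    simpa using this

end Aux

/-- The Moser–Trudinger supremum on the strip `Ω = ℝ × (-1,1)` is attained by a function of
`H¹₀(Ω)`: there are a measurable `ũ` and test functions `φ_j` with Dirichlet energies `≤ 1`
converging a.e. in `Ω` to `ũ` such that `∫_Ω (e^{4π ũ²} - 1)` equals the supremum. -/
theorem strip_extremal_exists :
    ∃ (ut : EuclideanSpace ℝ (Fin 2) → ℝ) (φ : ℕ → EuclideanSpace ℝ (Fin 2) → ℝ),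
      Measurable ut ∧
      (∀ j : ℕ, IsTest strip (φ j) ∧ (∫ x in strip, ‖fderiv ℝ (φ j) x‖ ^ 2) ≤ 1) ∧
      (∀ᵐ x ∂(volume.restrict strip), Tendsto (fun j => φ j x) atTop (nhds (ut x))) ∧
      (∫ x in strip, (Real.exp (4 * Real.pi * ut x ^ 2) - 1)) =
        sSup {r : ℝ | ∃ u : EuclideanSpace ℝ (Fin 2) → ℝ, IsTest strip u ∧
          (∫ x in strip, ‖fderiv ℝ u x‖ ^ 2) ≤ 1 ∧
          r = ∫ x in strip, (Real.exp (4 * Real.pi * u x ^ 2) - 1)} :=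
  strip_extremal_aux
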